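/- arXiv:1108.4709 — 2 statements merged into one kernel-verified Lean document; each statement's English description precedes it below -/
import Mathlib

section
/- Fix positive integers M1, M2, M3, positive integers L1, L2, and a real r > 0. Let H1 and H2 be independent standard complex Gaussian random matrices of sizes M2×M1 and M3×M2 respectively, and for SNR ρ > 1 let C_i(ρ) = log det(I + (ρ/M_i) H_i H_i†). Define the outage probability P_out(ρ) = P( {L1·C_1(ρ) < r·log ρ} ∪ {L2·C_2(ρ) < r·log ρ} ). Then lim_{ρ→∞} log P_out(ρ) / log ρ = − min{ d^{(M1,M2)}(r/L1), d^{(M2,M3)}(r/L2) }. (Theorem 2: DMDT of the fixed ARQ protocol for a three-node MIMO multihop network under the long-term static channel assumption.) -/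
open MeasureTheory ProbabilityTheory

/-- The point values of the diversity-multiplexing tradeoff:
`dmtPt m n k = (m - k) * (n - k)`. -/
noncomputable def dmtPt (m n k : ℕ) : ℝ := ((m : ℝ) - k) * ((n : ℝ) - k)

/-- The diversity-multiplexing tradeoff function `d^{(m,n)}` of an `m × n` MIMO channel:
the piecewise linear function connecting the points `(k, (m-k)(n-k))` for
`k = 0, 1, ..., min m n`, and equal to `0` for arguments `≥ min m n`. -/
noncomputable def dmt (m n : ℕ) (r : ℝ) : ℝ :=
  if ((min m n : ℕ) : ℝ) ≤ r then 0
  else dmtPt m n ⌊r⌋₊ + (r - ⌊r⌋₊) * (dmtPt m n (⌊r⌋₊ + 1) - dmtPt m n ⌊r⌋₊)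

/-- The capacity `log det (I + (ρ / M) H Hᴴ)` of a MIMO channel with matrix `H`,
`M` transmit antennas and SNR `ρ` (the determinant of the Hermitian positive definite
matrix being real, we take the real part). -/
noncomputable def cap {a b : ℕ} (M : ℕ) (ρ : ℝ) (H : Matrix (Fin a) (Fin b) ℂ) : ℝ :=
  Real.log ((1 + ((ρ / M : ℝ) : ℂ) • (H * H.conjTranspose)).det.re)


set_option linter.unusedSectionVars false

open scoped ComplexOrder in
lemma aux_one_le_det {I : Type*} [Fintype I] [DecidableEq I] {P : Matrix I I ℂ}
    (hP : P.PosSemidef) : 1 ≤ (1 + P).det := by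
  have h := hP.1.spectral_theorem
  set U := hP.1.eigenvectorUnitary
  have h2 : (1 + P).det = ∏ i, (1 + (hP.1.eigenvalues i : ℂ)) := by
    conv_lhs => rw [h]
    rw [Unitary.conjStarAlgAut_apply, mul_assoc, Matrix.det_one_add_mul_comm, mul_assoc]
    rw [Unitary.coe_star_mul_self, mul_one, ← Matrix.diagonal_one, Matrix.diagonal_add,
      Matrix.det_diagonal]
    rfl
  rw [h2]
  have : ∏ i, (1 + (hP.1.eigenvalues i : ℂ)) = ((∏ i, (1 + hP.1.eigenvalues i) : ℝ) : ℂ) := by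
    push_cast; rfl
  rw [this]
  norm_cast
  refine le_of_eq_of_le (Finset.prod_const_one (s := (Finset.univ : Finset I))).symm ?_
  refine Finset.prod_le_prod (fun _ _ => zero_le_one) (fun i _ => ?_)
  have := hP.eigenvalues_nonneg i
  linarith

open scoped ComplexOrder in
lemma aux_det_mono {I : Type*} [Fintype I] [DecidableEq I] {A B : Matrix I I ℂ}
    (hA : A.PosDef) (hB : B.PosSemidef) : A.det ≤ (A + B).det := by
  obtain ⟨X, rfl⟩ : ∃ X : Matrix I I ℂ, B = X.conjTranspose * X := by
    open scoped MatrixOrder Matrix.Norms.L2Operator in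
    exact (CStarAlgebra.nonneg_iff_eq_star_mul_self.mp hB.nonneg)
  have hu : IsUnit A.det := isUnit_iff_ne_zero.2 hA.det_pos.ne'
  rw [Matrix.det_add_mul _ _ hu]
  have h1 : (1:ℂ) ≤ (1 + X * A⁻¹ * X.conjTranspose).det :=
    aux_one_le_det (hA.inv.posSemidef.mul_mul_conjTranspose_same X)
  calc A.det = A.det * 1 := by ring
    _ ≤ _ := mul_le_mul_of_nonneg_left h1 hA.det_pos.le

/-- `det (1 + ρ H Hᴴ)` as a real number. -/
noncomputable def dt {I J : Type*} [Fintype I] [Fintype J] [DecidableEq I] (ρ : ℝ)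
    (H : Matrix I J ℂ) : ℝ := (1 + (ρ : ℂ) • (H * H.conjTranspose)).det.re

section
variable {I J K : Type*} [Fintype I] [Fintype J] [Fintype K] [DecidableEq I] [DecidableEq J]
  [DecidableEq K]

open scoped ComplexOrder in
lemma aux_pos_smul {ρ : ℝ} (hρ : 0 ≤ ρ) (H : Matrix I J ℂ) :
    ((ρ : ℂ) • (H * H.conjTranspose)).PosSemidef :=
  (Matrix.posSemidef_self_mul_conjTranspose H).smul (by exact_mod_cast hρ)

open scoped ComplexOrder in
lemma dt_coe {ρ : ℝ} (hρ : 0 ≤ ρ) (H : Matrix I J ℂ) :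
    ((dt ρ H : ℝ) : ℂ) = (1 + (ρ : ℂ) • (H * H.conjTranspose)).det := by
  have := aux_one_le_det (aux_pos_smul hρ H)
  rw [Complex.le_def] at this
  apply Complex.ext
  · simp [dt]
  · simpa using this.2

open scoped ComplexOrder in
lemma one_le_dt {ρ : ℝ} (hρ : 0 ≤ ρ) (H : Matrix I J ℂ) : 1 ≤ dt ρ H := by
  have := aux_one_le_det (aux_pos_smul hρ H)
  rw [← dt_coe hρ] at this
  exact_mod_cast this

lemma dt_conjTranspose (ρ : ℝ) (H : Matrix I J ℂ) : dt ρ H.conjTranspose = dt ρ H := by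
  unfold dt
  rw [← Matrix.smul_mul, Matrix.det_one_add_mul_comm, Matrix.conjTranspose_conjTranspose,
    Matrix.mul_smul]

lemma dt_submatrix {I' J' : Type*} [Fintype I'] [Fintype J'] [DecidableEq I']
    (ρ : ℝ) (H : Matrix I J ℂ) (e : I' ≃ I) (f : J' ≃ J) : dt ρ (H.submatrix e f) = dt ρ H := by
  unfold dt
  rw [Matrix.conjTranspose_submatrix, Matrix.submatrix_mul_equiv,
    ← Matrix.det_submatrix_equiv_self e (1 + (ρ : ℂ) • (H * H.conjTranspose))]
  simp only [Matrix.submatrix_add, Matrix.submatrix_smul, Pi.add_apply, Pi.smul_apply, 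
    Matrix.submatrix_one_equiv]

lemma aux_dot_self {I : Type*} [Fintype I] (y : I → ℂ) :
    star y ⬝ᵥ y = ((∑ i, ‖y i‖ ^ 2 : ℝ) : ℂ) := by
  simp only [dotProduct, Pi.star_apply, RCLike.star_def]
  push_cast
  exact Finset.sum_congr rfl fun i _ => by rw [Complex.conj_mul']

lemma aux_entries_le {I : Type*} [Fintype I] (X : Matrix I I ℂ) (hX : ∀ i j, ‖X i j‖ ≤ 1) :
    ∑ i, ∑ j, ‖X i j‖ ^ 2 ≤ (Fintype.card I : ℝ) ^ 2 := by
  calc _ ≤ ∑ i : I, ∑ j : I, (1:ℝ) := by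
        gcongr with i _ j _
        exact pow_le_one₀ (norm_nonneg _) (hX i j)
    _ = _ := by simp [sq]

open scoped ComplexOrder in
lemma aux_gram_le {k : ℝ} (X : Matrix I J ℂ) (hX : ∑ i, ∑ j, ‖X i j‖ ^ 2 ≤ k) :
    ((k : ℂ) • (1 : Matrix J J ℂ) - X.conjTranspose * X).PosSemidef := by
  refine Matrix.PosSemidef.of_dotProduct_mulVec_nonneg ?_ ?_
  · refine Matrix.IsHermitian.sub ?_ (Matrix.isHermitian_conjTranspose_mul_self X)
    simp [Matrix.IsHermitian]
  · intro x
    have h2 : star x ⬝ᵥ ((X.conjTranspose * X).mulVec x) =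
        ((∑ i, ‖(X.mulVec x) i‖ ^ 2 : ℝ) : ℂ) := by
      rw [← Matrix.mulVec_mulVec, Matrix.dotProduct_mulVec, Matrix.vecMul_conjTranspose, star_star, aux_dot_self]
    rw [Matrix.sub_mulVec, dotProduct_sub, h2, Matrix.smul_mulVec, Matrix.one_mulVec,
      dotProduct_smul, aux_dot_self, smul_eq_mul]
    norm_cast
    rw [sub_nonneg]
    have h3 : ∀ i, ‖(X.mulVec x) i‖ ^ 2 ≤ (∑ j, ‖X i j‖ ^ 2) * ∑ j, ‖x j‖ ^ 2 := by
      intro i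
      have : ‖(X.mulVec x) i‖ ≤ ∑ j, ‖X i j‖ * ‖x j‖ := by
        simp only [Matrix.mulVec, dotProduct]
        exact (norm_sum_le _ _).trans_eq (by simp)
      calc _ ≤ (∑ j, ‖X i j‖ * ‖x j‖) ^ 2 := by gcongr
        _ ≤ _ := Finset.sum_mul_sq_le_sq_mul_sq _ _ _
    calc _ ≤ ∑ i, (∑ j, ‖X i j‖ ^ 2) * ∑ j, ‖x j‖ ^ 2 := Finset.sum_le_sum fun i _ => h3 i
      _ = (∑ i, ∑ j, ‖X i j‖ ^ 2) * ∑ j, ‖x j‖ ^ 2 := by rw [Finset.sum_mul]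
      _ ≤ _ := by gcongr

open scoped ComplexOrder in
lemma dt_mul_left_le {ρ k : ℝ} (hρ : 0 ≤ ρ) (X : Matrix I J ℂ) (H : Matrix J K ℂ)
    (hX : ∑ i, ∑ j, ‖X i j‖ ^ 2 ≤ k) : dt ρ (X * H) ≤ dt (k * ρ) H := by
  have hk : 0 ≤ k := le_trans (by positivity) hX
  rw [← dt_conjTranspose, ← dt_conjTranspose _ H]
  have h := (((aux_gram_le X hX).conjTranspose_mul_mul_same H).smul
    (show (0:ℂ) ≤ (ρ : ℂ) by exact_mod_cast hρ))
  have h2 := aux_det_mono (Matrix.PosDef.one.add_posSemidef (aux_pos_smul hρ (X * H).conjTranspose)) h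
  rw [← dt_coe hρ] at h2
  have h3 : (dt ρ (X * H).conjTranspose : ℂ) ≤ (dt (k * ρ) H.conjTranspose : ℂ) := by
    refine h2.trans_eq ?_
    rw [dt_coe (by positivity), add_assoc]
    congr 2
    simp only [Matrix.conjTranspose_mul, Matrix.conjTranspose_conjTranspose, Matrix.mul_sub,
      Matrix.sub_mul, smul_sub, Matrix.mul_assoc, Matrix.smul_mul, Matrix.mul_smul, Matrix.one_mul,
      smul_smul]
    push_cast
    rw [mul_comm (ρ:ℂ)]
    abel
  exact_mod_cast h3

lemma dt_mul_right_le {ρ k : ℝ} (hρ : 0 ≤ ρ) (X : Matrix J K ℂ) (H : Matrix I J ℂ)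
    (hX : ∑ i, ∑ j, ‖X i j‖ ^ 2 ≤ k) : dt ρ (H * X) ≤ dt (k * ρ) H := by
  rw [← dt_conjTranspose, ← dt_conjTranspose _ H, Matrix.conjTranspose_mul]
  refine dt_mul_left_le hρ _ _ ?_
  rw [Finset.sum_comm]
  simpa using hX

lemma dt_le_of_entries {ρ : ℝ} (hρ : 0 ≤ ρ) (X : Matrix I I ℂ) (Y : Matrix J J ℂ)
    (H : Matrix I J ℂ) (hX : ∀ i j, ‖X i j‖ ≤ 1) (hY : ∀ i j, ‖Y i j‖ ≤ 1) :
    dt ρ (X * H * Y) ≤ dt ((Fintype.card I * Fintype.card J : ℝ) ^ 2 * ρ) H := by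
  rw [Matrix.mul_assoc]
  refine (dt_mul_left_le hρ X _ (aux_entries_le X hX)).trans ?_
  refine (dt_mul_right_le (by positivity) Y _ (aux_entries_le Y hY)).trans_eq ?_
  congr 1
  ring

lemma dt_blockdiag {ρ : ℝ} (hρ : 0 ≤ ρ) (S : Matrix I J ℂ) (a : ℂ) :
    dt ρ (Matrix.fromBlocks S 0 0 (Matrix.of fun (_ _ : Unit) => a)) = dt ρ S * (1 + ρ * ‖a‖ ^ 2) := by
  have : ((dt ρ (Matrix.fromBlocks S 0 0 (Matrix.of fun (_ _ : Unit) => a)) : ℝ) : ℂ) =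
    ((dt ρ S * (1 + ρ * ‖a‖ ^ 2) : ℝ) : ℂ) := by
    rw [dt_coe hρ]
    push_cast
    rw [dt_coe hρ, Matrix.fromBlocks_conjTranspose, Matrix.fromBlocks_multiply,
      Matrix.fromBlocks_smul, ← Matrix.fromBlocks_one, Matrix.fromBlocks_add]
    simp only [Matrix.conjTranspose_zero, Matrix.mul_zero, Matrix.zero_mul, add_zero, smul_zero,
      zero_add]
    rw [Matrix.det_fromBlocks_zero₂₁]
    congr 1
    simp [Matrix.mul_apply, Complex.mul_conj']
  exact_mod_cast this

end

/-- The block matrix with pivot `a`, first row `b`, first column `c` and Schur complement `S`. -/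
noncomputable def asm {m n : ℕ} (a : ℂ) (b : Fin n → ℂ) (c : Fin m → ℂ)
    (S : Fin m → Fin n → ℂ) : Fin (m + 1) → Fin (n + 1) → ℂ :=
  Fin.cons (Fin.cons a b) (fun i => Fin.cons (c i) (fun j => S i j + c i * b j / a))

/-- Reindexing used to split off the first index. -/
def eS (m : ℕ) : Fin m ⊕ Unit ≃ Fin (m + 1) :=
  ((finSuccEquiv m).trans (Equiv.optionEquivSumPUnit _)).symm

lemma asm_submatrix {m n : ℕ} (a : ℂ) (b : Fin n → ℂ) (c : Fin m → ℂ)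
    (S : Fin m → Fin n → ℂ) :
    (Matrix.of (asm a b c S)).submatrix (eS m) (eS n) =
      Matrix.fromBlocks (Matrix.of fun i j => S i j + c i * b j / a) (Matrix.of fun i _ => c i)
        (Matrix.of fun _ j => b j) (Matrix.of fun (_ _ : Unit) => a) := by
  ext i j
  rcases i with i | i <;> rcases j with j | j <;> simp [eS, asm]

/-- Elementary column-elimination factor. -/
noncomputable def eL {m : ℕ} (c : Fin m → ℂ) : Matrix (Fin m ⊕ Unit) (Fin m ⊕ Unit) ℂ :=
  Matrix.fromBlocks 1 (Matrix.of fun i _ => c i) 0 1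

/-- Elementary row-elimination factor. -/
noncomputable def eR {n : ℕ} (b : Fin n → ℂ) : Matrix (Fin n ⊕ Unit) (Fin n ⊕ Unit) ℂ :=
  Matrix.fromBlocks 1 0 (Matrix.of fun _ j => b j) 1

lemma eL_entries {m : ℕ} (c : Fin m → ℂ) (hc : ∀ i, ‖c i‖ ≤ 1) (i j) : ‖eL c i j‖ ≤ 1 := by
  rcases i with i | i <;> rcases j with j | j <;> simp [eL, hc, Matrix.one_apply]
  split_ifs <;> simp

lemma eR_entries {m : ℕ} (c : Fin m → ℂ) (hc : ∀ i, ‖c i‖ ≤ 1) (i j) : ‖eR c i j‖ ≤ 1 := by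
  rcases i with i | i <;> rcases j with j | j <;> simp [eR, hc, Matrix.one_apply]
  split_ifs <;> simp

/-- Block diagonal matrix with blocks `S` and `a`. -/
noncomputable def bD {m n : ℕ} (S : Fin m → Fin n → ℂ) (a : ℂ) :
    Matrix (Fin m ⊕ Unit) (Fin n ⊕ Unit) ℂ :=
  Matrix.fromBlocks (Matrix.of S) 0 0 (Matrix.of fun (_ _ : Unit) => a)

lemma asm_factor {m n : ℕ} (a : ℂ) (b : Fin n → ℂ) (c : Fin m → ℂ)
    (S : Fin m → Fin n → ℂ) (hb : ∀ j, ‖b j‖ ≤ ‖a‖) (hc : ∀ i, ‖c i‖ ≤ ‖a‖) :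
    (Matrix.of (asm a b c S)).submatrix (eS m) (eS n) =
      eL (fun i => c i / a) * bD S a * eR (fun j => b j / a) ∧
    eL (fun i => -(c i / a)) * (Matrix.of (asm a b c S)).submatrix (eS m) (eS n) *
      eR (fun j => -(b j / a)) = bD S a := by
  have hb' : ∀ j, b j / a * a = b j := fun j => by
    by_cases h : a = 0
    · have := hb j; simp_all
    · field_simp
  have hc' : ∀ j, c j / a * a = c j := fun j => by
    by_cases h : a = 0
    · have := hc j; simp_all
    · field_simp
  have hbc : ∀ i j, c i * b j / a = c i / a * a * (b j / a) := fun i j => by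
    rw [hc']; ring
  rw [asm_submatrix]
  unfold eL eR bD
  simp only [Matrix.fromBlocks_multiply]
  constructor
  · congr 1 <;> ext i j <;> simp [Matrix.mul_apply, hbc, hc', hb', mul_comm a]
  · congr 1 <;> ext i j <;> simp [Matrix.mul_apply, hc', hb', mul_comm a]
    rw [hbc]; simp only [hc']; ring

lemma aux_div_le {a b : ℂ} (h : ‖b‖ ≤ ‖a‖) : ‖b / a‖ ≤ 1 := by
  rw [norm_div]; exact div_le_one_of_le₀ h (norm_nonneg _)

/-- Constant lost in one elimination step. -/
noncomputable def kc (m n : ℕ) : ℝ := (((m : ℝ) + 1) * ((n : ℝ) + 1)) ^ 2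

lemma kc_one_le (m n : ℕ) : 1 ≤ kc m n := by
  unfold kc
  apply one_le_pow₀
  have : (0:ℝ) ≤ m := by positivity
  have : (0:ℝ) ≤ n := by positivity
  nlinarith

lemma dt_asm_le {m n : ℕ} {ρ : ℝ} (hρ : 0 ≤ ρ) (a : ℂ) (b : Fin n → ℂ) (c : Fin m → ℂ)
    (S : Fin m → Fin n → ℂ) (hb : ∀ j, ‖b j‖ ≤ ‖a‖) (hc : ∀ i, ‖c i‖ ≤ ‖a‖) :
    dt ρ (Matrix.of (asm a b c S)) ≤
      dt (kc m n * ρ) (Matrix.of S) * (1 + kc m n * ρ * ‖a‖ ^ 2) := by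
  rw [← dt_submatrix _ _ (eS m) (eS n), (asm_factor a b c S hb hc).1]
  refine (dt_le_of_entries hρ _ _ _ (eL_entries _ fun i => aux_div_le (hc i))
    (eR_entries _ fun i => aux_div_le (hb i))).trans_eq ?_
  have := kc_one_le m n
  rw [bD, ← dt_blockdiag (by positivity)]
  simp [kc]

lemma le_dt_asm {m n : ℕ} {ρ : ℝ} (hρ : 0 ≤ ρ) (a : ℂ) (b : Fin n → ℂ) (c : Fin m → ℂ)
    (S : Fin m → Fin n → ℂ) (hb : ∀ j, ‖b j‖ ≤ ‖a‖) (hc : ∀ i, ‖c i‖ ≤ ‖a‖) :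
    dt ρ (Matrix.of S) * (1 + ρ * ‖a‖ ^ 2) ≤ dt (kc m n * ρ) (Matrix.of (asm a b c S)) := by
  rw [← dt_submatrix _ (Matrix.of (asm a b c S)) (eS m) (eS n), ← dt_blockdiag hρ]
  have h := (asm_factor a b c S hb hc).2
  rw [bD] at h
  rw [← h]
  refine (dt_le_of_entries hρ _ _ _ (eL_entries _ fun i => ?_)
    (eR_entries _ fun i => ?_)).trans_eq ?_
  · rw [norm_neg]; exact aux_div_le (hc i)
  · rw [norm_neg]; exact aux_div_le (hb i)
  · simp [kc]


open scoped ENNReal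

lemma mp_asm (m n : ℕ) : MeasurePreserving
    (fun p : (ℂ × (Fin n → ℂ)) × ((Fin m → ℂ) × (Fin m → Fin n → ℂ)) =>
      (Fin.cons (Fin.cons p.1.1 p.1.2) (fun i => Fin.cons (p.2.1 i) (p.2.2 i)) :
        Fin (m + 1) → Fin (n + 1) → ℂ)) := by
  have e1 := (volume_preserving_piFinSuccAbove (fun _ : Fin (m + 1) => Fin (n + 1) → ℂ) 0).symm
  have e2 := (volume_preserving_piFinSuccAbove (fun _ : Fin (n + 1) => ℂ) 0).symm
  have e3 := volume_preserving_pi (fun _ : Fin m => e2)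
  have e4 := (volume_measurePreserving_arrowProdEquivProdArrow ℂ (Fin n → ℂ) (Fin m)).symm
  have := e1.comp (e2.prod (e3.comp e4))
  convert! this using 1
  funext p
  ext i j
  simp [MeasurableEquiv.piFinSuccAbove, MeasurableEquiv.arrowProdEquivProdArrow,
    Equiv.arrowProdEquivProdArrow]
  rfl

lemma lintegral_asm {m n : ℕ} (g : (Fin (m + 1) → Fin (n + 1) → ℂ) → ℝ≥0∞) (hg : Measurable g) :
    ∫⁻ H, g H = ∫⁻ a, ∫⁻ b, ∫⁻ c, ∫⁻ S, g (asm a b c S) := by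
  have hm := (mp_asm m n).measurable
  rw [← (mp_asm m n).lintegral_comp hg]
  have h0 : Measurable (fun p : (ℂ × (Fin n → ℂ)) × ((Fin m → ℂ) × (Fin m → Fin n → ℂ)) =>
      g (Fin.cons (Fin.cons p.1.1 p.1.2) (fun i => Fin.cons (p.2.1 i) (p.2.2 i)))) := hg.comp hm
  rw [Measure.volume_eq_prod, lintegral_prod _ h0.aemeasurable]
  have h2 := h0.lintegral_prod_right' (ν := volume)
  rw [Measure.volume_eq_prod ℂ, lintegral_prod _ h2.aemeasurable]
  refine lintegral_congr fun a => lintegral_congr fun b => ?_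
  have h1 : Measurable (fun x : (Fin m → ℂ) × (Fin m → Fin n → ℂ) => ((a, b), x)) := by fun_prop
  have h3 : Measurable (fun x : (Fin m → ℂ) × (Fin m → Fin n → ℂ) =>
      g (Fin.cons (Fin.cons a b) (fun i => Fin.cons (x.1 i) (x.2 i)))) := h0.comp h1
  rw [Measure.volume_eq_prod, lintegral_prod _ h3.aemeasurable]
  refine lintegral_congr fun c => ?_
  rw [← lintegral_add_right_eq_self _ (fun i j => c i * b j / a : Fin m → Fin n → ℂ)]
  rfl

lemma mp_perm {m n : ℕ} (σ : Equiv.Perm (Fin m)) (τ : Equiv.Perm (Fin n)) : MeasurePreserving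
    (fun (H : Fin m → Fin n → ℂ) i j => H (σ i) (τ j)) := by
  have h1 := volume_preserving_arrowCongr' τ.symm (MeasurableEquiv.refl ℂ) (MeasurePreserving.id _)
  have h2 := volume_preserving_arrowCongr' σ.symm _ h1
  exact h2

lemma measurable_dt {m n : ℕ} (ρ : ℝ) :
    Measurable (fun H : Fin m → Fin n → ℂ => dt ρ (Matrix.of H)) := by
  apply Continuous.measurable
  unfold dt
  refine Complex.continuous_re.comp (Continuous.matrix_det ?_)
  have : Continuous (fun H : Fin m → Fin n → ℂ => Matrix.of H) := continuous_id
  fun_prop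

/-- Weighted negative moment integrand. -/
noncomputable def gI {m n : ℕ} (η t ρ : ℝ) (H : Fin m → Fin n → ℂ) : ℝ≥0∞ :=
  ENNReal.ofReal (Real.exp (-(η * ∑ i, ∑ j, ‖H i j‖ ^ 2)) * dt ρ (Matrix.of H) ^ (-t))

lemma measurable_gI {m n : ℕ} (η t ρ : ℝ) :
    Measurable (gI η t ρ : (Fin m → Fin n → ℂ) → ℝ≥0∞) := by
  have := measurable_dt (m := m) (n := n) ρ
  unfold gI
  fun_prop

lemma gI_perm {m n : ℕ} (η t ρ : ℝ) (σ : Equiv.Perm (Fin m)) (τ : Equiv.Perm (Fin n))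
    (H : Fin m → Fin n → ℂ) : gI η t ρ (fun i j => H (σ i) (τ j)) = gI η t ρ H := by
  unfold gI
  have h1 : dt ρ (Matrix.of fun i j => H (σ i) (τ j)) = dt ρ (Matrix.of H) :=
    dt_submatrix ρ (Matrix.of H) σ τ
  rw [h1]
  have h2 : ∑ i, ∑ j, ‖H (σ i) (τ j)‖ ^ 2 = ∑ i, ∑ j, ‖H i j‖ ^ 2 := by
    rw [← Equiv.sum_comp σ (fun i => ∑ j, ‖H i j‖ ^ 2)]
    refine Finset.sum_congr rfl fun i _ => ?_
    rw [← Equiv.sum_comp τ (fun j => ‖H (σ i) j‖ ^ 2)]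
  rw [h2]

/-- Matrices whose entry `(p, q)` is maximal. -/
def pivSet (m n : ℕ) (p : Fin m) (q : Fin n) : Set (Fin m → Fin n → ℂ) :=
  {H | ∀ i j, ‖H i j‖ ≤ ‖H p q‖}

lemma measurableSet_pivSet (m n : ℕ) (p : Fin m) (q : Fin n) : MeasurableSet (pivSet m n p q) := by
  unfold pivSet
  simp only [Set.ofPred_forall]
  refine MeasurableSet.iInter fun i => MeasurableSet.iInter fun j => ?_
  apply measurableSet_le <;> fun_prop

lemma lintegral_gI_le {m n : ℕ} (η t ρ : ℝ) :
    ∫⁻ H : Fin (m + 1) → Fin (n + 1) → ℂ, gI η t ρ H ≤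
      (((m + 1) * (n + 1) : ℕ) : ℝ≥0∞) * ∫⁻ H, (pivSet (m + 1) (n + 1) 0 0).indicator (gI η t ρ) H := by
  have h1 : ∀ p q, ∫⁻ H, (pivSet (m + 1) (n + 1) p q).indicator (gI η t ρ) H =
      ∫⁻ H, (pivSet (m + 1) (n + 1) 0 0).indicator (gI η t ρ) H := by
    intro p q
    rw [← (mp_perm (Equiv.swap 0 p) (Equiv.swap 0 q)).lintegral_comp
      ((measurable_gI η t ρ).indicator (measurableSet_pivSet _ _ 0 0))]
    refine lintegral_congr fun H => ?_
    unfold Set.indicator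
    rw [gI_perm]
    congr 1
    simp only [pivSet, Set.mem_ofPred_eq, Equiv.swap_apply_left, eq_iff_iff]
    constructor
    · intro h i j; exact h _ _
    · intro h i j
      simpa using h (Equiv.swap 0 p i) (Equiv.swap 0 q j)
  calc _ ≤ ∫⁻ H : Fin (m + 1) → Fin (n + 1) → ℂ, ∑ pq : Fin (m + 1) × Fin (n + 1),
        (pivSet (m + 1) (n + 1) pq.1 pq.2).indicator (gI η t ρ) H := by
        refine lintegral_mono fun H => ?_
        obtain ⟨pq, hpq⟩ := Finite.exists_max (fun x : Fin (m + 1) × Fin (n + 1) => ‖H x.1 x.2‖)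
        refine le_trans ?_ (Finset.single_le_sum (fun _ _ => zero_le) (Finset.mem_univ pq))
        rw [Set.indicator_of_mem]
        exact fun i j => hpq (i, j)
    _ = ∑ pq : Fin (m + 1) × Fin (n + 1), ∫⁻ H : Fin (m + 1) → Fin (n + 1) → ℂ,
        (pivSet (m + 1) (n + 1) pq.1 pq.2).indicator (gI η t ρ) H := by
        rw [lintegral_finsetSum]
        exact fun _ _ => (measurable_gI η t ρ).indicator (measurableSet_pivSet _ _ _ _)
    _ = _ := by
        simp only [h1]
        simp

lemma vol_cball (n : ℕ) (r : ℝ) (hr : 0 ≤ r) :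
    volume (Metric.closedBall (0 : Fin n → ℂ) r) = ENNReal.ofReal ((Real.pi * r ^ 2) ^ n) := by
  rw [volume_pi_closedBall _ hr]
  simp only [Complex.volume_closedBall, Finset.prod_const, Finset.card_univ, Fintype.card_fin]
  rw [ENNReal.ofReal_pow (by positivity), ENNReal.ofReal_mul (by positivity), mul_comm,
    ENNReal.ofReal_pow hr]
  congr 2
  rw [← NNReal.coe_real_pi, ENNReal.ofReal_coe_nnreal]

lemma gI_asm_le {m n : ℕ} {η t ρ : ℝ} (hη : 0 < η) (ht : 0 ≤ t) (hρ : 0 < ρ) (a : ℂ)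
    (b : Fin n → ℂ) (c : Fin m → ℂ) (S : Fin m → Fin n → ℂ) :
    (pivSet (m + 1) (n + 1) 0 0).indicator (gI η t (kc m n * ρ)) (asm a b c S) ≤
      ENNReal.ofReal (Real.exp (-(η / 2 * ‖a‖ ^ 2)) * (1 + ρ * ‖a‖ ^ 2) ^ (-t)) *
      ((Metric.closedBall (0 : Fin n → ℂ) ‖a‖).indicator 1 b *
      ((Metric.closedBall (0 : Fin m → ℂ) ‖a‖).indicator 1 c *
        gI (η / (8 * (m * n + 1))) t ρ S)) := by
  by_cases h : asm a b c S ∈ pivSet (m + 1) (n + 1) 0 0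
  swap
  · rw [Set.indicator_of_notMem h]; exact zero_le
  rw [Set.indicator_of_mem h]
  have h' : ∀ i j, ‖asm a b c S i j‖ ≤ ‖a‖ := fun i j => by simpa [asm] using h i j
  have hb : ∀ j, ‖b j‖ ≤ ‖a‖ := fun j => by simpa [asm] using h' 0 j.succ
  have hc : ∀ i, ‖c i‖ ≤ ‖a‖ := fun i => by simpa [asm] using h' i.succ 0
  have hD : ∀ i j, ‖S i j + c i * b j / a‖ ≤ ‖a‖ := fun i j => by
    simpa [asm] using h' i.succ j.succ
  have hS : ∀ i j, ‖S i j‖ ≤ 2 * ‖a‖ := fun i j => by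
    have h1 : ‖c i * b j / a‖ ≤ ‖a‖ := by
      rw [mul_div_assoc, norm_mul]
      exact (mul_le_of_le_one_right (norm_nonneg _) (aux_div_le (hb j))).trans (hc i)
    have h2 : S i j = (S i j + c i * b j / a) - c i * b j / a := by ring
    rw [h2]
    refine (norm_sub_le _ _).trans ?_
    linarith [hD i j]
  rw [Set.indicator_of_mem (by simpa [pi_norm_le_iff_of_nonneg (norm_nonneg a)] using hb),
    Set.indicator_of_mem (by simpa [pi_norm_le_iff_of_nonneg (norm_nonneg a)] using hc)]
  simp only [Pi.one_apply, one_mul]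
  unfold gI
  rw [← ENNReal.ofReal_mul (by positivity)]
  apply ENNReal.ofReal_le_ofReal
  have hk := kc_one_le m n
  have hdS := one_le_dt hρ.le (Matrix.of S)
  have e1 : dt (kc m n * ρ) (Matrix.of (asm a b c S)) ^ (-t) ≤
      dt ρ (Matrix.of S) ^ (-t) * (1 + ρ * ‖a‖ ^ 2) ^ (-t) := by
    rw [← Real.mul_rpow (by positivity) (by positivity)]
    exact Real.rpow_le_rpow_of_nonpos (by positivity) (le_dt_asm hρ.le a b c S hb hc) (by linarith)
  have e2 : Real.exp (-(η * ∑ i, ∑ j, ‖asm a b c S i j‖ ^ 2)) ≤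
      Real.exp (-(η / 2 * ‖a‖ ^ 2)) *
        Real.exp (-(η / (8 * (m * n + 1)) * ∑ i, ∑ j, ‖S i j‖ ^ 2)) := by
    rw [← Real.exp_add]
    apply Real.exp_le_exp.2
    have f1 : ‖a‖ ^ 2 ≤ ∑ i, ∑ j, ‖asm a b c S i j‖ ^ 2 := by
      calc ‖a‖ ^ 2 = ‖asm a b c S 0 0‖ ^ 2 := by simp [asm]
        _ ≤ ∑ j, ‖asm a b c S 0 j‖ ^ 2 :=
          Finset.single_le_sum (f := fun j => ‖asm a b c S 0 j‖ ^ 2) (fun _ _ => by positivity) (Finset.mem_univ 0)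
        _ ≤ _ := Finset.single_le_sum (f := fun i => ∑ j, ‖asm a b c S i j‖ ^ 2) (fun _ _ => by positivity) (Finset.mem_univ 0)
    have f2 : ∑ i, ∑ j, ‖S i j‖ ^ 2 ≤ m * n * (4 * ‖a‖ ^ 2) := by
      calc _ ≤ ∑ i : Fin m, ∑ j : Fin n, (2 * ‖a‖) ^ 2 := by
            gcongr with i _ j _; exact hS i j
        _ = _ := by simp; ring
    have f3 : η / (8 * (m * n + 1)) * ∑ i, ∑ j, ‖S i j‖ ^ 2 ≤ η / 2 * ‖a‖ ^ 2 := by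
      rw [div_mul_eq_mul_div, div_le_iff₀ (by positivity)]
      have := mul_le_mul_of_nonneg_left f2 hη.le
      have h3 : 0 ≤ η * ‖a‖ ^ 2 := by positivity
      nlinarith
    have := mul_le_mul_of_nonneg_left f1 hη.le
    linarith
  calc _ ≤ (Real.exp (-(η / 2 * ‖a‖ ^ 2)) *
        Real.exp (-(η / (8 * (m * n + 1)) * ∑ i, ∑ j, ‖S i j‖ ^ 2))) *
        (dt ρ (Matrix.of S) ^ (-t) * (1 + ρ * ‖a‖ ^ 2) ^ (-t)) := by
        have := one_le_dt (show 0 ≤ kc m n * ρ by positivity) (Matrix.of (asm a b c S))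
        gcongr
    _ = _ := by ring

lemma radial_bound (N : ℕ) {η t ε : ℝ} (hη : 0 < η) (hε : 0 < ε) (hε1 : ε ≤ 1) (ht : 1 ≤ t) :
    ∃ C : ℝ, 0 ≤ C ∧ ∀ ρ : ℝ, 0 < ρ →
      ∫⁻ a : ℂ, ENNReal.ofReal (Real.exp (-(η * ‖a‖ ^ 2)) * (1 + ρ * ‖a‖ ^ 2) ^ (-t) *
        (Real.pi * ‖a‖ ^ 2) ^ N) ≤ ENNReal.ofReal (C * ρ ^ (-(min t (N + 1) - ε))) := by
  set q := min t (N + 1) - ε with hq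
  have hN : (0:ℝ) ≤ N := by positivity
  have hq0 : 0 ≤ q := by
    have : (1:ℝ) ≤ min t (N + 1) := le_min ht (by linarith)
    linarith
  have hqt : q ≤ t := by have := min_le_left t ((N:ℝ) + 1); linarith
  have hqN : q ≤ N + 1 - ε := by have := min_le_right t ((N:ℝ) + 1); linarith
  have hI := Complex.integral_rpow_mul_exp_neg_mul_rpow (p := 2) (q := 2 * N - 2 * q) (b := η)
    (by norm_num) (by linarith) hη
  have hpos : 0 < 2 * Real.pi / 2 * η ^ (-(2 * N - 2 * q + 2) / 2) *
      Real.Gamma ((2 * N - 2 * q + 2) / 2) := by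
    have := Real.Gamma_pos_of_pos (show 0 < (2 * N - 2 * q + 2) / 2 by linarith)
    have := Real.pi_pos
    positivity
  have hint : Integrable (fun x : ℂ => ‖x‖ ^ (2 * N - 2 * q) * Real.exp (-η * ‖x‖ ^ (2:ℝ))) := by
    by_contra hcon
    rw [integral_undef hcon] at hI
    exact hpos.ne hI
  set K := ∫ x : ℂ, ‖x‖ ^ (2 * N - 2 * q) * Real.exp (-η * ‖x‖ ^ (2:ℝ)) with hK
  refine ⟨Real.pi ^ N * K, ?_, ?_⟩
  · rw [hI]; have := Real.pi_pos; positivity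
  intro ρ hρ
  have step : ∫⁻ a : ℂ, ENNReal.ofReal (Real.exp (-(η * ‖a‖ ^ 2)) * (1 + ρ * ‖a‖ ^ 2) ^ (-t) *
        (Real.pi * ‖a‖ ^ 2) ^ N) ≤ ∫⁻ a : ℂ, ENNReal.ofReal (Real.pi ^ N * ρ ^ (-q)) * 
          ENNReal.ofReal (‖a‖ ^ (2 * N - 2 * q) * Real.exp (-η * ‖a‖ ^ (2:ℝ))) := by
    refine lintegral_mono_ae ?_
    have h0 : ∀ᵐ a : ℂ, a ≠ 0 := by
      rw [ae_iff]; simp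
    filter_upwards [h0] with a ha
    have ha' : 0 < ‖a‖ := norm_pos_iff.2 ha
    have := Real.pi_pos
    rw [← ENNReal.ofReal_mul (by positivity)]
    apply ENNReal.ofReal_le_ofReal
    have h1 : (1 + ρ * ‖a‖ ^ 2) ^ (-t) ≤ ρ ^ (-q) * ‖a‖ ^ (-(2 * q)) := by
      calc (1 + ρ * ‖a‖ ^ 2) ^ (-t) ≤ (1 + ρ * ‖a‖ ^ 2) ^ (-q) :=
            Real.rpow_le_rpow_of_exponent_le (by nlinarith [mul_pos hρ (pow_pos ha' 2)]) (by linarith)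
        _ ≤ (ρ * ‖a‖ ^ 2) ^ (-q) :=
            Real.rpow_le_rpow_of_nonpos (by positivity) (by linarith) (by linarith)
        _ = _ := by
            rw [Real.mul_rpow hρ.le (by positivity), ← Real.rpow_natCast ‖a‖ 2,
              ← Real.rpow_mul ha'.le]
            congr 2; push_cast; ring
    have h2 : ‖a‖ ^ (2 * (N:ℝ) - 2 * q) = (‖a‖ ^ 2) ^ N * ‖a‖ ^ (-(2 * q)) := by
      rw [sub_eq_add_neg, Real.rpow_add ha', ← pow_mul, ← Real.rpow_natCast ‖a‖ (2 * N)]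
      push_cast; rfl
    have h3 : Real.exp (-η * ‖a‖ ^ (2:ℝ)) = Real.exp (-(η * ‖a‖ ^ 2)) := by
      rw [← Real.rpow_natCast ‖a‖ 2]; push_cast; ring_nf
    rw [h2, h3, mul_pow]
    calc _ ≤ Real.exp (-(η * ‖a‖ ^ 2)) * (ρ ^ (-q) * ‖a‖ ^ (-(2 * q))) * (Real.pi ^ N * (‖a‖ ^ 2) ^ N) := by
          gcongr
      _ = _ := by ring
  refine step.trans ?_
  have := Real.pi_pos
  rw [lintegral_const_mul' _ _ ENNReal.ofReal_ne_top, ← ofReal_integral_eq_lintegral_ofReal hint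
    (Filter.Eventually.of_forall fun x => by positivity), ← ENNReal.ofReal_mul (by positivity)]
  apply ENNReal.ofReal_le_ofReal
  apply le_of_eq
  ring

/-- Recursive exponent of the negative moment. -/
noncomputable def Qe (t ε : ℝ) : ℕ → ℕ → ℝ
  | m + 1, n + 1 => (min t ((m + n : ℕ) + 1) - ε) + Qe t ε m n
  | _, _ => 0

lemma gI_zero_dim {m n : ℕ} (h : m = 0 ∨ n = 0) (η t ρ : ℝ) :
    ∫⁻ H : Fin m → Fin n → ℂ, gI η t ρ H ≤ 1 := by
  have hle : ∀ H : Fin m → Fin n → ℂ, gI η t ρ H ≤ 1 := by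
    intro H
    have : H = fun _ _ => 0 := by
      rcases h with rfl | rfl
      · ext i; exact i.elim0
      · ext i j; exact j.elim0
    subst this
    have : (Matrix.of fun (_ : Fin m) (_ : Fin n) => (0:ℂ)) = 0 := rfl
    simp [gI, dt, this]
  calc _ ≤ ∫⁻ H : Fin m → Fin n → ℂ, 1 := lintegral_mono hle
    _ = 1 := by
      rw [lintegral_one, volume_pi, Measure.pi_univ]
      rcases h with rfl | rfl
      · simp
      · simp [volume_pi, Measure.pi_univ]

lemma neg_moment {t ε : ℝ} (hε : 0 < ε) (hε1 : ε ≤ 1) (ht : 1 ≤ t) (m n : ℕ) :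
    ∀ η : ℝ, 0 < η → ∃ C : ℝ, 0 ≤ C ∧ ∀ ρ : ℝ, 0 < ρ →
      ∫⁻ H : Fin m → Fin n → ℂ, gI η t ρ H ≤ ENNReal.ofReal (C * ρ ^ (-(Qe t ε m n))) := by
  induction m generalizing n with
  | zero =>
    intro η hη
    refine ⟨1, zero_le_one, fun ρ hρ => (gI_zero_dim (Or.inl rfl) _ _ _).trans ?_⟩
    simp [Qe]
  | succ m ih =>
    cases n with
    | zero =>
      intro η hη
      refine ⟨1, zero_le_one, fun ρ hρ => (gI_zero_dim (Or.inr rfl) _ _ _).trans ?_⟩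
      simp [Qe]
    | succ n =>
      intro η hη
      obtain ⟨C1, hC1, h1⟩ := ih n (η / (8 * (m * n + 1))) (by positivity)
      obtain ⟨C2, hC2, h2⟩ := radial_bound (m + n) (half_pos hη) hε hε1 ht
      have hk := kc_one_le m n
      have hk0 : 0 < kc m n := by linarith
      refine ⟨((m + 1) * (n + 1) : ℕ) * (C2 * C1 * (kc m n)⁻¹ ^ (-(Qe t ε (m + 1) (n + 1)))), by positivity, ?_⟩
      intro ρ' hρ'
      obtain ⟨ρ, hρ, rfl⟩ : ∃ ρ, 0 < ρ ∧ ρ' = kc m n * ρ :=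
        ⟨ρ' / kc m n, by positivity, by field_simp⟩
      refine (lintegral_gI_le η t _).trans ?_
      rw [lintegral_asm _ ((measurable_gI _ _ _).indicator (measurableSet_pivSet _ _ _ _))]
      have hmG := measurable_gI (m := m) (n := n) (η / (8 * (m * n + 1))) t ρ
      set F := ∫⁻ S : Fin m → Fin n → ℂ, gI (η / (8 * (m * n + 1))) t ρ S with hF
      have step : ∫⁻ a, ∫⁻ b : Fin n → ℂ, ∫⁻ c : Fin m → ℂ, ∫⁻ S, (pivSet (m + 1) (n + 1) 0 0).indicator
          (gI η t (kc m n * ρ)) (asm a b c S) ≤ ∫⁻ a : ℂ, 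
          ENNReal.ofReal (Real.exp (-(η / 2 * ‖a‖ ^ 2)) * (1 + ρ * ‖a‖ ^ 2) ^ (-t) *
            (Real.pi * ‖a‖ ^ 2) ^ (m + n)) * F := by
        refine lintegral_mono fun a => ?_
        refine (lintegral_mono fun b => lintegral_mono fun c => lintegral_mono fun S =>
          gI_asm_le hη (by linarith) hρ a b c S).trans ?_
        have mb : ∀ k, Measurable ((Metric.closedBall (0 : Fin k → ℂ) ‖a‖).indicator (1 : (Fin k → ℂ) → ℝ≥0∞)) :=
          fun k => measurable_one.indicator Metric.isClosed_closedBall.measurableSet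
        have mi : ∀ k, ∫⁻ b, (Metric.closedBall (0 : Fin k → ℂ) ‖a‖).indicator (1 : (Fin k → ℂ) → ℝ≥0∞) b =
          ENNReal.ofReal ((Real.pi * ‖a‖ ^ 2) ^ k) := fun k => by
            rw [lintegral_indicator_one Metric.isClosed_closedBall.measurableSet, vol_cball _ _ (norm_nonneg _)]
        apply le_of_eq
        calc _ = ∫⁻ b : Fin n → ℂ, ∫⁻ c : Fin m → ℂ,
              ENNReal.ofReal (Real.exp (-(η / 2 * ‖a‖ ^ 2)) * (1 + ρ * ‖a‖ ^ 2) ^ (-t)) *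
              ((Metric.closedBall (0 : Fin n → ℂ) ‖a‖).indicator 1 b *
              ((Metric.closedBall (0 : Fin m → ℂ) ‖a‖).indicator 1 c * F)) := by
              refine lintegral_congr fun b => lintegral_congr fun c => ?_
              rw [lintegral_const_mul _ (by fun_prop), lintegral_const_mul _ (by fun_prop),
                lintegral_const_mul _ (by fun_prop)]
          _ = ∫⁻ b : Fin n → ℂ, 
              ENNReal.ofReal (Real.exp (-(η / 2 * ‖a‖ ^ 2)) * (1 + ρ * ‖a‖ ^ 2) ^ (-t)) *
              ((Metric.closedBall (0 : Fin n → ℂ) ‖a‖).indicator 1 b *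
              (ENNReal.ofReal ((Real.pi * ‖a‖ ^ 2) ^ m) * F)) := by
              refine lintegral_congr fun b => ?_
              have := mb m
              rw [lintegral_const_mul _ (by fun_prop), lintegral_const_mul _ (by fun_prop),
                lintegral_mul_const _ (by fun_prop), mi]
          _ = ENNReal.ofReal (Real.exp (-(η / 2 * ‖a‖ ^ 2)) * (1 + ρ * ‖a‖ ^ 2) ^ (-t)) *
              (ENNReal.ofReal ((Real.pi * ‖a‖ ^ 2) ^ n) *
              (ENNReal.ofReal ((Real.pi * ‖a‖ ^ 2) ^ m) * F)) := by
              have := mb n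
              rw [lintegral_const_mul _ (by fun_prop), lintegral_mul_const _ (by fun_prop), mi]
          _ = _ := by
              have := Real.pi_pos
              conv_rhs => rw [ENNReal.ofReal_mul (by positivity), pow_add,
                ENNReal.ofReal_mul (p := (Real.pi * ‖a‖ ^ 2) ^ m) (by positivity)]
              ring
      rw [lintegral_mul_const'' _ (by fun_prop)] at step
      refine (mul_le_mul_right (step.trans (mul_le_mul' (h2 ρ hρ) (h1 ρ hρ))) _).trans ?_
      rw [← ENNReal.ofReal_mul (by positivity), ← ENNReal.ofReal_natCast,
        ← ENNReal.ofReal_mul (by positivity)]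
      apply ENNReal.ofReal_le_ofReal
      apply le_of_eq
      rw [mul_assoc ((((m + 1) * (n + 1) : ℕ) : ℝ))]
      congr 1
      rw [mul_assoc (C2 * C1), ← Real.mul_rpow (by positivity) (by positivity),
        inv_mul_cancel_left₀ hk0.ne', Qe, neg_add, Real.rpow_add hρ]
      push_cast
      ring

open scoped ENNReal

lemma Qe_base (ε : ℝ) (m : ℕ) : ∀ (n : ℕ) (t : ℝ), (m : ℝ) + n - 1 ≤ t →
    Qe t ε m n = m * n - (min m n : ℕ) * ε := by
  induction m with
  | zero => intro n t _; simp [Qe]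
  | succ m ih =>
    intro n t ht
    cases n with
    | zero => simp [Qe]
    | succ n =>
      push_cast at ht
      rw [Qe, ih n t (by linarith), min_eq_right (by push_cast; linarith), Nat.succ_min_succ]
      push_cast
      ring

lemma Qe_eq (ε : ℝ) (m : ℕ) : ∀ (n k : ℕ), k < min m n →
    Qe ((m : ℝ) + n - 2 * k - 1) ε m n = m * n - k * (k + 1) - (min m n : ℕ) * ε := by
  induction m with
  | zero => intro n k h; simp at h
  | succ m ih =>
    intro n k h
    cases n with
    | zero => simp at h
    | succ n =>
      cases k with
      | zero =>
        rw [Qe_base _ _ _ _ (by simp)]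
        simp
      | succ k =>
        rw [Nat.succ_min_succ] at h ⊢
        have hk : k < min m n := by omega
        have h1 := ih n k hk
        have e : ((m + 1 : ℕ) : ℝ) + (n + 1 : ℕ) - 2 * (k + 1 : ℕ) - 1 = m + n - 2 * k - 1 := by
          push_cast; ring
        rw [e, Qe, h1, min_eq_left (by push_cast; linarith [(k.cast_nonneg : (0:ℝ) ≤ k)])]
        push_cast
        ring

lemma dmt_eq {m n : ℕ} {s : ℝ} (hs : s < (min m n : ℕ)) :
    dmt m n s = ((m : ℝ) - ⌊s⌋₊) * (n - ⌊s⌋₊) - (s - ⌊s⌋₊) * (m + n - 2 * ⌊s⌋₊ - 1) := by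
  rw [dmt, if_neg (not_le.2 hs), dmtPt, dmtPt]
  push_cast
  ring

lemma dmt_comm (m n : ℕ) (s : ℝ) : dmt m n s = dmt n m s := by
  unfold dmt dmtPt
  rw [min_comm]
  congr 1
  ring

/-- Gaussian weight. -/
noncomputable def gw {m n : ℕ} (H : Fin m → Fin n → ℂ) : ℝ :=
  Real.exp (-∑ i, ∑ j, ‖H i j‖ ^ 2)

lemma measurable_gw {m n : ℕ} : Measurable (gw : (Fin m → Fin n → ℂ) → ℝ) := by
  unfold gw; fun_prop

lemma upper_bound {m n : ℕ} {s : ℝ} (hs0 : 0 ≤ s) (hs : s < (min m n : ℕ)) {ε : ℝ} (hε : 0 < ε)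
    {M : ℝ} (hM : 0 < M) :
    ∃ C : ℝ, 0 ≤ C ∧ ∀ ρ : ℝ, 1 < ρ →
      ∫⁻ H in {H : Fin m → Fin n → ℂ | dt (ρ / M) (Matrix.of H) < ρ ^ s}, ENNReal.ofReal (gw H) ≤
        ENNReal.ofReal (C * ρ ^ (-dmt m n s + ε)) := by
  set k := ⌊s⌋₊ with hk
  have hkm : k < min m n := by rw [hk, Nat.floor_lt hs0]; exact hs
  set N : ℕ := min m n with hN
  have hNpos : (0:ℝ) < N := by exact_mod_cast (by omega : 0 < N)
  have hkN : (k:ℝ) + 1 ≤ N := by exact_mod_cast hkm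
  have hNm : (N:ℝ) ≤ m := by exact_mod_cast min_le_left m n
  have hNn : (N:ℝ) ≤ n := by exact_mod_cast min_le_right m n
  set t : ℝ := (m : ℝ) + n - 2 * k - 1 with ht
  have ht1 : 1 ≤ t := by linarith
  set ε' := min 1 (ε / N) with hε'
  have hε0 : 0 < ε' := by positivity
  obtain ⟨C, hC, h⟩ := neg_moment hε0 (min_le_left _ _) ht1 m n 1 one_pos
  have hQ := Qe_eq ε' m n k hkm
  rw [← ht, ← hN] at hQ
  refine ⟨C * M⁻¹ ^ (-(Qe t ε' m n)), by positivity, fun ρ hρ => ?_⟩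
  have hρ0 : 0 < ρ := by linarith
  have hms : MeasurableSet {H : Fin m → Fin n → ℂ | dt (ρ / M) (Matrix.of H) < ρ ^ s} :=
    measurableSet_lt (measurable_dt _) measurable_const
  calc _ ≤ ∫⁻ H in {H : Fin m → Fin n → ℂ | dt (ρ / M) (Matrix.of H) < ρ ^ s},
        ENNReal.ofReal (ρ ^ (s * t)) * gI 1 t (ρ / M) H := by
        refine setLIntegral_mono' hms fun H hH => ?_
        unfold gI
        rw [← ENNReal.ofReal_mul (by positivity)]
        apply ENNReal.ofReal_le_ofReal
        have hd := one_le_dt (show 0 ≤ ρ / M by positivity) (Matrix.of H)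
        have h1 : (ρ ^ (s * t))⁻¹ ≤ dt (ρ / M) (Matrix.of H) ^ (-t) := by
          rw [Real.rpow_mul hρ0.le, ← Real.rpow_neg (by positivity)]
          exact Real.rpow_le_rpow_of_nonpos (by linarith) (le_of_lt hH) (by linarith)
        have h2 : 0 < ρ ^ (s * t) := by positivity
        rw [inv_le_iff_one_le_mul₀ h2] at h1
        unfold gw
        rw [one_mul]
        have h3 := Real.exp_pos (-∑ i, ∑ j, ‖H i j‖ ^ 2)
        calc _ ≤ Real.exp (-∑ i, ∑ j, ‖H i j‖ ^ 2) *
            (dt (ρ / M) (Matrix.of H) ^ (-t) * ρ ^ (s * t)) := le_mul_of_one_le_right h3.le h1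
          _ = _ := by ring
    _ ≤ ∫⁻ H : Fin m → Fin n → ℂ, ENNReal.ofReal (ρ ^ (s * t)) * gI 1 t (ρ / M) H :=
        setLIntegral_le_lintegral _ _
    _ = ENNReal.ofReal (ρ ^ (s * t)) * ∫⁻ H : Fin m → Fin n → ℂ, gI 1 t (ρ / M) H :=
        lintegral_const_mul _ (measurable_gI _ _ _)
    _ ≤ ENNReal.ofReal (ρ ^ (s * t)) * ENNReal.ofReal (C * (ρ / M) ^ (-(Qe t ε' m n))) := by
        gcongr; exact h _ (by positivity)
    _ ≤ _ := by
        rw [← ENNReal.ofReal_mul (by positivity)]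
        apply ENNReal.ofReal_le_ofReal
        rw [div_eq_mul_inv, Real.mul_rpow hρ0.le (by positivity)]
        have e : ρ ^ (s * t) * ρ ^ (-(Qe t ε' m n)) ≤ ρ ^ (-dmt m n s + ε) := by
          rw [← Real.rpow_add hρ0]
          apply Real.rpow_le_rpow_of_exponent_le hρ.le
          rw [hQ, dmt_eq hs, ← hk]
          have : N * ε' ≤ ε := by
            have : ε' ≤ ε / N := min_le_right _ _
            rw [le_div_iff₀ hNpos] at this
            linarith
          have e2 : s * t + -((m:ℝ) * n - k * (k + 1) - N * ε') =
            -(((m:ℝ) - k) * (n - k) - (s - k) * (m + n - 2 * k - 1)) + N * ε' := by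
            rw [ht]; ring
          rw [e2]; linarith
        calc _ = (C * M⁻¹ ^ (-(Qe t ε' m n))) * (ρ ^ (s * t) * ρ ^ (-(Qe t ε' m n))) := by ring
          _ ≤ _ := by gcongr

open scoped ENNReal

/-- Volume of the recursive box family. -/
noncomputable def vL : ℕ → ℕ → (ℕ → ℝ) → ℝ
  | m + 1, n + 1, δ => (δ 0 ^ 2) ^ (m + n + 1) * vL m n (fun i => δ (i + 1))
  | _, _, _ => 1

/-- Determinant bound of the recursive box family. -/
noncomputable def pL (ρ : ℝ) : ℕ → ℕ → (ℕ → ℝ) → ℝ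
  | m + 1, n + 1, δ => (1 + ρ * δ 0 ^ 2) * pL ρ m n (fun i => δ (i + 1))
  | _, _, _ => 1

lemma pL_pos {ρ : ℝ} (hρ : 0 ≤ ρ) (m : ℕ) : ∀ n δ, 0 < pL ρ m n δ := by
  induction m with
  | zero => intro n δ; simp [pL]
  | succ m ih =>
    intro n δ
    cases n with
    | zero => simp [pL]
    | succ n => rw [pL]; have := ih n (fun i => δ (i + 1)); positivity

lemma pL_mono {ρ ρ' : ℝ} (hρ : 0 ≤ ρ) (h : ρ ≤ ρ') (m : ℕ) : ∀ n δ, pL ρ m n δ ≤ pL ρ' m n δ := by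
  induction m with
  | zero => intro n δ; simp [pL]
  | succ m ih =>
    intro n δ
    cases n with
    | zero => simp [pL]
    | succ n =>
      rw [pL, pL]
      have := ih n (fun i => δ (i + 1))
      have := pL_pos hρ m n (fun i => δ (i + 1))
      have h2 : 0 ≤ ρ' := hρ.trans h
      gcongr

lemma pL_scale {ρ k : ℝ} (hρ : 0 ≤ ρ) (hk : 1 ≤ k) (m : ℕ) :
    ∀ n δ, pL (k * ρ) m n δ ≤ k ^ m * pL ρ m n δ := by
  induction m with
  | zero => intro n δ; simp [pL]
  | succ m ih =>
    intro n δ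
    cases n with
    | zero => simpa [pL] using one_le_pow₀ hk
    | succ n =>
      rw [pL, pL]
      have h1 := ih n (fun i => δ (i + 1))
      have h0 := pL_pos hρ m n (fun i => δ (i + 1))
      have h2 : 1 + k * ρ * δ 0 ^ 2 ≤ k * (1 + ρ * δ 0 ^ 2) := by linarith
      calc _ ≤ (k * (1 + ρ * δ 0 ^ 2)) * (k ^ m * pL ρ m n (fun i => δ (i + 1))) := by
            have := pL_pos (show 0 ≤ k * ρ by positivity) m n (fun i => δ (i + 1))
            gcongr
        _ = _ := by ring

/-- The box family. -/
def tB (m n : ℕ) (C ρ : ℝ) (δ : ℕ → ℝ) : Set (Fin m → Fin n → ℂ) :=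
  {H | (∀ i j, ‖H i j‖ ≤ C * δ 0) ∧ dt ρ (Matrix.of H) ≤ C * pL ρ m n δ}

lemma measurableSet_tB (m n : ℕ) (C ρ : ℝ) (δ : ℕ → ℝ) : MeasurableSet (tB m n C ρ δ) := by
  have h1 : MeasurableSet {H : Fin m → Fin n → ℂ | ∀ i j, ‖H i j‖ ≤ C * δ 0} := by
    simp only [Set.ofPred_forall]
    refine MeasurableSet.iInter fun i => MeasurableSet.iInter fun j => ?_
    apply measurableSet_le <;> fun_prop
  exact h1.inter (measurableSet_le (measurable_dt _) measurable_const)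

lemma tB_zero {m n : ℕ} (h : m = 0 ∨ n = 0) {ρ : ℝ} (δ : ℕ → ℝ) :
    ENNReal.ofReal (1 * vL m n δ) ≤ volume (tB m n 1 ρ δ) := by
  have h1 : tB m n 1 ρ δ = Set.univ := by
    apply Set.eq_univ_of_forall
    intro H
    have : H = fun _ _ => 0 := by
      rcases h with rfl | rfl
      · ext i; exact i.elim0
      · ext i j; exact j.elim0
    subst this
    have : (Matrix.of fun (_ : Fin m) (_ : Fin n) => (0:ℂ)) = 0 := rfl
    have hp : pL ρ m n δ = 1 := by
      rcases h with rfl | rfl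
      · simp [pL]
      · cases m <;> simp [pL]
    refine ⟨?_, ?_⟩
    · rcases h with rfl | rfl
      · exact fun i => i.elim0
      · exact fun _ j => j.elim0
    · rw [hp]; simp [dt, this]
  rw [h1, volume_pi, Measure.pi_univ]
  rcases h with rfl | rfl
  · simp [vL]
  · cases m <;> simp [vL, volume_pi]

lemma tB_volume (m : ℕ) : ∀ n, ∃ c C : ℝ, 0 < c ∧ 1 ≤ C ∧ ∀ δ : ℕ → ℝ, Antitone δ → (∀ i, 0 < δ i) →
    ∀ ρ, 0 < ρ → ENNReal.ofReal (c * vL m n δ) ≤ volume (tB m n C ρ δ) := by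
  induction m with
  | zero =>
    intro n
    exact ⟨1, 1, one_pos, le_rfl, fun δ _ _ ρ _ => tB_zero (Or.inl rfl) δ⟩
  | succ m ih =>
    intro n
    cases n with
    | zero => exact ⟨1, 1, one_pos, le_rfl, fun δ _ _ ρ _ => tB_zero (Or.inr rfl) δ⟩
    | succ n =>
      obtain ⟨c, C, hc, hC, h⟩ := ih n
      have hk := kc_one_le m n
      set k := kc m n with hkdef
      have hpi := Real.pi_pos
      have hCk : 0 ≤ C * k ^ m * (9 * k) := by positivity
      refine ⟨Real.pi ^ (m + n + 1) * c, C * k ^ m * (9 * k) + C + 3, by positivity, by linarith, ?_⟩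
      intro δ hδ hpos ρ hρ
      set C' := C * k ^ m * (9 * k) + C + 3 with hC'
      set δ' : ℕ → ℝ := fun i => δ (i + 1) with hδ'
      have hd0 := hpos 0
      have hd1 : δ' 0 ≤ δ 0 := hδ (by norm_num)
      have hS := h δ' (fun i j hij => hδ (by omega)) (fun i => hpos _) (k * ρ) (by positivity)
      have key : ∀ a b c' S, (Metric.closedBall ((2 * δ 0 : ℝ) : ℂ) (δ 0)).indicator (1 : ℂ → ℝ≥0∞) a *
          ((Metric.closedBall (0 : Fin n → ℂ) (δ 0)).indicator 1 b *
          ((Metric.closedBall (0 : Fin m → ℂ) (δ 0)).indicator 1 c' *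
          (tB m n C (k * ρ) δ').indicator 1 S)) ≤ (tB (m + 1) (n + 1) C' ρ δ).indicator 1 (asm a b c' S) := by
        intro a b c' S
        by_cases ha : a ∈ Metric.closedBall ((2 * δ 0 : ℝ) : ℂ) (δ 0)
        swap
        · rw [Set.indicator_of_notMem ha, zero_mul]; exact zero_le
        by_cases hb : b ∈ Metric.closedBall (0 : Fin n → ℂ) (δ 0)
        swap
        · simp [Set.indicator_of_notMem hb]
        by_cases hcc : c' ∈ Metric.closedBall (0 : Fin m → ℂ) (δ 0)
        swap
        · simp [Set.indicator_of_notMem hcc]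
        by_cases hSS : S ∈ tB m n C (k * ρ) δ'
        swap
        · simp [Set.indicator_of_notMem hSS]
        have hb' : ∀ j, ‖b j‖ ≤ δ 0 := by
          simpa [pi_norm_le_iff_of_nonneg hd0.le] using hb
        have hc' : ∀ j, ‖c' j‖ ≤ δ 0 := by
          simpa [pi_norm_le_iff_of_nonneg hd0.le] using hcc
        have hn : ‖((2 * δ 0 : ℝ) : ℂ)‖ = 2 * δ 0 := by
          rw [Complex.norm_real, Real.norm_eq_abs, abs_of_pos (by positivity)]
        rw [mem_closedBall_iff_norm] at ha
        have ha1 : δ 0 ≤ ‖a‖ := by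
          have h1 := norm_sub_norm_le ((2 * δ 0 : ℝ) : ℂ) a
          rw [norm_sub_rev] at ha
          linarith
        have ha2 : ‖a‖ ≤ 3 * δ 0 := by
          have := norm_sub_norm_le a ((2 * δ 0 : ℝ) : ℂ)
          linarith
        have hba : ∀ j, ‖b j‖ ≤ ‖a‖ := fun j => (hb' j).trans ha1
        have hca : ∀ j, ‖c' j‖ ≤ ‖a‖ := fun j => (hc' j).trans ha1
        have hmem : asm a b c' S ∈ tB (m + 1) (n + 1) C' ρ δ := by
          have hC3 : 3 ≤ C' := by linarith
          have hC1 : C + 1 ≤ C' := by linarith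
          refine ⟨?_, ?_⟩
          · intro i j
            refine Fin.cases ?_ (fun i => ?_) i
            · refine Fin.cases ?_ (fun j => ?_) j
              · simp only [asm, Fin.cons_zero]; nlinarith
              · simp only [asm, Fin.cons_zero, Fin.cons_succ]; nlinarith [hb' j]
            · refine Fin.cases ?_ (fun j => ?_) j
              · simp only [asm, Fin.cons_zero, Fin.cons_succ]; nlinarith [hc' i]
              · simp only [asm, Fin.cons_succ]
                have h1 : ‖c' i * b j / a‖ ≤ δ 0 := by
                  rw [mul_div_assoc, norm_mul]
                  exact (mul_le_of_le_one_right (norm_nonneg _) (aux_div_le (hba j))).trans (hc' i)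
                have h2 := hSS.1 i j
                have h3 := norm_add_le (S i j) (c' i * b j / a)
                nlinarith
          · have h1 := dt_asm_le hρ.le a b c' S hba hca
            have h2 := hSS.2
            have h3 := pL_scale hρ.le hk m n δ'
            have h4 := pL_pos hρ.le m n δ'
            have h6 : ‖a‖ ^ 2 ≤ 9 * δ 0 ^ 2 := by nlinarith [norm_nonneg a]
            have h5 : 1 + k * ρ * ‖a‖ ^ 2 ≤ 9 * k * (1 + ρ * δ 0 ^ 2) := by
              have := mul_le_mul_of_nonneg_left h6 (show 0 ≤ k * ρ by positivity)
              nlinarith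
            refine h1.trans ?_
            rw [pL]
            calc _ ≤ (C * (k ^ m * pL ρ m n δ')) * (9 * k * (1 + ρ * δ 0 ^ 2)) := by
                  refine mul_le_mul (h2.trans (by gcongr)) h5 (by positivity) (by positivity)
              _ = (C * k ^ m * (9 * k)) * ((1 + ρ * δ 0 ^ 2) * pL ρ m n δ') := by ring
              _ ≤ C' * ((1 + ρ * δ 0 ^ 2) * pL ρ m n δ') := by
                  refine mul_le_mul_of_nonneg_right (by linarith) (by positivity)
        rw [Set.indicator_of_mem hmem]
        simp only [Pi.one_apply]
        have i1 : ∀ {α : Type} (s : Set α) (x : α), s.indicator (1 : α → ℝ≥0∞) x ≤ 1 := fun s x =>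
          Set.indicator_le_self' (fun _ _ => zero_le) x
        calc _ ≤ (1 : ℝ≥0∞) * (1 * (1 * 1)) := by gcongr <;> exact i1 _ _
          _ = 1 := by simp
      have hmT := measurableSet_tB (m + 1) (n + 1) C' ρ δ
      have hmS := measurableSet_tB m n C (k * ρ) δ'
      rw [← lintegral_indicator_one hmT, lintegral_asm _ (measurable_one.indicator hmT)]
      refine le_trans ?_ (lintegral_mono fun a => lintegral_mono fun b => lintegral_mono fun c' =>
        lintegral_mono fun S => key a b c' S)
      have mb : ∀ l, Measurable ((Metric.closedBall (0 : Fin l → ℂ) (δ 0)).indicator (1 : (Fin l → ℂ) → ℝ≥0∞)) :=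
          fun l => measurable_one.indicator Metric.isClosed_closedBall.measurableSet
      have mi : ∀ l, ∫⁻ b, (Metric.closedBall (0 : Fin l → ℂ) (δ 0)).indicator (1 : (Fin l → ℂ) → ℝ≥0∞) b =
          ENNReal.ofReal ((Real.pi * δ 0 ^ 2) ^ l) := fun l => by
            rw [lintegral_indicator_one Metric.isClosed_closedBall.measurableSet, vol_cball _ _ hd0.le]
      have ma : Measurable ((Metric.closedBall ((2 * δ 0 : ℝ) : ℂ) (δ 0)).indicator (1 : ℂ → ℝ≥0∞)) :=
        measurable_one.indicator Metric.isClosed_closedBall.measurableSet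
      have ia : ∫⁻ a, (Metric.closedBall ((2 * δ 0 : ℝ) : ℂ) (δ 0)).indicator (1 : ℂ → ℝ≥0∞) a =
          ENNReal.ofReal (Real.pi * δ 0 ^ 2) := by
        rw [lintegral_indicator_one Metric.isClosed_closedBall.measurableSet, Complex.volume_closedBall,
          ENNReal.ofReal_mul (by positivity), mul_comm, ENNReal.ofReal_pow hd0.le]
        congr 1
        rw [← NNReal.coe_real_pi, ENNReal.ofReal_coe_nnreal]
      have iS : ∫⁻ S, (tB m n C (k * ρ) δ').indicator (1 : (Fin m → Fin n → ℂ) → ℝ≥0∞) S = volume (tB m n C (k * ρ) δ') :=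
        lintegral_indicator_one hmS
      have mS : Measurable ((tB m n C (k * ρ) δ').indicator (1 : (Fin m → Fin n → ℂ) → ℝ≥0∞)) :=
        measurable_one.indicator hmS
      have mbn := mb n
      have mbm := mb m
      have big : ∫⁻ (a : ℂ) (b : Fin n → ℂ) (c' : Fin m → ℂ) (S : Fin m → Fin n → ℂ),
          (Metric.closedBall ((2 * δ 0 : ℝ) : ℂ) (δ 0)).indicator (1 : ℂ → ℝ≥0∞) a *
          ((Metric.closedBall (0 : Fin n → ℂ) (δ 0)).indicator 1 b *
          ((Metric.closedBall (0 : Fin m → ℂ) (δ 0)).indicator 1 c' *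
          (tB m n C (k * ρ) δ').indicator 1 S)) =
          ENNReal.ofReal (Real.pi * δ 0 ^ 2) * (ENNReal.ofReal ((Real.pi * δ 0 ^ 2) ^ n) *
          (ENNReal.ofReal ((Real.pi * δ 0 ^ 2) ^ m) * volume (tB m n C (k * ρ) δ'))) := by
        have s1 : ∀ a b c', ∫⁻ (S : Fin m → Fin n → ℂ),
          (Metric.closedBall ((2 * δ 0 : ℝ) : ℂ) (δ 0)).indicator (1 : ℂ → ℝ≥0∞) a *
          ((Metric.closedBall (0 : Fin n → ℂ) (δ 0)).indicator 1 b *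
          ((Metric.closedBall (0 : Fin m → ℂ) (δ 0)).indicator 1 c' *
          (tB m n C (k * ρ) δ').indicator 1 S)) = 
          (Metric.closedBall ((2 * δ 0 : ℝ) : ℂ) (δ 0)).indicator (1 : ℂ → ℝ≥0∞) a *
          ((Metric.closedBall (0 : Fin n → ℂ) (δ 0)).indicator 1 b *
          ((Metric.closedBall (0 : Fin m → ℂ) (δ 0)).indicator 1 c' *
          volume (tB m n C (k * ρ) δ'))) := by
          intro a b c'
          rw [lintegral_const_mul _ (by fun_prop), lintegral_const_mul _ (by fun_prop),
            lintegral_const_mul _ mS, iS]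
        simp only [s1]
        have s2 : ∀ a b, ∫⁻ (c' : Fin m → ℂ),
          (Metric.closedBall ((2 * δ 0 : ℝ) : ℂ) (δ 0)).indicator (1 : ℂ → ℝ≥0∞) a *
          ((Metric.closedBall (0 : Fin n → ℂ) (δ 0)).indicator 1 b *
          ((Metric.closedBall (0 : Fin m → ℂ) (δ 0)).indicator 1 c' *
          volume (tB m n C (k * ρ) δ'))) = 
          (Metric.closedBall ((2 * δ 0 : ℝ) : ℂ) (δ 0)).indicator (1 : ℂ → ℝ≥0∞) a *
          ((Metric.closedBall (0 : Fin n → ℂ) (δ 0)).indicator 1 b *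
          (ENNReal.ofReal ((Real.pi * δ 0 ^ 2) ^ m) * volume (tB m n C (k * ρ) δ'))) := by
          intro a b
          rw [lintegral_const_mul _ (by fun_prop), lintegral_const_mul _ (by fun_prop),
            lintegral_mul_const _ mbm, mi]
        simp only [s2]
        have s3 : ∀ a, ∫⁻ (b : Fin n → ℂ),
          (Metric.closedBall ((2 * δ 0 : ℝ) : ℂ) (δ 0)).indicator (1 : ℂ → ℝ≥0∞) a *
          ((Metric.closedBall (0 : Fin n → ℂ) (δ 0)).indicator 1 b *
          (ENNReal.ofReal ((Real.pi * δ 0 ^ 2) ^ m) * volume (tB m n C (k * ρ) δ'))) = 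
          (Metric.closedBall ((2 * δ 0 : ℝ) : ℂ) (δ 0)).indicator (1 : ℂ → ℝ≥0∞) a *
          (ENNReal.ofReal ((Real.pi * δ 0 ^ 2) ^ n) *
          (ENNReal.ofReal ((Real.pi * δ 0 ^ 2) ^ m) * volume (tB m n C (k * ρ) δ'))) := by
          intro a
          rw [lintegral_const_mul _ (by fun_prop), lintegral_mul_const _ mbn, mi]
        simp only [s3]
        rw [lintegral_mul_const _ ma, ia]
      rw [big]
      calc _ = ENNReal.ofReal (Real.pi * δ 0 ^ 2) * (ENNReal.ofReal ((Real.pi * δ 0 ^ 2) ^ n) *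
          (ENNReal.ofReal ((Real.pi * δ 0 ^ 2) ^ m) * ENNReal.ofReal (c * vL m n δ'))) := by
            rw [← ENNReal.ofReal_mul (by positivity), ← ENNReal.ofReal_mul (by positivity),
              ← ENNReal.ofReal_mul (by positivity), vL]
            congr 1
            ring
        _ ≤ _ := by gcongr

/-- Recursive exponent. -/
noncomputable def eE : ℕ → ℕ → ℝ → ℝ
  | m + 1, n + 1, s => ((m : ℝ) + n + 1) * (1 - min s 1) + eE m n (max (s - 1) 0)
  | _, _, _ => 0

lemma dmt_zero (m n : ℕ) : dmt m n 0 = m * n := by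
  unfold dmt
  split_ifs with h
  · have : min m n = 0 := by exact_mod_cast le_antisymm h (by positivity)
    rcases Nat.min_eq_zero_iff.1 this with rfl | rfl <;> simp
  · simp [dmtPt]

lemma eE_eq (m : ℕ) : ∀ n s, 0 ≤ s → eE m n s = dmt m n s := by
  induction m with
  | zero => intro n s hs; simp [eE, dmt, hs]
  | succ m ih =>
    intro n s hs
    cases n with
    | zero => simp [eE, dmt, hs]
    | succ n =>
      rw [eE, ih _ _ (le_max_right _ _)]
      rcases le_or_gt 1 s with h1 | h1
      · rw [min_eq_right h1, max_eq_left (by linarith)]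
        unfold dmt dmtPt
        have hf : 1 ≤ ⌊s⌋₊ := by rw [Nat.le_floor_iff hs]; simpa using h1
        rw [Nat.floor_sub_one, Nat.succ_min_succ]
        have : ((min m n : ℕ) : ℝ) ≤ s - 1 ↔ ((min m n + 1 : ℕ) : ℝ) ≤ s := by
          push_cast; constructor <;> intro h <;> linarith
        simp only [this]
        split_ifs
        · ring
        · push_cast [Nat.cast_sub hf]; ring
      · rw [min_eq_left h1.le, max_eq_right (by linarith), dmt_zero]
        have hf : ⌊s⌋₊ = 0 := Nat.floor_eq_zero.2 h1
        rw [dmt_eq]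
        · rw [hf]; push_cast; ring
        · rw [Nat.succ_min_succ]; push_cast
          have : (0:ℝ) ≤ min (m:ℝ) n := by positivity
          linarith

/-- Clamped rates. -/
noncomputable def bt (s : ℝ) (i : ℕ) : ℝ := min (max (s - i) 0) 1

lemma bt_succ (s : ℝ) (i : ℕ) : bt s (i + 1) = bt (max (s - 1) 0) i := by
  unfold bt
  push_cast
  congr 1
  have : (0:ℝ) ≤ i := by positivity
  rcases le_total (s - 1) 0 with h | h
  · rw [max_eq_right h, max_eq_right (by linarith), max_eq_right (by linarith)]
  · rw [max_eq_left h]; congr 1; ring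

lemma bt_zero {s : ℝ} (hs : 0 ≤ s) : bt s 0 = min s 1 := by
  simp [bt, hs]

lemma vL_eq {x ρ : ℝ} (hρ : 0 < ρ) (m : ℕ) : ∀ n s δ, 0 ≤ s → (∀ i, δ i ^ 2 = x * ρ ^ (-(1 - bt s i))) →
    vL m n δ = x ^ (m * n) * ρ ^ (-(eE m n s)) := by
  induction m with
  | zero => intro n s δ hs h; simp [vL, eE]
  | succ m ih =>
    intro n s δ hs h
    cases n with
    | zero => simp [vL, eE]
    | succ n =>
      rw [vL, eE, ih n (max (s - 1) 0) _ (le_max_right _ _) (fun i => by rw [h, bt_succ]), h, bt_zero hs,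
        mul_pow, neg_add, Real.rpow_add hρ, ← Real.rpow_mul_natCast hρ.le]
      have : -(((m:ℝ) + n + 1) * (1 - min s 1)) = -(1 - min s 1) * ((m + n + 1 : ℕ) : ℝ) := by
        push_cast; ring
      rw [this]
      ring

lemma pL_le {x ρ : ℝ} (hx : 0 < x) (hx1 : x ≤ 1) (hρ : 1 ≤ ρ) (m : ℕ) : ∀ n s δ, 0 ≤ s →
    (∀ i, δ i ^ 2 = x * ρ ^ (-(1 - bt s i))) → pL ρ m n δ ≤ 2 ^ m * ρ ^ s := by
  induction m with
  | zero => intro n s δ hs h; simpa [pL] using Real.one_le_rpow hρ hs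
  | succ m ih =>
    intro n s δ hs h
    cases n with
    | zero =>
      rw [pL]
      · exact one_le_mul_of_one_le_of_one_le (one_le_pow₀ (by norm_num)) (Real.one_le_rpow hρ hs)
      · simp
    | succ n =>
      have hρ0 : 0 < ρ := by linarith
      have h1 := ih n (max (s - 1) 0) (fun i => δ (i + 1)) (le_max_right _ _)
        (fun i => by rw [h, bt_succ])
      have h2 : ρ * δ 0 ^ 2 = x * ρ ^ (min s 1) := by
        rw [h, bt_zero hs]
        have : ρ ^ (min s 1) = ρ * ρ ^ (-(1 - min s 1)) := by
          conv_rhs => enter [1]; rw [← Real.rpow_one ρ]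
          rw [← Real.rpow_add hρ0]; congr 1; ring
        rw [this]; ring
      have h3 : 1 ≤ ρ ^ (min s 1) := Real.one_le_rpow hρ (le_min hs zero_le_one)
      rw [pL, h2]
      have h4 : ρ ^ s = ρ ^ (min s 1) * ρ ^ (max (s - 1) 0) := by
        rw [← Real.rpow_add hρ0]; congr 1
        rcases le_total s 1 with h | h
        · rw [min_eq_left h, max_eq_right (by linarith)]; ring
        · rw [min_eq_right h, max_eq_left (by linarith)]; ring
      have h5 : 1 + x * ρ ^ (min s 1) ≤ 2 * ρ ^ (min s 1) := by nlinarith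
      calc _ ≤ (2 * ρ ^ (min s 1)) * (2 ^ m * ρ ^ (max (s - 1) 0)) := by
            have := pL_pos hρ0.le m n (fun i => δ (i + 1))
            gcongr
        _ = _ := by rw [h4]; ring

lemma pL_le' {x ρ : ℝ} (hx : 0 < x) (hx1 : x ≤ 1) (hρ : 1 ≤ ρ) (m : ℕ) (n s δ) (hs : 0 ≤ s)
    (hxs : 1 ≤ x * ρ ^ (min s 1))
    (h : ∀ i, δ i ^ 2 = x * ρ ^ (-(1 - bt s i))) :
    pL ρ (m + 1) (n + 1) δ ≤ 2 ^ (m + 1) * x * ρ ^ s := by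
  have hρ0 : 0 < ρ := by linarith
  have h1 := pL_le hx hx1 hρ m n (max (s - 1) 0) (fun i => δ (i + 1)) (le_max_right _ _)
    (fun i => by rw [h, bt_succ])
  have h2 : ρ * δ 0 ^ 2 = x * ρ ^ (min s 1) := by
    rw [h, bt_zero hs]
    have : ρ ^ (min s 1) = ρ * ρ ^ (-(1 - min s 1)) := by
      conv_rhs => enter [1]; rw [← Real.rpow_one ρ]
      rw [← Real.rpow_add hρ0]; congr 1; ring
    rw [this]; ring
  rw [pL, h2]
  have h4 : ρ ^ s = ρ ^ (min s 1) * ρ ^ (max (s - 1) 0) := by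
    rw [← Real.rpow_add hρ0]; congr 1
    rcases le_total s 1 with h | h
    · rw [min_eq_left h, max_eq_right (by linarith)]; ring
    · rw [min_eq_right h, max_eq_left (by linarith)]; ring
  have h5 : 1 + x * ρ ^ (min s 1) ≤ 2 * x * ρ ^ (min s 1) := by linarith
  calc _ ≤ (2 * x * ρ ^ (min s 1)) * (2 ^ m * ρ ^ (max (s - 1) 0)) := by
        have := pL_pos hρ0.le m n (fun i => δ (i + 1))
        gcongr
    _ = _ := by rw [h4]; ring

lemma lower_bound {m n : ℕ} (hm : 0 < m) (hn : 0 < n) {s : ℝ} (hs : 0 < s) {M : ℝ} (hM : 1 ≤ M) :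
    ∃ c : ℝ, 0 < c ∧ ∀ᶠ ρ : ℝ in Filter.atTop, ENNReal.ofReal (c * ρ ^ (-dmt m n s)) ≤
      ∫⁻ H in {H : Fin m → Fin n → ℂ | dt (ρ / M) (Matrix.of H) < ρ ^ s}, ENNReal.ofReal (gw H) := by
  obtain ⟨m, rfl⟩ : ∃ k, m = k + 1 := ⟨m - 1, by omega⟩
  obtain ⟨n, rfl⟩ : ∃ k, n = k + 1 := ⟨n - 1, by omega⟩
  obtain ⟨c, C, hc, hC, h⟩ := tB_volume (m + 1) (n + 1)
  set x : ℝ := 1 / (C * 2 ^ (m + 2)) with hx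
  have hx0 : 0 < x := by positivity
  have hx1 : x ≤ 1 := by
    rw [hx, div_le_one (by positivity)]
    exact one_le_mul_of_one_le_of_one_le hC (one_le_pow₀ (by norm_num))
  set W := Real.exp (-(((m + 1 : ℕ) * (n + 1 : ℕ) : ℝ) * C ^ 2)) with hW
  refine ⟨W * (c * x ^ ((m + 1) * (n + 1))), by positivity, ?_⟩
  have ht : Filter.Tendsto (fun ρ : ℝ => x * ρ ^ (min s 1)) Filter.atTop Filter.atTop :=
    (tendsto_rpow_atTop (lt_min hs one_pos)).const_mul_atTop hx0
  filter_upwards [ht.eventually_ge_atTop 1, Filter.eventually_ge_atTop 1] with ρ h1 hρ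
  have hρ0 : 0 < ρ := by linarith
  set δ : ℕ → ℝ := fun i => Real.sqrt (x * ρ ^ (-(1 - bt s i))) with hδ
  have hδ2 : ∀ i, δ i ^ 2 = x * ρ ^ (-(1 - bt s i)) := fun i => Real.sq_sqrt (by positivity)
  have hδpos : ∀ i, 0 < δ i := fun i => Real.sqrt_pos.2 (by positivity)
  have hanti : Antitone δ := by
    intro i j hij
    apply Real.sqrt_le_sqrt
    apply mul_le_mul_of_nonneg_left _ hx0.le
    apply Real.rpow_le_rpow_of_exponent_le hρ
    have : bt s j ≤ bt s i := by
      unfold bt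
      have : (i:ℝ) ≤ j := by exact_mod_cast hij
      gcongr
    linarith
  have hδ1 : δ 0 ≤ 1 := by
    apply Real.sqrt_le_one.2
    apply mul_le_one₀ hx1 (by positivity)
    apply Real.rpow_le_one_of_one_le_of_nonpos hρ
    have : bt s 0 ≤ 1 := min_le_right _ _
    linarith
  have hv := h δ hanti hδpos (ρ / M) (by positivity)
  rw [vL_eq hρ0 _ _ s δ hs.le hδ2, eE_eq _ _ _ hs.le] at hv
  have hp := pL_le' hx0 hx1 hρ m n s δ hs.le h1 hδ2
  have hp2 := pL_mono (show 0 ≤ ρ / M by positivity) (div_le_self hρ0.le hM) (m + 1) (n + 1) δ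
  have hsub : tB (m + 1) (n + 1) C (ρ / M) δ ⊆
      {H : Fin (m + 1) → Fin (n + 1) → ℂ | dt (ρ / M) (Matrix.of H) < ρ ^ s} := by
    intro H hH
    have h2 := hH.2
    have hxC : C * (2 ^ (m + 1) * x) = 1 / 2 := by rw [hx]; field_simp; ring
    have hpos : 0 < ρ ^ s := by positivity
    change dt (ρ / M) (Matrix.of H) < ρ ^ s
    calc _ ≤ C * (2 ^ (m + 1) * x * ρ ^ s) := h2.trans (by gcongr; exact hp2.trans hp)
      _ = (1 / 2) * ρ ^ s := by rw [← hxC]; ring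
      _ < _ := by linarith
  calc _ = ENNReal.ofReal W * ENNReal.ofReal (c * (x ^ ((m + 1) * (n + 1)) * ρ ^ (-dmt (m + 1) (n + 1) s))) := by
        rw [← ENNReal.ofReal_mul (by positivity)]; congr 1; ring
    _ ≤ ENNReal.ofReal W * volume (tB (m + 1) (n + 1) C (ρ / M) δ) := by gcongr
    _ = ∫⁻ H in tB (m + 1) (n + 1) C (ρ / M) δ, ENNReal.ofReal W := by rw [setLIntegral_const]
    _ ≤ ∫⁻ H in tB (m + 1) (n + 1) C (ρ / M) δ, ENNReal.ofReal (gw H) := by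
        refine setLIntegral_mono' (measurableSet_tB _ _ _ _ _) fun H hH => ?_
        apply ENNReal.ofReal_le_ofReal
        apply Real.exp_le_exp.2
        apply neg_le_neg
        calc _ ≤ ∑ i : Fin (m + 1), ∑ j : Fin (n + 1), C ^ 2 := by
              gcongr with i _ j _
              exact (hH.1 i j).trans (mul_le_of_le_one_right (by linarith) hδ1)
          _ = _ := by simp; ring
    _ ≤ _ := lintegral_mono_set hsub

open scoped ENNReal

lemma pi_marg {ι ι' κ : Type} [Fintype ι] [Fintype ι'] [Fintype κ] (e : ι ⊕ ι' ≃ κ) (μ : Measure ℝ)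
    [IsProbabilityMeasure μ] :
    (Measure.pi (fun _ : κ => μ)).map (fun x (i : ι) => x (e (Sum.inl i))) =
      Measure.pi (fun _ : ι => μ) := by
  symm
  apply Measure.pi_eq
  intro s hs
  have hm : Measurable (fun (x : κ → ℝ) (i : ι) => x (e (Sum.inl i))) := by fun_prop
  rw [Measure.map_apply hm (MeasurableSet.univ_pi hs)]
  have : (fun (x : κ → ℝ) (i : ι) => x (e (Sum.inl i))) ⁻¹' Set.univ.pi s =
      Set.univ.pi (fun k => Sum.elim s (fun _ => Set.univ) (e.symm k)) := by
    ext x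
    simp only [Set.mem_preimage, Set.mem_univ_pi]
    constructor
    · intro h k
      obtain ⟨y, rfl⟩ := e.surjective k
      cases y <;> simp [h]
    · intro h i
      simpa using h (e (Sum.inl i))
  rw [this, Measure.pi_pi, ← e.prod_comp]
  simp

lemma pi_gauss {ι : Type} [Fintype ι] :
    Measure.pi (fun _ : ι => gaussianReal 0 (1/2)) =
      (volume : Measure (ι → ℝ)).withDensity
        (fun x => ENNReal.ofReal (∏ i, gaussianPDFReal 0 (1/2) (x i))) := by
  have hv : (1/2 : NNReal) ≠ 0 := by simp
  apply Measure.pi_eq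
  intro s hs
  rw [withDensity_apply _ (MeasurableSet.univ_pi hs), volume_pi, Measure.restrict_pi_pi,
    ← ofReal_integral_eq_lintegral_ofReal]
  · rw [integral_fintype_prod_eq_prod (fun _ : ι => gaussianPDFReal 0 (1/2)),
      ENNReal.ofReal_prod_of_nonneg]
    · refine Finset.prod_congr rfl fun i _ => ?_
      rw [gaussianReal_apply_eq_integral _ hv]
    · intro i _
      exact integral_nonneg fun x => gaussianPDFReal_nonneg _ _ _
  · exact Integrable.fintype_prod (f := fun _ : ι => gaussianPDFReal 0 (1/2))
      fun i => (integrable_gaussianPDFReal 0 (1/2)).integrableOn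
  · exact Filter.Eventually.of_forall fun x => Finset.prod_nonneg fun i _ => gaussianPDFReal_nonneg _ _ _

/-- Real coordinates of a complex matrix. -/
noncomputable def rc {a b : ℕ} (H : Fin a → Fin b → ℂ) (p : (Fin a × Fin b) × Bool) : ℝ :=
  if p.2 then (H p.1.1 p.1.2).re else (H p.1.1 p.1.2).im

/-- Inverse of `rc`. -/
noncomputable def rci {a b : ℕ} (x : (Fin a × Fin b) × Bool → ℝ) (i : Fin a) (j : Fin b) : ℂ :=
  ⟨x ((i, j), true), x ((i, j), false)⟩

lemma rci_rc {a b : ℕ} (H : Fin a → Fin b → ℂ) : rci (rc H) = H := by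
  ext i j <;> simp [rci, rc]

lemma measurable_rci {a b : ℕ} : Measurable (rci : ((Fin a × Fin b) × Bool → ℝ) → _) := by
  rw [measurable_pi_iff]; intro i
  rw [measurable_pi_iff]; intro j
  have : Measurable (fun x : (Fin a × Fin b) × Bool → ℝ => (x ((i, j), true), x ((i, j), false))) := by
    fun_prop
  exact Complex.measurableEquivRealProd.symm.measurable.comp this

lemma measurable_rc {a b : ℕ} : Measurable (rc : (Fin a → Fin b → ℂ) → _) := by
  rw [measurable_pi_iff]; rintro ⟨⟨i, j⟩, t⟩
  cases t <;> simp only [rc] <;> simp <;> fun_prop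

lemma mp_rc {a b : ℕ} : MeasurePreserving (rc : (Fin a → Fin b → ℂ) → _) := by
  refine ⟨measurable_rc, ?_⟩
  symm
  rw [volume_pi]
  apply Measure.pi_eq
  intro s hs
  rw [Measure.map_apply measurable_rc (MeasurableSet.univ_pi hs)]
  have h1 : (rc : (Fin a → Fin b → ℂ) → _) ⁻¹' Set.univ.pi s =
      Set.univ.pi (fun i => Set.univ.pi (fun j =>
        Complex.measurableEquivRealProd ⁻¹' (s ((i, j), true) ×ˢ s ((i, j), false)))) := by
    ext H
    simp only [Set.mem_preimage, Set.mem_univ_pi, Set.mem_prod, Prod.forall, Bool.forall_bool, rc,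
      Complex.measurableEquivRealProd_apply]
    simp [and_comm]
  rw [h1, volume_pi_pi]
  simp only [volume_pi_pi]
  simp only [Fintype.prod_prod_type, Fintype.prod_bool]
  refine Finset.prod_congr rfl fun i _ => Finset.prod_congr rfl fun j _ => ?_
  rw [Complex.volume_preserving_equiv_real_prod.measure_preimage
    ((hs _).prod (hs _)).nullMeasurableSet, Measure.volume_eq_prod, Measure.prod_prod]

lemma dens_rc {a b : ℕ} (H : Fin a → Fin b → ℂ) :
    ∏ p, gaussianPDFReal 0 (1/2) (rc H p) = (Real.pi⁻¹) ^ (a * b) * gw H := by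
  have h0 : ∀ x : ℝ, gaussianPDFReal 0 (1/2) x = (Real.sqrt Real.pi)⁻¹ * Real.exp (-x ^ 2) := by
    intro x
    rw [gaussianPDFReal]
    congr 3
    · push_cast; ring
    · push_cast; ring
  have h1 : ∀ z : ℂ, gaussianPDFReal 0 (1/2) z.re * gaussianPDFReal 0 (1/2) z.im =
      Real.pi⁻¹ * Real.exp (-‖z‖ ^ 2) := by
    intro z
    rw [h0, h0, mul_mul_mul_comm, ← Real.exp_add, ← mul_inv, Real.mul_self_sqrt Real.pi_pos.le,
      ← Complex.normSq_eq_norm_sq, Complex.normSq_apply]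
    congr 2; ring
  simp only [Fintype.prod_prod_type, Fintype.prod_bool, rc]
  simp only [if_true, Bool.false_eq_true, if_false, h1, Finset.prod_mul_distrib, Finset.prod_const,
    Finset.card_univ, Fintype.card_fin, ← Real.exp_sum, gw, Finset.sum_neg_distrib]
  rw [← pow_mul, mul_comm b a]

lemma law_rc {Ω : Type*} [MeasurableSpace Ω] (P : Measure Ω) {a b : ℕ} {ι' κ : Type} [Fintype ι']
    [Fintype κ] (e : ((Fin a × Fin b) × Bool) ⊕ ι' ≃ κ) (F : Ω → κ → ℝ)
    (hF : P.map F = Measure.pi (fun _ => gaussianReal 0 (1/2)))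
    (H : Ω → Fin a → Fin b → ℂ) (hH : ∀ ω p, rc (H ω) p = F ω (e (Sum.inl p)))
    (A : Set (Fin a → Fin b → ℂ)) (hA : MeasurableSet A) :
    P {ω | H ω ∈ A} = ENNReal.ofReal ((Real.pi⁻¹) ^ (a * b)) * ∫⁻ H in A, ENNReal.ofReal (gw H) := by
  have hae : AEMeasurable F P := by
    by_contra hcon
    rw [Measure.map_of_not_aemeasurable hcon] at hF
    have : (Measure.pi (fun _ : κ => gaussianReal 0 (1/2))) Set.univ = 1 := measure_univ
    rw [← hF] at this
    simp at this
  have hm : Measurable (fun (x : κ → ℝ) p => x (e (Sum.inl p))) := by fun_prop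
  have hset : {ω | H ω ∈ A} = F ⁻¹' ((fun (x : κ → ℝ) p => x (e (Sum.inl p))) ⁻¹' (rci ⁻¹' A)) := by
    ext ω
    have : (fun p => F ω (e (Sum.inl p))) = rc (H ω) := by
      funext p; rw [hH]
    simp [this, rci_rc]
  have hB : MeasurableSet (rci ⁻¹' A) := measurable_rci hA
  rw [hset, ← Measure.map_apply_of_aemeasurable hae (hm hB), hF, ← Measure.map_apply hm hB, pi_marg,
    pi_gauss, withDensity_apply _ hB, ← mp_rc.setLIntegral_comp_preimage hB, ← Set.preimage_comp]
  · have : (rci ∘ rc : (Fin a → Fin b → ℂ) → _) = id := funext rci_rc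
    rw [this, Set.preimage_id]
    have hpi := Real.pi_pos
    rw [← lintegral_const_mul _ (by have := measurable_gw (m := a) (n := b); fun_prop)]
    refine lintegral_congr fun H => ?_
    rw [dens_rc, ENNReal.ofReal_mul (by positivity)]
  · have := measurable_gaussianPDFReal 0 (1/2)
    fun_prop

open scoped ENNReal

lemma tendsto_log_ratio {q : ℝ → ℝ} {d : ℝ}
    (hup : ∀ ε, 0 < ε → ∃ C, 0 < C ∧ ∀ ρ : ℝ, 1 < ρ → q ρ ≤ C * ρ ^ (-d + ε))
    (hlow : ∃ c, 0 < c ∧ ∀ᶠ ρ : ℝ in Filter.atTop, c * ρ ^ (-d) ≤ q ρ) :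
    Filter.Tendsto (fun ρ => Real.log (q ρ) / Real.log ρ) Filter.atTop (nhds (-d)) := by
  obtain ⟨c, hc, hlow⟩ := hlow
  have hinv : ∀ x : ℝ, Filter.Tendsto (fun ρ => x / Real.log ρ) Filter.atTop (nhds 0) := fun x =>
    Real.tendsto_log_atTop.const_div_atTop x
  rw [tendsto_order]
  constructor
  · intro a ha
    filter_upwards [hlow, Filter.eventually_gt_atTop 1,
      (hinv (Real.log c)).eventually_const_lt (show a + d < 0 by linarith)] with ρ h1 hρ h2
    have hl := Real.log_pos hρ
    have hρ0 : 0 < ρ := by linarith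
    have h3 := Real.log_le_log (by positivity) h1
    rw [Real.log_mul hc.ne' (by positivity), Real.log_rpow hρ0] at h3
    rw [lt_div_iff₀ hl] at h2 ⊢
    linarith
  · intro a ha
    obtain ⟨C, hC, hup⟩ := hup ((a + d) / 2) (by linarith)
    filter_upwards [hlow, Filter.eventually_gt_atTop 1,
      (hinv (Real.log C)).eventually_lt_const (show 0 < (a + d) / 2 by linarith)] with ρ h1 hρ h2
    have hl := Real.log_pos hρ
    have hρ0 : 0 < ρ := by linarith
    have hq : 0 < q ρ := lt_of_lt_of_le (by positivity) h1
    have h3 := Real.log_le_log hq (hup ρ hρ)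
    rw [Real.log_mul hC.ne' (by positivity), Real.log_rpow hρ0] at h3
    rw [div_lt_iff₀ hl] at h2 ⊢
    linarith

lemma event_iff {a b M L : ℕ} (hM : 0 < M) (hL : 0 < L) {r ρ : ℝ} (hρ : 1 < ρ)
    (H : Matrix (Fin a) (Fin b) ℂ) :
    (L : ℝ) * cap M ρ H < r * Real.log ρ ↔ dt (ρ / M) (Matrix.of (fun i j => H i j)) < ρ ^ (r / L) := by
  have hρ0 : 0 < ρ := by linarith
  have hc : cap M ρ H = Real.log (dt (ρ / M) H) := rfl
  have hof : (Matrix.of (fun i j => H i j)) = H := rfl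
  have hd := one_le_dt (show 0 ≤ ρ / M by positivity) H
  have hL' : (0:ℝ) < L := by exact_mod_cast hL
  rw [hc, hof, Real.lt_rpow_iff_log_lt (by linarith) hρ0, div_mul_eq_mul_div, lt_div_iff₀ hL', mul_comm]

lemma link {Ω : Type*} [MeasurableSpace Ω] (P : Measure Ω) [IsProbabilityMeasure P] {a b M L : ℕ}
    (ha : 0 < a) (hb : 0 < b) (hM : 0 < M) (hL : 0 < L) {r : ℝ} (hr : 0 < r)
    (H : Ω → Matrix (Fin a) (Fin b) ℂ)
    (law : ∀ A : Set (Fin a → Fin b → ℂ), MeasurableSet A → P {ω | (fun i j => H ω i j) ∈ A} =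
      ENNReal.ofReal ((Real.pi⁻¹) ^ (a * b)) * ∫⁻ H in A, ENNReal.ofReal (gw H)) :
    (∀ ε, 0 < ε → ∃ C, 0 < C ∧ ∀ ρ : ℝ, 1 < ρ →
      (P {ω | (L : ℝ) * cap M ρ (H ω) < r * Real.log ρ}).toReal ≤ C * ρ ^ (-dmt a b (r / L) + ε)) ∧
    (∃ c, 0 < c ∧ ∀ᶠ ρ : ℝ in Filter.atTop, c * ρ ^ (-dmt a b (r / L)) ≤
      (P {ω | (L : ℝ) * cap M ρ (H ω) < r * Real.log ρ}).toReal) := by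
  have hL' : (0:ℝ) < L := by exact_mod_cast hL
  have hM' : (1:ℝ) ≤ M := by exact_mod_cast hM
  set s := r / L with hs
  have hs0 : 0 < s := by positivity
  set κ := (Real.pi⁻¹) ^ (a * b) with hκ
  have hκ0 : 0 < κ := by have := Real.pi_pos; positivity
  have hP : ∀ ρ : ℝ, 1 < ρ → P {ω | (L : ℝ) * cap M ρ (H ω) < r * Real.log ρ} =
      ENNReal.ofReal κ * ∫⁻ H in {H : Fin a → Fin b → ℂ | dt (ρ / M) (Matrix.of H) < ρ ^ s},
        ENNReal.ofReal (gw H) := by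
    intro ρ hρ
    rw [← law _ (measurableSet_lt (measurable_dt _) measurable_const)]
    congr 1
    ext ω
    exact event_iff hM hL hρ (H ω)
  constructor
  · intro ε hε
    by_cases hlt : s < (min a b : ℕ)
    · obtain ⟨C, hC, h⟩ := upper_bound hs0.le hlt hε (show (0:ℝ) < M by linarith)
      refine ⟨κ * C + 1, by positivity, fun ρ hρ => ?_⟩
      have hρ0 : 0 < ρ := by linarith
      rw [hP ρ hρ]
      have h1 : ENNReal.ofReal κ * ∫⁻ H in {H : Fin a → Fin b → ℂ | dt (ρ / M) (Matrix.of H) < ρ ^ s},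
        ENNReal.ofReal (gw H) ≤ ENNReal.ofReal ((κ * C + 1) * ρ ^ (-dmt a b s + ε)) := by
        calc _ ≤ ENNReal.ofReal κ * ENNReal.ofReal (C * ρ ^ (-dmt a b s + ε)) := by
              gcongr; exact h ρ hρ
          _ = ENNReal.ofReal ((κ * C) * ρ ^ (-dmt a b s + ε)) := by
              rw [← ENNReal.ofReal_mul hκ0.le, mul_assoc]
          _ ≤ _ := by
              apply ENNReal.ofReal_le_ofReal
              gcongr; linarith
      exact ENNReal.toReal_le_of_le_ofReal (by positivity) h1
    · refine ⟨1, one_pos, fun ρ hρ => ?_⟩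
      have h0 : dmt a b s = 0 := by rw [dmt, if_pos (not_lt.1 hlt)]
      rw [h0, neg_zero, zero_add, one_mul]
      refine le_trans ?_ (Real.one_le_rpow hρ.le hε.le)
      exact ENNReal.toReal_le_of_le_ofReal zero_le_one (by rw [ENNReal.ofReal_one]; exact prob_le_one)
  · obtain ⟨c, hc, h⟩ := lower_bound ha hb hs0 hM'
    refine ⟨κ * c, by positivity, ?_⟩
    filter_upwards [h, Filter.eventually_gt_atTop 1] with ρ h hρ
    have hρ0 : 0 < ρ := by linarith
    have h1 : ENNReal.ofReal (κ * c * ρ ^ (-dmt a b s)) ≤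
        P {ω | (L : ℝ) * cap M ρ (H ω) < r * Real.log ρ} := by
      rw [hP ρ hρ, mul_assoc, ENNReal.ofReal_mul hκ0.le]
      gcongr
    exact (ENNReal.ofReal_le_iff_le_toReal (measure_ne_top _ _)).1 h1

/-- **Theorem 2** (DMDT of the fixed ARQ protocol, three-node network, long-term static
channel): if `H1`, `H2` are independent standard complex Gaussian random matrices
(i.i.d. entries with independent `N(0,1/2)` real and imaginary parts), then the outage
probability `P(L1 C₁(ρ) < r log ρ ∨ L2 C₂(ρ) < r log ρ)` has SNR exponent
`- min (d^{(M1,M2)}(r/L1)) (d^{(M2,M3)}(r/L2))`. -/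
theorem fixedARQ_DMDT_threeNode_longTerm
    {Ω : Type*} [MeasurableSpace Ω] (P : Measure Ω) [IsProbabilityMeasure P]
    (M1 M2 M3 : ℕ) (hM1 : 0 < M1) (hM2 : 0 < M2) (hM3 : 0 < M3)
    (L1 L2 : ℕ) (hL1 : 0 < L1) (hL2 : 0 < L2) (r : ℝ) (hr : 0 < r)
    (H1 : Ω → Matrix (Fin M2) (Fin M1) ℂ) (H2 : Ω → Matrix (Fin M3) (Fin M2) ℂ)
    (hGauss : Measure.map
      (fun ω (p : ((Fin M2 × Fin M1) ⊕ (Fin M3 × Fin M2)) × Bool) =>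
        Sum.elim
          (fun q => if p.2 then (H1 ω q.1 q.2).re else (H1 ω q.1 q.2).im)
          (fun q => if p.2 then (H2 ω q.1 q.2).re else (H2 ω q.1 q.2).im) p.1) P
      = Measure.pi (fun _ => gaussianReal 0 (1/2))) :
    Filter.Tendsto (fun ρ : ℝ =>
        Real.log ((P {ω | (L1 : ℝ) * cap M1 ρ (H1 ω) < r * Real.log ρ ∨
                          (L2 : ℝ) * cap M2 ρ (H2 ω) < r * Real.log ρ}).toReal)
          / Real.log ρ)
      Filter.atTop
      (nhds (-(min (dmt M1 M2 (r / L1)) (dmt M2 M3 (r / L2))))) := by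
  set F : Ω → ((Fin M2 × Fin M1) ⊕ (Fin M3 × Fin M2)) × Bool → ℝ :=
      (fun ω (p : ((Fin M2 × Fin M1) ⊕ (Fin M3 × Fin M2)) × Bool) =>
        Sum.elim
          (fun q => if p.2 then (H1 ω q.1 q.2).re else (H1 ω q.1 q.2).im)
          (fun q => if p.2 then (H2 ω q.1 q.2).re else (H2 ω q.1 q.2).im) p.1) with hF
  have law1 := law_rc P (Equiv.sumProdDistrib (Fin M2 × Fin M1) (Fin M3 × Fin M2) Bool).symm F hGauss
    (fun ω i j => H1 ω i j) (fun ω p => rfl)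
  have law2 := law_rc P ((Equiv.sumComm _ _).trans
    (Equiv.sumProdDistrib (Fin M2 × Fin M1) (Fin M3 × Fin M2) Bool).symm) F hGauss
    (fun ω i j => H2 ω i j) (fun ω p => rfl)
  obtain ⟨up1, low1⟩ := link P hM2 hM1 hM1 hL1 hr H1 law1
  obtain ⟨up2, low2⟩ := link P hM3 hM2 hM2 hL2 hr H2 law2
  rw [dmt_comm M2 M1] at low1
  simp only [dmt_comm M2 M1] at up1
  rw [dmt_comm M3 M2] at low2
  simp only [dmt_comm M3 M2] at up2
  set d1 := dmt M1 M2 (r / L1)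
  set d2 := dmt M2 M3 (r / L2)
  apply tendsto_log_ratio
  · intro ε hε
    obtain ⟨C1, hC1, h1⟩ := up1 ε hε
    obtain ⟨C2, hC2, h2⟩ := up2 ε hε
    refine ⟨C1 + C2, by positivity, fun ρ hρ => ?_⟩
    have hu : (P {ω | (L1 : ℝ) * cap M1 ρ (H1 ω) < r * Real.log ρ ∨
        (L2 : ℝ) * cap M2 ρ (H2 ω) < r * Real.log ρ}).toReal ≤
        (P {ω | (L1 : ℝ) * cap M1 ρ (H1 ω) < r * Real.log ρ}).toReal +
        (P {ω | (L2 : ℝ) * cap M2 ρ (H2 ω) < r * Real.log ρ}).toReal := by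
      rw [← ENNReal.toReal_add (measure_ne_top _ _) (measure_ne_top _ _)]
      apply ENNReal.toReal_mono (by simp [measure_ne_top])
      exact measure_union_le _ _
    have e1 : ρ ^ (-d1 + ε) ≤ ρ ^ (-min d1 d2 + ε) :=
      Real.rpow_le_rpow_of_exponent_le hρ.le (by linarith [min_le_left d1 d2])
    have e2 : ρ ^ (-d2 + ε) ≤ ρ ^ (-min d1 d2 + ε) :=
      Real.rpow_le_rpow_of_exponent_le hρ.le (by linarith [min_le_right d1 d2])
    have f1 := mul_le_mul_of_nonneg_left e1 hC1.le
    have f2 := mul_le_mul_of_nonneg_left e2 hC2.le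
    have g1 := h1 ρ hρ
    have g2 := h2 ρ hρ
    rw [add_mul]
    linarith
  · rcases le_total d1 d2 with h | h
    · rw [min_eq_left h]
      obtain ⟨c, hc, hl⟩ := low1
      refine ⟨c, hc, hl.mono fun ρ hρ => hρ.trans ?_⟩
      exact ENNReal.toReal_mono (measure_ne_top _ _) (measure_mono fun ω hω => Or.inl hω)
    · rw [min_eq_right h]
      obtain ⟨c, hc, hl⟩ := low2
      refine ⟨c, hc, hl.mono fun ρ hρ => hρ.trans ?_⟩
      exact ENNReal.toReal_mono (measure_ne_top _ _) (measure_mono fun ω hω => Or.inr hω)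
end

section
/- Fix positive integers M1, M2, M3, an integer L ≥ 2, and a real r > 0. Let H1 and H2 be independent standard complex Gaussian random matrices of sizes M2×M1 and M3×M2, and for ρ > 1 let C_i(ρ) = log det(I + (ρ/M_i) H_i H_i†). Define the integer decoding times t_i(ρ) = min{ t ∈ ℤ, t ≥ 1 : t·C_i(ρ) ≥ r·log ρ } (with t_i(ρ) = +∞ if no such t exists). Then lim_{ρ→∞} log P( t_1(ρ) + t_2(ρ) > L ) / log ρ = − min{ d^{(M1,M2)}(r/l1) + d^{(M2,M3)}(r/l2) : l1, l2 ∈ ℤ, l1, l2 ≥ 0, l1 + l2 = L−1 }, where by convention d^{(m,n)}(r/0) := 0. (Theorem 3: DMDT of the fixed-block-length (FBL) ARQ protocol for a three-node MIMO multihop network under the long-term static channel assumption.) -/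
open MeasureTheory ProbabilityTheory

/-- `d^{(m,n)}(r / l)` with the convention `d^{(m,n)}(r/0) := 0`. -/
noncomputable def dmtDiv (m n : ℕ) (r : ℝ) (l : ℕ) : ℝ :=
  if l = 0 then 0 else dmt m n (r / l)

/-- The integer decoding time `min {t ∈ ℤ, t ≥ 1 : t · C ≥ R}`, equal to `+∞` (the top
element of `ℕ∞`) if no such `t` exists. -/
noncomputable def decTime (C R : ℝ) : ℕ∞ :=
  sInf {t : ℕ∞ | ∃ n : ℕ, t = (n : ℕ∞) ∧ 1 ≤ n ∧ R ≤ (n : ℝ) * C}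
namespace FBL
set_option linter.unusedSectionVars false
open Matrix
open scoped ComplexOrder MatrixOrder

section LinAlg
variable {m n k : Type*} [Fintype m] [DecidableEq m] [Fintype n] [DecidableEq n]

lemma one_le_det_one_add {A : Matrix m m ℂ} (hA : A.PosSemidef) : 1 ≤ (1 + A).det := by
  have h := hA.1.spectral_theorem
  have h2 : (1 + A).det = ∏ i, (1 + (hA.1.eigenvalues i : ℂ)) := by
    conv_lhs => rw [h, Unitary.conjStarAlgAut_apply, mul_assoc, det_one_add_mul_comm]
    rw [mul_assoc, Unitary.coe_star_mul_self, mul_one, ← diagonal_one, diagonal_add, det_diagonal]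
    rfl
  rw [h2]
  have h3 : ∀ i, (1:ℝ) ≤ 1 + hA.1.eigenvalues i := fun i => by
    have := hA.eigenvalues_nonneg i; linarith
  have h4 : (1:ℝ) ≤ ∏ i, (1 + hA.1.eigenvalues i) := by
    calc (1:ℝ) = ∏ i : m, (1:ℝ) := by simp
    _ ≤ _ := Finset.prod_le_prod (fun _ _ => zero_le_one) (fun i _ => h3 i)
  exact_mod_cast h4

lemma det_mono {A B : Matrix m m ℂ} (hA : A.PosDef) (hB : (B - A).PosSemidef) :
    A.det ≤ B.det := by
  obtain ⟨C, hC⟩ := CStarAlgebra.nonneg_iff_eq_star_mul_self.mp hB.nonneg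
  have hB' : B = A + star C * C := by rw [← hC]; abel
  rw [hB', det_add_mul _ _ ((Matrix.isUnit_iff_isUnit_det _).1 hA.isUnit)]
  have h1 : (C * A⁻¹ * star C).PosSemidef := hA.inv.posSemidef.mul_mul_conjTranspose_same C
  have := mul_le_mul_of_nonneg_left (one_le_det_one_add h1) hA.det_pos.le
  simpa using this

/-- real determinant `det (I + ρ H Hᴴ)` -/
noncomputable def dG (ρ : ℝ) (H : Matrix m n ℂ) : ℝ := (1 + (ρ : ℂ) • (H * Hᴴ)).det.re

lemma psd_smul {ρ : ℝ} (hρ : 0 ≤ ρ) {A : Matrix m m ℂ} (hA : A.PosSemidef) :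
    ((ρ : ℂ) • A).PosSemidef := hA.smul (by exact_mod_cast hρ)

lemma pd_one_add {A : Matrix m m ℂ} (hA : A.PosSemidef) : (1 + A).PosDef :=
  PosDef.one.add_posSemidef hA

lemma dG_coe {ρ : ℝ} (hρ : 0 ≤ ρ) (H : Matrix m n ℂ) :
    (1 + (ρ : ℂ) • (H * Hᴴ)).det = (dG ρ H : ℂ) := by
  have h := (pd_one_add (psd_smul hρ (posSemidef_self_mul_conjTranspose H))).det_pos
  rw [Complex.pos_iff] at h
  exact Complex.ext rfl (by simpa using h.2.symm)

lemma one_le_dG {ρ : ℝ} (hρ : 0 ≤ ρ) (H : Matrix m n ℂ) : 1 ≤ dG ρ H := by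
  have := one_le_det_one_add (psd_smul hρ (posSemidef_self_mul_conjTranspose H))
  rw [dG_coe hρ] at this
  exact_mod_cast this

lemma psd_bound [Fintype k] {N : ℝ} (L : Matrix k m ℂ) (hL : ∀ i j, ‖L i j‖ ≤ 1)
    (hN : (Fintype.card k * Fintype.card m : ℝ) ≤ N) :
    ((N : ℂ) • (1 : Matrix m m ℂ) - Lᴴ * L).PosSemidef := by
  have hH : ((N : ℂ) • (1 : Matrix m m ℂ) - Lᴴ * L).IsHermitian := by
    refine IsHermitian.sub ?_ (isHermitian_conjTranspose_mul_self L)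
    simp [IsHermitian, conjTranspose_smul]
  refine PosSemidef.of_dotProduct_mulVec_nonneg hH fun x => ?_
  have e1 : star x ⬝ᵥ x = ((∑ j, ‖x j‖ ^ 2 : ℝ) : ℂ) := by
    simp [dotProduct, ← Complex.normSq_eq_conj_mul_self, Complex.normSq_eq_norm_sq]
  have e2 : star x ⬝ᵥ (Lᴴ * L) *ᵥ x = ((∑ i, ‖(L *ᵥ x) i‖ ^ 2 : ℝ) : ℂ) := by
    rw [← mulVec_mulVec, dotProduct_mulVec, vecMul_conjTranspose, star_star]
    simp [dotProduct, ← Complex.normSq_eq_conj_mul_self, Complex.normSq_eq_norm_sq]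
  rw [sub_mulVec, dotProduct_sub, smul_mulVec, one_mulVec, dotProduct_smul, e1, e2, smul_eq_mul,
    sub_nonneg]
  have h3 : ∀ i, ‖(L *ᵥ x) i‖ ^ 2 ≤ Fintype.card m * ∑ j, ‖x j‖ ^ 2 := fun i => by
    have : ‖(L *ᵥ x) i‖ ≤ ∑ j, ‖x j‖ := by
      refine (norm_sum_le _ _).trans (Finset.sum_le_sum fun j _ => ?_)
      rw [norm_mul]
      exact mul_le_of_le_one_left (norm_nonneg _) (hL i j)
    calc ‖(L *ᵥ x) i‖ ^ 2 ≤ (∑ j, ‖x j‖) ^ 2 := by gcongr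
    _ ≤ _ := by simpa using sq_sum_le_card_mul_sum_sq (s := Finset.univ) (f := fun j => ‖x j‖)
  have h4 : ∑ i, ‖(L *ᵥ x) i‖ ^ 2 ≤ N * ∑ j, ‖x j‖ ^ 2 := by
    calc _ ≤ ∑ i : k, (Fintype.card m * ∑ j, ‖x j‖ ^ 2 : ℝ) := Finset.sum_le_sum fun i _ => h3 i
    _ = (Fintype.card k * Fintype.card m : ℝ) * ∑ j, ‖x j‖ ^ 2 := by simp [mul_assoc]
    _ ≤ _ := by gcongr
  exact_mod_cast h4

lemma dG_comm (ρ : ℝ) (H : Matrix m n ℂ) : dG ρ Hᴴ = dG ρ H := by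
  unfold dG
  rw [conjTranspose_conjTranspose, ← Matrix.smul_mul, det_one_add_mul_comm, Matrix.mul_smul]

lemma dG_scale {ρ κ : ℝ} (hρ : 0 ≤ ρ) (hκ : 1 ≤ κ) (H : Matrix m n ℂ) :
    dG (κ * ρ) H ≤ κ ^ Fintype.card m * dG ρ H := by
  have hY := psd_smul hρ (posSemidef_self_mul_conjTranspose H)
  have hκ0 : 0 ≤ κ * ρ := by positivity
  have h := det_mono (pd_one_add (psd_smul hκ0 (posSemidef_self_mul_conjTranspose H)))
    (B := (κ : ℂ) • (1 + (ρ : ℂ) • (H * Hᴴ))) (by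
      have : (κ : ℂ) • (1 + (ρ : ℂ) • (H * Hᴴ)) - (1 + ((κ * ρ : ℝ) : ℂ) • (H * Hᴴ))
          = ((κ - 1 : ℝ) : ℂ) • (1 : Matrix m m ℂ) := by
        push_cast; rw [smul_add, smul_smul, sub_smul, one_smul]; abel
      rw [this]
      exact psd_smul (by linarith) PosSemidef.one)
  rw [det_smul, dG_coe hκ0, dG_coe hρ] at h
  exact_mod_cast h

lemma dG_mono {ρ ρ' : ℝ} (hρ : 0 ≤ ρ) (h : ρ ≤ ρ') (H : Matrix m n ℂ) : dG ρ H ≤ dG ρ' H := by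
  have h := det_mono (pd_one_add (psd_smul hρ (posSemidef_self_mul_conjTranspose H)))
    (B := 1 + (ρ' : ℂ) • (H * Hᴴ)) (by
      have : 1 + (ρ' : ℂ) • (H * Hᴴ) - (1 + (ρ : ℂ) • (H * Hᴴ))
          = ((ρ' - ρ : ℝ) : ℂ) • (H * Hᴴ) := by
        push_cast; rw [sub_smul]; abel
      rw [this]
      exact psd_smul (by linarith) (posSemidef_self_mul_conjTranspose H))
  rw [dG_coe hρ, dG_coe (hρ.trans ‹_›)] at h
  exact_mod_cast h

/-- one sided multiplication by a matrix with entries bounded by one -/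
lemma dG_mul_right {ρ N : ℝ} (hρ : 0 ≤ ρ) (X : Matrix m n ℂ) (U : Matrix n n ℂ)
    (hU : ∀ i j, ‖U i j‖ ≤ 1) (hN : (Fintype.card n * Fintype.card n : ℝ) ≤ N) (hN1 : 1 ≤ N) :
    dG ρ (X * U) ≤ N ^ Fintype.card m * dG ρ X := by
  refine le_trans ?_ (dG_scale hρ hN1 X)
  have hNρ : 0 ≤ N * ρ := by positivity
  have h := det_mono (pd_one_add (psd_smul hρ (posSemidef_self_mul_conjTranspose (X * U))))
    (B := 1 + ((N * ρ : ℝ) : ℂ) • (X * Xᴴ)) (by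
      have h0 : 1 + ((N * ρ : ℝ) : ℂ) • (X * Xᴴ) - (1 + (ρ : ℂ) • (X * U * (X * U)ᴴ))
          = (ρ : ℂ) • (X * ((N : ℂ) • (1 : Matrix n n ℂ) - Uᴴᴴ * Uᴴ) * Xᴴ) := by
        push_cast
        rw [conjTranspose_mul, conjTranspose_conjTranspose, Matrix.mul_sub, Matrix.sub_mul, smul_sub,
          Matrix.mul_smul, Matrix.smul_mul, smul_smul, Matrix.mul_one, mul_comm (N : ℂ)]
        simp only [Matrix.mul_assoc]
        abel
      rw [h0]
      exact psd_smul hρ ((psd_bound Uᴴ (by simpa using fun i j => hU j i) hN).mul_mul_conjTranspose_same X))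
  rw [dG_coe hρ, dG_coe hNρ] at h
  exact_mod_cast h

lemma dG_mul {ρ N : ℝ} (hρ : 0 ≤ ρ) (L : Matrix m m ℂ) (X : Matrix m n ℂ) (U : Matrix n n ℂ)
    (hL : ∀ i j, ‖L i j‖ ≤ 1) (hU : ∀ i j, ‖U i j‖ ≤ 1)
    (hN : (Fintype.card n * Fintype.card n : ℝ) ≤ N)
    (hN' : (Fintype.card m * Fintype.card m : ℝ) ≤ N) (hN1 : 1 ≤ N) :
    dG ρ (L * X * U) ≤ N ^ (Fintype.card m + Fintype.card n) * dG ρ X := by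
  refine (dG_mul_right hρ (L * X) U hU hN hN1).trans ?_
  rw [pow_add, mul_assoc]
  gcongr
  rw [← dG_comm ρ (L * X), ← dG_comm ρ X, conjTranspose_mul]
  exact dG_mul_right hρ _ _ (by simpa using fun i j => hL j i) hN' hN1

lemma dG_submatrix {m' n' : Type*} [Fintype m'] [DecidableEq m'] [Fintype n'] [DecidableEq n']
    (ρ : ℝ) (H : Matrix m n ℂ) (e : m' ≃ m) (f : n' ≃ n) : dG ρ (H.submatrix e f) = dG ρ H := by
  unfold dG
  rw [← det_submatrix_equiv_self e (1 + (ρ : ℂ) • (H * Hᴴ)), submatrix_add, submatrix_smul]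
  simp only [Pi.add_apply, Pi.smul_apply]
  rw [conjTranspose_submatrix, submatrix_mul_equiv, submatrix_one_equiv]

lemma dG_block (ρ : ℝ) (hρ : 0 ≤ ρ) (a : ℂ) (S : Matrix m n ℂ) :
    dG ρ (fromBlocks (Matrix.of fun (_ _ : Unit) => a) 0 0 S) = (1 + ρ * ‖a‖ ^ 2) * dG ρ S := by
  have h : (1 + (ρ : ℂ) • (fromBlocks (Matrix.of fun (_ _ : Unit) => a) 0 0 S *
      (fromBlocks (Matrix.of fun (_ _ : Unit) => a) 0 0 S)ᴴ)).det =
      (((1 + ρ * ‖a‖ ^ 2) * dG ρ S : ℝ) : ℂ) := by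
    rw [fromBlocks_conjTranspose, fromBlocks_multiply, fromBlocks_smul, ← fromBlocks_one,
      fromBlocks_add]
    simp only [Matrix.mul_zero, Matrix.zero_mul, add_zero, zero_add, conjTranspose_zero, smul_zero]
    rw [det_fromBlocks_zero₂₁, dG_coe hρ S]
    have : (1 + (ρ : ℂ) • ((Matrix.of fun (_ _ : Unit) => a) *
        (Matrix.of fun (_ _ : Unit) => a)ᴴ)).det = 1 + (ρ : ℂ) * (‖a‖ : ℂ) ^ 2 := by
      rw [det_unique]
      simp [Matrix.mul_apply, Complex.mul_conj, Complex.normSq_eq_norm_sq]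
    rw [this]
    push_cast
    ring
  have := congrArg Complex.re h
  rw [Complex.ofReal_re] at this
  exact this

end LinAlg
end FBL

namespace FBL
open Matrix

/-- matrix with pivot entry `a` at `(p,q)`, rest of pivot row `b`, rest of pivot column `c`,
remaining block `D`. -/
def asm {m n : ℕ} (p : Fin (m+1)) (q : Fin (n+1)) (a : ℂ) (b : Fin n → ℂ) (c : Fin m → ℂ)
    (D : Fin m → Fin n → ℂ) : Fin (m+1) → Fin (n+1) → ℂ :=
  p.insertNth (α := fun _ => Fin (n+1) → ℂ) (q.insertNth (α := fun _ => ℂ) a b)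
    (fun i => q.insertNth (α := fun _ => ℂ) (c i) (D i))

section
variable {m n : ℕ} (p : Fin (m+1)) (q : Fin (n+1)) (a : ℂ) (b : Fin n → ℂ) (c : Fin m → ℂ)
    (D : Fin m → Fin n → ℂ)

@[simp] lemma asm_pq : asm p q a b c D p q = a := by simp [asm]
@[simp] lemma asm_pj (j) : asm p q a b c D p (q.succAbove j) = b j := by simp [asm]
@[simp] lemma asm_iq (i) : asm p q a b c D (p.succAbove i) q = c i := by simp [asm]
@[simp] lemma asm_ij (i j) : asm p q a b c D (p.succAbove i) (q.succAbove j) = D i j := by simp [asm]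
end

/-- The sum of a point and `Fin m` as `Fin (m+1)` with distinguished element `p`. -/
def pivEquiv {m : ℕ} (p : Fin (m+1)) : Unit ⊕ Fin m ≃ Fin (m+1) :=
  (Equiv.sumComm _ _).trans ((Equiv.optionEquivSumPUnit (Fin m)).symm.trans (finSuccEquiv' p).symm)

@[simp] lemma pivEquiv_inl {m : ℕ} (p : Fin (m+1)) (x) : pivEquiv p (Sum.inl x) = p := by
  simp [pivEquiv]
@[simp] lemma pivEquiv_inr {m : ℕ} (p : Fin (m+1)) (i) :
    pivEquiv p (Sum.inr i) = p.succAbove i := by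
  simp [pivEquiv]

noncomputable def gG {m n : ℕ} (ρ : ℝ) (H : Fin m → Fin n → ℂ) : ℝ := dG ρ (Matrix.of H)

lemma one_le_gG {m n : ℕ} {ρ : ℝ} (hρ : 0 ≤ ρ) (H : Fin m → Fin n → ℂ) : 1 ≤ gG ρ H :=
  one_le_dG hρ _

/-- the unit triangular factors -/
def Lf {m : ℕ} (w : Fin m → ℂ) : Matrix (Unit ⊕ Fin m) (Unit ⊕ Fin m) ℂ :=
  fromBlocks 1 0 (Matrix.of fun i _ => w i) 1
def Uf {n : ℕ} (z : Fin n → ℂ) : Matrix (Unit ⊕ Fin n) (Unit ⊕ Fin n) ℂ :=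
  fromBlocks 1 (Matrix.of fun _ j => z j) 0 1

lemma Lf_bound {m : ℕ} (w : Fin m → ℂ) (hw : ∀ i, ‖w i‖ ≤ 1) (i j) : ‖Lf w i j‖ ≤ 1 := by
  rcases i with i | i <;> rcases j with j | j <;> simp [Lf, hw]
  rw [Matrix.one_apply]; split_ifs <;> simp
lemma Uf_bound {m : ℕ} (w : Fin m → ℂ) (hw : ∀ i, ‖w i‖ ≤ 1) (i j) : ‖Uf w i j‖ ≤ 1 := by
  rcases i with i | i <;> rcases j with j | j <;> simp [Uf, hw]
  rw [Matrix.one_apply]; split_ifs <;> simp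

lemma Lf_neg {m : ℕ} (w : Fin m → ℂ) : Lf (-w) * Lf w = 1 := by
  rw [Lf, Lf, fromBlocks_multiply, ← fromBlocks_one]
  congr 1 <;> ext <;> simp
lemma Uf_neg {m : ℕ} (w : Fin m → ℂ) : Uf w * Uf (-w) = 1 := by
  rw [Uf, Uf, fromBlocks_multiply, ← fromBlocks_one]
  congr 1 <;> ext <;> simp

lemma asm_factor {m n : ℕ} (p : Fin (m+1)) (q : Fin (n+1)) (a : ℂ) (z : Fin n → ℂ) (w : Fin m → ℂ)
    (S : Fin m → Fin n → ℂ) :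
    (Matrix.of (asm p q a (fun j => a * z j) (fun i => w i * a)
      (fun i j => S i j + w i * a * z j))).submatrix (pivEquiv p) (pivEquiv q)
    = Lf w * fromBlocks (Matrix.of fun (_ _ : Unit) => a) 0 0 (Matrix.of S) * Uf z := by
  rw [Lf, Uf, fromBlocks_multiply, fromBlocks_multiply]
  ext i j
  rcases i with i | i <;> rcases j with j | j <;> simp [Matrix.mul_apply, add_comm]

noncomputable def KK (m n : ℕ) : ℝ := ((m + n + 2 : ℝ) ^ 2) ^ ((m + 1) + (n + 1))

lemma KK_pos (m n : ℕ) : 0 < KK m n := by unfold KK; positivity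

lemma gG_pivot {m n : ℕ} {ρ : ℝ} (hρ : 0 ≤ ρ) (p : Fin (m+1)) (q : Fin (n+1)) (a : ℂ)
    (z : Fin n → ℂ) (w : Fin m → ℂ) (S : Fin m → Fin n → ℂ) (hz : ∀ j, ‖z j‖ ≤ 1)
    (hw : ∀ i, ‖w i‖ ≤ 1) :
    (1 + ρ * ‖a‖ ^ 2) * gG ρ S ≤ KK m n * gG ρ (asm p q a (fun j => a * z j) (fun i => w i * a)
      (fun i j => S i j + w i * a * z j)) ∧
    gG ρ (asm p q a (fun j => a * z j) (fun i => w i * a) (fun i j => S i j + w i * a * z j))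
      ≤ KK m n * ((1 + ρ * ‖a‖ ^ 2) * gG ρ S) := by
  have hf := asm_factor p q a z w S
  set H := asm p q a (fun j => a * z j) (fun i => w i * a) (fun i j => S i j + w i * a * z j)
  have h1 : gG ρ H = dG ρ ((Matrix.of H).submatrix (pivEquiv p) (pivEquiv q)) :=
    (dG_submatrix _ _ _ _).symm
  have h2 := dG_block ρ hρ a (Matrix.of S)
  have hN : ((Fintype.card (Unit ⊕ Fin n)) * (Fintype.card (Unit ⊕ Fin n)) : ℝ)
      ≤ (m + n + 2 : ℝ) ^ 2 := by
    simp only [Fintype.card_sum, Fintype.card_unit, Fintype.card_fin]; push_cast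
    nlinarith [(Nat.cast_nonneg m : (0:ℝ) ≤ m), (Nat.cast_nonneg n : (0:ℝ) ≤ n)]
  have hN' : ((Fintype.card (Unit ⊕ Fin m)) * (Fintype.card (Unit ⊕ Fin m)) : ℝ)
      ≤ (m + n + 2 : ℝ) ^ 2 := by
    simp only [Fintype.card_sum, Fintype.card_unit, Fintype.card_fin]; push_cast
    nlinarith [(Nat.cast_nonneg m : (0:ℝ) ≤ m), (Nat.cast_nonneg n : (0:ℝ) ≤ n)]
  have hN1 : 1 ≤ (m + n + 2 : ℝ) ^ 2 := by
    nlinarith [(Nat.cast_nonneg m : (0:ℝ) ≤ m), (Nat.cast_nonneg n : (0:ℝ) ≤ n)]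
  have hK : KK m n = ((m + n + 2 : ℝ) ^ 2) ^
      (Fintype.card (Unit ⊕ Fin m) + Fintype.card (Unit ⊕ Fin n)) := by
    simp [KK, add_comm]
  change _ * dG ρ (Matrix.of S) ≤ _ ∧ _ ≤ _ * (_ * dG ρ (Matrix.of S))
  rw [← h2, h1, hf, hK]
  constructor
  · have := dG_mul hρ (Lf (-w)) (Lf w * fromBlocks (Matrix.of fun (_ _ : Unit) => a) 0 0 (Matrix.of S) * Uf z)
      (Uf (-z)) (Lf_bound _ (by simpa using hw)) (Uf_bound _ (by simpa using hz)) hN hN' hN1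
    have e : Lf (-w) * (Lf w * fromBlocks (Matrix.of fun (_ _ : Unit) => a) 0 0 (Matrix.of S) * Uf z)
      * Uf (-z) = fromBlocks (Matrix.of fun (_ _ : Unit) => a) 0 0 (Matrix.of S) := by
      rw [Matrix.mul_assoc, Matrix.mul_assoc (Lf w * _), Uf_neg, Matrix.mul_one,
        ← Matrix.mul_assoc, Lf_neg, Matrix.one_mul]
    rwa [e] at this
  · exact dG_mul hρ _ _ _ (Lf_bound _ hw) (Uf_bound _ hz) hN hN' hN1

open MeasureTheory
open scoped ENNReal

lemma continuous_gG {m n : ℕ} (ρ : ℝ) : Continuous (fun H : Fin m → Fin n → ℂ => gG ρ H) := by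
  unfold gG dG
  refine Complex.continuous_re.comp (Continuous.matrix_det ?_)
  have : Continuous (fun H : Fin m → Fin n → ℂ => Matrix.of H) := continuous_id
  fun_prop

lemma measurable_gG {m n : ℕ} (ρ : ℝ) : Measurable (fun H : Fin m → Fin n → ℂ => gG ρ H) :=
  (continuous_gG ρ).measurable

lemma lintegral_insertNth {α : Type} [MeasureSpace α] [SigmaFinite (volume : Measure α)] {n : ℕ}
    (q : Fin (n+1)) (f : (Fin (n+1) → α) → ℝ≥0∞) (hf : Measurable f) :
    ∫⁻ x, f x = ∫⁻ a : α, ∫⁻ b : Fin n → α, f (q.insertNth (α := fun _ => α) a b) := by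
  have h := (volume_preserving_piFinSuccAbove (fun _ : Fin (n+1) => α) q).symm
  rw [← h.lintegral_comp hf]
  exact lintegral_prod _ (hf.comp h.measurable).aemeasurable

lemma lintegral_cols {m n : ℕ} (q : Fin (n+1)) (f : (Fin m → Fin (n+1) → ℂ) → ℝ≥0∞)
    (hf : Measurable f) :
    ∫⁻ x, f x = ∫⁻ c : Fin m → ℂ, ∫⁻ D : Fin m → Fin n → ℂ,
      f (fun i => q.insertNth (α := fun _ => ℂ) (c i) (D i)) := by
  have h := volume_preserving_pi (fun _ : Fin m =>
    (volume_preserving_piFinSuccAbove (fun _ : Fin (n+1) => ℂ) q).symm)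
  have h2 := (volume_measurePreserving_arrowProdEquivProdArrow ℂ (Fin n → ℂ) (Fin m)).symm
  rw [← h.lintegral_comp hf]
  refine (h2.lintegral_comp (hf.comp h.measurable)).symm.trans ?_
  exact lintegral_prod _ ((hf.comp h.measurable).comp h2.measurable).aemeasurable

lemma lintegral_asm {m n : ℕ} (p : Fin (m+1)) (q : Fin (n+1))
    (f : (Fin (m+1) → Fin (n+1) → ℂ) → ℝ≥0∞) (hf : Measurable f) 
    (sh : ℂ → (Fin n → ℂ) → (Fin m → ℂ) → (Fin m → Fin n → ℂ)) :
    ∫⁻ x, f x = ∫⁻ a : ℂ, ∫⁻ b : Fin n → ℂ, ∫⁻ c : Fin m → ℂ, ∫⁻ S : Fin m → Fin n → ℂ,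
      f (asm p q a b c (S + sh a b c)) := by
  rw [lintegral_insertNth p f hf, lintegral_insertNth q]
  · refine lintegral_congr fun a => lintegral_congr fun b => ?_
    rw [lintegral_cols q]
    · refine lintegral_congr fun c => ?_
      rw [← lintegral_add_right_eq_self _ (sh a b c)]
      rfl
    · refine hf.comp ?_
      exact (MeasurableEquiv.piFinSuccAbove (fun _ : Fin (m+1) => Fin (n+1) → ℂ) p).symm.measurable.comp
        measurable_prodMk_left
  · refine Measurable.lintegral_prod_right' (f := fun y : (Fin (n+1) → ℂ) × (Fin m → Fin (n+1) → ℂ) => f (p.insertNth (α := fun _ => Fin (n+1) → ℂ) y.1 y.2)) (hf.comp ?_)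
    exact (MeasurableEquiv.piFinSuccAbove (fun _ : Fin (m+1) => Fin (n+1) → ℂ) p).symm.measurable

end FBL

namespace FBL
open MeasureTheory
open scoped ENNReal

noncomputable def phi : ℕ → ℕ → ℝ → ℝ
  | 0, _, _ => 0
  | _ + 1, 0, _ => 0
  | m + 1, n + 1, t => min t ((m : ℝ) + n + 1) + phi m n t

noncomputable def ff {m n : ℕ} (t lam ρ : ℝ) (H : Fin m → Fin n → ℂ) : ℝ :=
  gG ρ H ^ (-t) * Real.exp (-lam * ‖H‖ ^ 2)

lemma ff_nonneg {m n : ℕ} (t lam : ℝ) {ρ : ℝ} (hρ : 0 ≤ ρ) (H : Fin m → Fin n → ℂ) :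
    0 ≤ ff t lam ρ H := by
  have := one_le_gG hρ H
  unfold ff; positivity

lemma measurable_ff {m n : ℕ} (t lam ρ : ℝ) :
    Measurable (fun H : Fin m → Fin n → ℂ => ENNReal.ofReal (ff t lam ρ H)) := by
  have := measurable_gG (m := m) (n := n) ρ
  unfold ff
  fun_prop

noncomputable def FF (m n : ℕ) (t lam ρ : ℝ) : ℝ≥0∞ :=
  ∫⁻ H : Fin m → Fin n → ℂ, ENNReal.ofReal (ff t lam ρ H)

lemma volume_cball {n : ℕ} {r : ℝ} (hr : 0 ≤ r) :
    volume (Metric.closedBall (0 : Fin n → ℂ) r) = ENNReal.ofReal ((Real.pi * r ^ 2) ^ n) := by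
  rw [volume_pi_closedBall _ hr]
  simp only [Complex.volume_closedBall, Finset.prod_const, Finset.card_univ, Fintype.card_fin]
  rw [ENNReal.ofReal_pow (by positivity), ENNReal.ofReal_mul Real.pi_pos.le,
    ENNReal.ofReal_pow hr, mul_comm]
  congr 3
  rw [← NNReal.coe_real_pi, Real.toNNReal_coe]

lemma gauss_int {q b : ℝ} (hq : -2 < q) (hb : 0 < b) :
    ∃ I : ℝ, 0 < I ∧ ∫⁻ a : ℂ, ENNReal.ofReal (‖a‖ ^ q * Real.exp (-b * ‖a‖ ^ 2))
      = ENNReal.ofReal I := by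
  have h := Complex.integral_rpow_mul_exp_neg_mul_rpow (p := 2) one_le_two hq hb
  have hpos : 0 < (2 * Real.pi / 2) * b ^ (-(q + 2) / 2) * Real.Gamma ((q + 2) / 2) := by
    have := Real.Gamma_pos_of_pos (show 0 < (q + 2) / 2 by linarith)
    have := Real.pi_pos
    positivity
  refine ⟨_, hpos, ?_⟩
  rw [← h]
  have hi : Integrable fun x : ℂ => ‖x‖ ^ q * Real.exp (-b * ‖x‖ ^ (2:ℝ)) := by
    by_contra hc
    rw [integral_undef hc] at h
    linarith
  rw [ofReal_integral_eq_lintegral_ofReal hi (ae_of_all _ fun x => by positivity)]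
  simp

/-- the function restricted to the region where the largest entry is at `(p,q)` -/
noncomputable def ffp {m n : ℕ} (t lam ρ : ℝ) (p : Fin m) (q : Fin n) (H : Fin m → Fin n → ℂ) : ℝ≥0∞ :=
  Set.indicator {H : Fin m → Fin n → ℂ | ‖H‖ ≤ ‖H p q‖} (fun H => ENNReal.ofReal (ff t lam ρ H)) H

lemma measurable_ffp {m n : ℕ} (t lam ρ : ℝ) (p : Fin m) (q : Fin n) :
    Measurable (ffp (m := m) (n := n) t lam ρ p q) := by
  refine (measurable_ff t lam ρ).indicator ?_
  exact measurableSet_le (by fun_prop) (by fun_prop)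

lemma FF_le_sum (m n : ℕ) (t lam ρ : ℝ) :
    FF (m+1) (n+1) t lam ρ ≤ ∑ p : Fin (m+1), ∑ q : Fin (n+1), ∫⁻ H, ffp t lam ρ p q H := by
  have : ∑ p : Fin (m+1), ∑ q : Fin (n+1), ∫⁻ H, ffp t lam ρ p q H
      = ∫⁻ H, ∑ p : Fin (m+1), ∑ q : Fin (n+1), ffp t lam ρ p q H := by
    rw [lintegral_finsetSum _ (fun p _ => Finset.measurable_sum _ fun q _ => measurable_ffp t lam ρ p q)]
    refine Finset.sum_congr rfl fun p _ => ?_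
    rw [lintegral_finsetSum _ (fun q _ => measurable_ffp t lam ρ p q)]
  rw [this]
  refine lintegral_mono fun H => ?_
  obtain ⟨x, -, hx⟩ := Finset.exists_max_image (Finset.univ : Finset (Fin (m+1) × Fin (n+1)))
    (fun x => ‖H x.1 x.2‖) ⟨(0,0), Finset.mem_univ _⟩
  have hH : ‖H‖ ≤ ‖H x.1 x.2‖ := by
    refine (pi_norm_le_iff_of_nonneg (norm_nonneg _)).2 fun i =>
      (pi_norm_le_iff_of_nonneg (norm_nonneg _)).2 fun j => hx (i,j) (Finset.mem_univ _)
  have h1 : ENNReal.ofReal (ff t lam ρ H) = ffp t lam ρ x.1 x.2 H := by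
    rw [ffp, Set.indicator_of_mem]; exact hH
  beta_reduce
  rw [h1]
  refine le_trans ?_ (Finset.single_le_sum (fun _ _ => zero_le) (Finset.mem_univ x.1))
  exact Finset.single_le_sum (f := fun q => ffp t lam ρ x.1 q H) (fun _ _ => zero_le) (Finset.mem_univ x.2)

lemma ffp_asm_le {m n : ℕ} {t lam ρ : ℝ} (ht : 0 < t) (hl : 0 < lam) (hρ : 0 ≤ ρ) (p : Fin (m+1))
    (q : Fin (n+1)) (a : ℂ) (b : Fin n → ℂ) (c : Fin m → ℂ) (S : Fin m → Fin n → ℂ) :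
    ffp t lam ρ p q (asm p q a b c (S + fun i j => c i * b j / a)) ≤
      ENNReal.ofReal (KK m n ^ t * ((1 + ρ * ‖a‖ ^ 2) ^ (-t) * Real.exp (-(lam/2) * ‖a‖ ^ 2))) *
      ((Metric.closedBall (0 : Fin n → ℂ) ‖a‖).indicator 1 b *
      ((Metric.closedBall (0 : Fin m → ℂ) ‖a‖).indicator 1 c *
      ENNReal.ofReal (ff t (lam/8) ρ S))) := by
  by_cases hH : ‖asm p q a b c (S + fun i j => c i * b j / a)‖ ≤ ‖a‖
  swap
  · rw [ffp, Set.indicator_of_notMem]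
    · exact zero_le
    · simpa using hH
  have hent : ∀ i j, ‖asm p q a b c (S + fun i j => c i * b j / a) i j‖ ≤ ‖a‖ := fun i j =>
    ((norm_le_pi_norm _ j).trans (norm_le_pi_norm _ i)).trans hH
  have hb : ∀ j, ‖b j‖ ≤ ‖a‖ := fun j => by simpa using hent p (q.succAbove j)
  have hc : ∀ j, ‖c j‖ ≤ ‖a‖ := fun j => by simpa using hent (p.succAbove j) q
  have hD : ∀ i j, ‖S i j + c i * b j / a‖ ≤ ‖a‖ := fun i j => by
    simpa using hent (p.succAbove i) (q.succAbove j)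
  have hb' : b ∈ Metric.closedBall (0 : Fin n → ℂ) ‖a‖ := by
    rw [mem_closedBall_zero_iff]
    exact (pi_norm_le_iff_of_nonneg (norm_nonneg _)).2 hb
  have hc' : c ∈ Metric.closedBall (0 : Fin m → ℂ) ‖a‖ := by
    rw [mem_closedBall_zero_iff]
    exact (pi_norm_le_iff_of_nonneg (norm_nonneg _)).2 hc
  rw [Set.indicator_of_mem hb', Set.indicator_of_mem hc', Pi.one_apply, Pi.one_apply, one_mul,
    one_mul, ← ENNReal.ofReal_mul (by have := KK_pos m n; positivity), ffp, Set.indicator_of_mem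
    (by simpa using hH)]
  refine ENNReal.ofReal_le_ofReal ?_
  have hz : ∀ j, ‖b j / a‖ ≤ 1 := fun j => by
    rw [norm_div]; exact div_le_one_of_le₀ (hb j) (norm_nonneg _)
  have hw : ∀ j, ‖c j / a‖ ≤ 1 := fun j => by
    rw [norm_div]; exact div_le_one_of_le₀ (hc j) (norm_nonneg _)
  have hS : ‖S‖ ≤ 2 * ‖a‖ := by
    refine (pi_norm_le_iff_of_nonneg (by positivity)).2 fun i =>
      (pi_norm_le_iff_of_nonneg (by positivity)).2 fun j => ?_
    have h1 : ‖c i * b j / a‖ ≤ ‖a‖ := by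
      rw [mul_div_assoc, norm_mul]
      exact (mul_le_of_le_one_right (norm_nonneg _) (hz j)).trans (hc i)
    calc ‖S i j‖ = ‖(S i j + c i * b j / a) - c i * b j / a‖ := by simp
    _ ≤ _ := norm_sub_le _ _
    _ ≤ 2 * ‖a‖ := by linarith [hD i j]
  have hba : b = fun j => a * (b j / a) := by
    funext j
    by_cases ha : a = 0
    · have := hb j; rw [ha] at this ⊢; simpa using this
    · field_simp
  have hca : c = fun j => (c j / a) * a := by
    funext j
    by_cases ha : a = 0
    · have := hc j; rw [ha] at this ⊢; simpa using this
    · field_simp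
  have hSa : (S + fun i j => c i * b j / a) = fun i j => S i j + (c i / a) * a * (b j / a) := by
    funext i j
    by_cases ha : a = 0
    · simp [ha]
    · simp; field_simp
  have hpiv := (gG_pivot hρ p q a (fun j => b j / a) (fun i => c i / a) S hz hw).1
  rw [← hba, ← hca, ← hSa] at hpiv
  have haH : ‖a‖ ≤ ‖asm p q a b c (S + fun i j => c i * b j / a)‖ := by
    have := (norm_le_pi_norm (asm p q a b c (S + fun i j => c i * b j / a) p) q).trans
      (norm_le_pi_norm _ p)
    simpa using this
  set H := asm p q a b c (S + fun i j => c i * b j / a)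
  have hK := KK_pos m n
  have hgS := one_le_gG hρ S
  have hgH := one_le_gG hρ H
  have hpos : 0 < 1 + ρ * ‖a‖ ^ 2 := by positivity
  have e1 : gG ρ H ^ (-t) ≤ KK m n ^ t * ((1 + ρ * ‖a‖ ^ 2) ^ (-t) * gG ρ S ^ (-t)) := by
    have h1 : (KK m n * gG ρ H) ^ (-t) ≤ ((1 + ρ * ‖a‖ ^ 2) * gG ρ S) ^ (-t) :=
      Real.rpow_le_rpow_of_nonpos (by positivity) hpiv (by linarith)
    rw [Real.mul_rpow hK.le (by linarith), Real.mul_rpow hpos.le (by linarith),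
      Real.rpow_neg hK.le] at h1
    rwa [inv_mul_le_iff₀ (by positivity)] at h1
  have e2 : Real.exp (-lam * ‖H‖ ^ 2) ≤ Real.exp (-(lam/2) * ‖a‖ ^ 2) * Real.exp (-(lam/8) * ‖S‖ ^ 2) := by
    rw [← Real.exp_add]
    refine Real.exp_le_exp.2 ?_
    have h3 : ‖S‖ ^ 2 ≤ (2 * ‖a‖) ^ 2 := by gcongr
    have h4 : ‖a‖ ^ 2 ≤ ‖H‖ ^ 2 := by gcongr
    nlinarith
  unfold ff
  calc _ ≤ (KK m n ^ t * ((1 + ρ * ‖a‖ ^ 2) ^ (-t) * gG ρ S ^ (-t))) *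
      (Real.exp (-(lam/2) * ‖a‖ ^ 2) * Real.exp (-(lam/8) * ‖S‖ ^ 2)) := by
        gcongr
  _ = _ := by ring

lemma int_ffp_le {m n : ℕ} {t lam u : ℝ} (ht : 0 < t) (hl : 0 < lam) (hu0 : 0 ≤ u) (hut : u ≤ t)
    (hu : u < m + n + 1) :
    ∃ C : ℝ, 0 < C ∧ ∀ ρ : ℝ, 1 ≤ ρ → ∀ p : Fin (m+1), ∀ q : Fin (n+1),
      ∫⁻ H, ffp t lam ρ p q H ≤ ENNReal.ofReal (C * ρ ^ (-u)) * FF m n t (lam/8) ρ := by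
  obtain ⟨I, hI, hInt⟩ := gauss_int (q := 2 * (m + n) - 2 * u) (b := lam/2) (by linarith) (by linarith)
  have hK := KK_pos m n
  refine ⟨KK m n ^ t * Real.pi ^ (m + n) * I, by positivity, fun ρ hρ p q => ?_⟩
  have hρ0 : 0 < ρ := by linarith
  rw [lintegral_asm p q _ (measurable_ffp t lam ρ p q) (fun a b c i j => c i * b j / a)]
  calc _ ≤ ∫⁻ a : ℂ, ∫⁻ b : Fin n → ℂ, ∫⁻ c : Fin m → ℂ, ∫⁻ S : Fin m → Fin n → ℂ,
      ENNReal.ofReal (KK m n ^ t * ((1 + ρ * ‖a‖ ^ 2) ^ (-t) * Real.exp (-(lam/2) * ‖a‖ ^ 2))) *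
      ((Metric.closedBall (0 : Fin n → ℂ) ‖a‖).indicator 1 b *
      ((Metric.closedBall (0 : Fin m → ℂ) ‖a‖).indicator 1 c *
      ENNReal.ofReal (ff t (lam/8) ρ S))) := by
        gcongr with a b c S
        exact ffp_asm_le ht hl hρ0.le p q a b c S
  _ = ∫⁻ a : ℂ, ENNReal.ofReal (KK m n ^ t * ((1 + ρ * ‖a‖ ^ 2) ^ (-t) * Real.exp (-(lam/2) * ‖a‖ ^ 2))) *
      (volume (Metric.closedBall (0 : Fin n → ℂ) ‖a‖) * (volume (Metric.closedBall (0 : Fin m → ℂ) ‖a‖) *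
        FF m n t (lam/8) ρ)) := by
      refine lintegral_congr fun a => ?_
      have hmS := measurable_ff (m := m) (n := n) t (lam/8) ρ
      have hB : MeasurableSet (Metric.closedBall (0 : Fin n → ℂ) ‖a‖) := measurableSet_closedBall
      have hC : MeasurableSet (Metric.closedBall (0 : Fin m → ℂ) ‖a‖) := measurableSet_closedBall
      have hmC : Measurable ((Metric.closedBall (0 : Fin m → ℂ) ‖a‖).indicator (1 : (Fin m → ℂ) → ℝ≥0∞)) :=
        measurable_one.indicator hC
      have hmB : Measurable ((Metric.closedBall (0 : Fin n → ℂ) ‖a‖).indicator (1 : (Fin n → ℂ) → ℝ≥0∞)) :=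
        measurable_one.indicator hB
      have s1 : ∀ b c, ∫⁻ S : Fin m → Fin n → ℂ,
        ENNReal.ofReal (KK m n ^ t * ((1 + ρ * ‖a‖ ^ 2) ^ (-t) * Real.exp (-(lam/2) * ‖a‖ ^ 2))) *
        ((Metric.closedBall (0 : Fin n → ℂ) ‖a‖).indicator 1 b *
        ((Metric.closedBall (0 : Fin m → ℂ) ‖a‖).indicator 1 c *
        ENNReal.ofReal (ff t (lam/8) ρ S))) = 
        ENNReal.ofReal (KK m n ^ t * ((1 + ρ * ‖a‖ ^ 2) ^ (-t) * Real.exp (-(lam/2) * ‖a‖ ^ 2))) *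
        ((Metric.closedBall (0 : Fin n → ℂ) ‖a‖).indicator 1 b *
        ((Metric.closedBall (0 : Fin m → ℂ) ‖a‖).indicator 1 c *
        FF m n t (lam/8) ρ)) := fun b c => by
          rw [lintegral_const_mul _ (by fun_prop), lintegral_const_mul _ (by fun_prop),
            lintegral_const_mul _ (by fun_prop)]
          rfl
      simp_rw [s1]
      have s2 : ∀ b, ∫⁻ c : Fin m → ℂ, 
        ENNReal.ofReal (KK m n ^ t * ((1 + ρ * ‖a‖ ^ 2) ^ (-t) * Real.exp (-(lam/2) * ‖a‖ ^ 2))) *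
        ((Metric.closedBall (0 : Fin n → ℂ) ‖a‖).indicator 1 b *
        ((Metric.closedBall (0 : Fin m → ℂ) ‖a‖).indicator 1 c *
        FF m n t (lam/8) ρ)) = 
        ENNReal.ofReal (KK m n ^ t * ((1 + ρ * ‖a‖ ^ 2) ^ (-t) * Real.exp (-(lam/2) * ‖a‖ ^ 2))) *
        ((Metric.closedBall (0 : Fin n → ℂ) ‖a‖).indicator 1 b *
        (volume (Metric.closedBall (0 : Fin m → ℂ) ‖a‖) * 
        FF m n t (lam/8) ρ)) := fun b => by
          rw [lintegral_const_mul _ (by fun_prop), lintegral_const_mul _ (by fun_prop),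
            lintegral_mul_const _ hmC, lintegral_indicator_one hC]
      simp_rw [s2]
      rw [lintegral_const_mul _ (by fun_prop), lintegral_mul_const _ hmB, lintegral_indicator_one hB]
  _ ≤ ∫⁻ a : ℂ, ENNReal.ofReal (KK m n ^ t * Real.pi ^ (m + n) * ρ ^ (-u)) *
        (ENNReal.ofReal (‖a‖ ^ (2 * (m + n : ℝ) - 2 * u) * Real.exp (-(lam/2) * ‖a‖ ^ 2)) *
        FF m n t (lam/8) ρ) := by
      refine lintegral_mono_ae ?_
      have hae : ∀ᵐ a : ℂ, a ≠ 0 := by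
        simp [ae_iff]
      filter_upwards [hae] with a ha
      have ha' : 0 < ‖a‖ := norm_pos_iff.2 ha
      rw [volume_cball ha'.le, volume_cball ha'.le, ← mul_assoc, ← mul_assoc, ← mul_assoc,
        ← ENNReal.ofReal_mul (by positivity), ← ENNReal.ofReal_mul (by positivity),
        ← mul_assoc (ENNReal.ofReal (KK m n ^ t * Real.pi ^ (m + n) * ρ ^ (-u))),
        ← ENNReal.ofReal_mul (by positivity)]
      refine mul_le_mul_left (ENNReal.ofReal_le_ofReal ?_) _
      have hx : 0 < ρ * ‖a‖ ^ 2 := by positivity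
      have h1 : (1 + ρ * ‖a‖ ^ 2) ^ (-t) ≤ ρ ^ (-u) * ‖a‖ ^ (-2 * u) := by
        calc (1 + ρ * ‖a‖ ^ 2) ^ (-t) ≤ (1 + ρ * ‖a‖ ^ 2) ^ (-u) :=
              Real.rpow_le_rpow_of_exponent_le (by linarith) (by linarith)
        _ ≤ (ρ * ‖a‖ ^ 2) ^ (-u) := Real.rpow_le_rpow_of_nonpos hx (by linarith) (by linarith)
        _ = _ := by
          rw [Real.mul_rpow hρ0.le (by positivity), ← Real.rpow_natCast, ← Real.rpow_mul ha'.le]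
          congr 2; push_cast; ring
      have h2 : ‖a‖ ^ (2 * (m + n : ℝ) - 2 * u) = ‖a‖ ^ (-2 * u) * (‖a‖ ^ 2) ^ (m + n) := by
        rw [← pow_mul, ← Real.rpow_natCast, ← Real.rpow_add ha']
        congr 1; push_cast; ring
      rw [h2]
      calc _ = KK m n ^ t * Real.pi ^ (m + n) * Real.exp (-(lam/2) * ‖a‖ ^ 2) * (‖a‖ ^ 2) ^ (m + n)
            * (1 + ρ * ‖a‖ ^ 2) ^ (-t) := by
            rw [mul_pow, mul_pow, pow_add, pow_add]; ring
      _ ≤ KK m n ^ t * Real.pi ^ (m + n) * Real.exp (-(lam/2) * ‖a‖ ^ 2) * (‖a‖ ^ 2) ^ (m + n)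
            * (ρ ^ (-u) * ‖a‖ ^ (-2 * u)) := by gcongr
      _ = _ := by ring
  _ = _ := by
      have hm : Measurable fun a : ℂ => ENNReal.ofReal (‖a‖ ^ (2 * (m + n : ℝ) - 2 * u) *
        Real.exp (-(lam/2) * ‖a‖ ^ 2)) := by fun_prop
      rw [lintegral_const_mul _ (by fun_prop), lintegral_mul_const _ hm, hInt, ← mul_assoc,
        ← ENNReal.ofReal_mul (by positivity)]
      congr 2; ring

lemma vol_univ_zero (n : ℕ) : volume (Set.univ : Set (Fin 0 → Fin n → ℂ)) = 1 := by
  simp [volume_pi]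
lemma vol_univ_zero' (m : ℕ) : volume (Set.univ : Set (Fin m → Fin 0 → ℂ)) = 1 := by
  rw [volume_pi, Measure.pi_univ]
  simp [volume_pi]

lemma ff_le_one {m n : ℕ} {t lam ρ : ℝ} (ht : 0 < t) (hl : 0 < lam) (hρ : 0 ≤ ρ)
    (H : Fin m → Fin n → ℂ) : ff t lam ρ H ≤ 1 := by
  have h1 : gG ρ H ^ (-t) ≤ 1 := Real.rpow_le_one_of_one_le_of_nonpos (one_le_gG hρ H) (by linarith)
  have h2 : Real.exp (-lam * ‖H‖ ^ 2) ≤ 1 := Real.exp_le_one_iff.2 (by nlinarith [sq_nonneg ‖H‖])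
  exact mul_le_one₀ h1 (Real.exp_pos _).le h2

lemma FF_bound_triv {m n : ℕ} (hv : volume (Set.univ : Set (Fin m → Fin n → ℂ)) = 1) {t lam ρ : ℝ}
    (ht : 0 < t) (hl : 0 < lam) (hρ : 0 ≤ ρ) : FF m n t lam ρ ≤ 1 := by
  calc FF m n t lam ρ ≤ ∫⁻ _ : Fin m → Fin n → ℂ, 1 := by
        refine lintegral_mono fun H => ?_
        exact ENNReal.ofReal_le_one.2 (ff_le_one ht hl hρ H)
  _ = 1 := by simp [hv]

theorem FF_bound : ∀ (m n : ℕ) (t lam ε : ℝ), 0 < t → 0 < lam → 0 < ε →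
    ∃ C : ℝ, 0 < C ∧ ∀ ρ : ℝ, 1 ≤ ρ → FF m n t lam ρ ≤ ENNReal.ofReal (C * ρ ^ (-phi m n t + ε)) := by
  intro m
  induction m with
  | zero =>
    intro n t lam ε ht hl hε
    refine ⟨1, one_pos, fun ρ hρ => (FF_bound_triv (vol_univ_zero n) ht hl (by linarith)).trans ?_⟩
    rw [ENNReal.one_le_ofReal, phi, one_mul]
    exact Real.one_le_rpow hρ (by linarith)
  | succ m ih =>
    intro n t lam ε ht hl hε
    cases n with
    | zero =>
      refine ⟨1, one_pos, fun ρ hρ => (FF_bound_triv (vol_univ_zero' _) ht hl (by linarith)).trans ?_⟩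
      rw [ENNReal.one_le_ofReal, phi, one_mul]
      exact Real.one_le_rpow hρ (by linarith)
    | succ n =>
      obtain ⟨C, hC, h⟩ := ih n t (lam/8) (ε/2) ht (by linarith) (by linarith)
      set Q := min t ((m : ℝ) + n + 1) with hQ
      have hQ0 : 0 < Q := lt_min ht (by positivity)
      set δ := min (ε/2) Q with hδ
      have hδ0 : 0 < δ := lt_min (by linarith) hQ0
      obtain ⟨C1, hC1, h1⟩ := int_ffp_le (m := m) (n := n) (u := Q - δ) ht hl
        (by linarith [min_le_right (ε/2) Q]) (by linarith [min_le_left t ((m : ℝ) + n + 1)])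
        (by linarith [min_le_right t ((m : ℝ) + n + 1)])
      refine ⟨(m + 1) * ((n + 1) * (C1 * C)), by positivity, fun ρ hρ => ?_⟩
      have hρ0 : 0 < ρ := by linarith
      refine (FF_le_sum m n t lam ρ).trans ?_
      calc _ ≤ ∑ p : Fin (m+1), ∑ q : Fin (n+1), ENNReal.ofReal (C1 * C * ρ ^ (-phi (m+1) (n+1) t + ε)) := by
            refine Finset.sum_le_sum fun p _ => Finset.sum_le_sum fun q _ => ?_
            refine (h1 ρ hρ p q).trans ?_
            refine (mul_le_mul_right (h ρ hρ) _).trans ?_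
            rw [← ENNReal.ofReal_mul (by positivity)]
            refine ENNReal.ofReal_le_ofReal ?_
            calc C1 * ρ ^ (-(Q - δ)) * (C * ρ ^ (-phi m n t + ε / 2))
                = C1 * C * (ρ ^ (-(Q - δ)) * ρ ^ (-phi m n t + ε / 2)) := by ring
            _ = C1 * C * ρ ^ (-(Q - δ) + (-phi m n t + ε / 2)) := by rw [← Real.rpow_add hρ0]
            _ ≤ _ := by
              have hphi : phi (m+1) (n+1) t = Q + phi m n t := rfl
              exact mul_le_mul_of_nonneg_left (Real.rpow_le_rpow_of_exponent_le hρ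
                (by rw [hphi]; linarith [min_le_left (ε/2) Q])) (by positivity)
      _ = _ := by
        simp only [Finset.sum_const, Finset.card_univ, Fintype.card_fin, nsmul_eq_mul]
        rw [← ENNReal.ofReal_natCast, ← ENNReal.ofReal_natCast, ← ENNReal.ofReal_mul (by positivity),
          ← ENNReal.ofReal_mul (by positivity)]
        congr 1; push_cast; ring

end FBL

namespace FBL

noncomputable def dd : ℕ → ℕ → ℝ → ℝ
  | 0, _, _ => 0
  | _ + 1, 0, _ => 0
  | m + 1, n + 1, s => (1 - max 0 (min s 1)) * ((m : ℝ) + n + 1) + dd m n (s - 1)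

lemma dd_zero (n : ℕ) (s : ℝ) : dd 0 n s = 0 := by simp [dd]
lemma dd_zero_right (m : ℕ) (s : ℝ) : dd m 0 s = 0 := by cases m <;> simp [dd]
lemma dd_succ (m n : ℕ) (s : ℝ) : dd (m+1) (n+1) s =
    (1 - max 0 (min s 1)) * ((m : ℝ) + n + 1) + dd m n (s - 1) := rfl

lemma continuous_dd : ∀ m n : ℕ, Continuous (dd m n) := by
  intro m
  induction m with
  | zero => intro n; simp only [funext (dd_zero n)]; exact continuous_const
  | succ m ih =>
    intro n
    cases n with
    | zero => simp only [funext (dd_zero_right (m+1))]; exact continuous_const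
    | succ n =>
      have := ih n
      simp only [funext (dd_succ m n)]
      fun_prop

lemma dd_nonpos : ∀ (m n : ℕ) (s : ℝ), s ≤ 0 → dd m n s = m * n := by
  intro m
  induction m with
  | zero => intro n s _; simp [dd_zero]
  | succ m ih =>
    intro n s hs
    cases n with
    | zero => simp [dd_zero_right]
    | succ n =>
      rw [dd_succ, ih n (s-1) (by linarith), min_eq_left (by linarith), max_eq_left hs]
      push_cast; ring

lemma dmt_eq : ∀ (m n : ℕ) (s : ℝ), 0 ≤ s → dmt m n s = dd m n s := by
  intro m
  induction m with
  | zero => intro n s hs; simp [dd_zero, dmt, hs]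
  | succ m ih =>
    intro n s hs
    cases n with
    | zero => simp [dd_zero_right, dmt, hs]
    | succ n =>
      rw [dd_succ]
      rcases lt_or_ge s 1 with h | h
      · rw [dd_nonpos m n (s-1) (by linarith), min_eq_left h.le, max_eq_right hs]
        have h0 : ⌊s⌋₊ = 0 := Nat.floor_eq_zero.2 h
        have hn : ¬ (((min (m+1) (n+1) : ℕ)) : ℝ) ≤ s := by
          push_cast
          rw [not_le]
          refine lt_min ?_ ?_
          · have : (0:ℝ) ≤ m := by positivity
            linarith
          · have : (0:ℝ) ≤ n := by positivity
            linarith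
        rw [dmt, if_neg hn, h0]
        simp only [dmtPt]
        push_cast; ring
      · rw [min_eq_right h, max_eq_right zero_le_one, ← ih n (s-1) (by linarith)]
        have hf : ⌊s⌋₊ = ⌊s - 1⌋₊ + 1 := by
          rw [← Nat.floor_add_one (by linarith)]; simp
        have hc : ((((min (m+1) (n+1) : ℕ)) : ℝ) ≤ s) ↔ (((min m n : ℕ)) : ℝ) ≤ s - 1 := by
          have : min (m+1) (n+1) = min m n + 1 := by omega
          rw [this]; push_cast
          constructor <;> intro h <;> linarith
        unfold dmt
        rw [hf]
        by_cases h2 : (((min m n : ℕ)) : ℝ) ≤ s - 1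
        · rw [if_pos h2, if_pos (hc.2 h2)]; ring
        · rw [if_neg h2, if_neg (fun h => h2 (hc.1 h))]
          simp only [dmtPt]
          push_cast; ring

lemma phi_zero (n : ℕ) (s : ℝ) : phi 0 n s = 0 := by simp [phi]
lemma phi_zero_right (m : ℕ) (s : ℝ) : phi m 0 s = 0 := by cases m <;> simp [phi]
lemma phi_succ (m n : ℕ) (t : ℝ) : phi (m+1) (n+1) t =
    min t ((m : ℝ) + n + 1) + phi m n t := rfl

lemma phi_large : ∀ (m n : ℕ) (t : ℝ), (m : ℝ) + n - 1 ≤ t → phi m n t = m * n := by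
  intro m
  induction m with
  | zero => intro n s _; simp [phi_zero]
  | succ m ih =>
    intro n s hs
    cases n with
    | zero => simp [phi_zero_right]
    | succ n =>
      push_cast at hs
      rw [phi_succ, ih n s (by linarith), min_eq_right (by linarith)]
      push_cast; ring

lemma legendre : ∀ (m n : ℕ) (s : ℝ), 0 ≤ s → s < m → s < n →
    ∃ t : ℝ, 0 < t ∧ t ≤ (m : ℝ) + n - 1 ∧ dd m n s ≤ phi m n t - s * t := by
  intro m
  induction m with
  | zero => intro n s h0 h1; simp at h1; linarith
  | succ m ih =>
    intro n s h0 h1 h2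
    cases n with
    | zero => simp at h2; linarith
    | succ n =>
      push_cast at h1 h2 ⊢
      rcases lt_or_ge s 1 with h | h
      · refine ⟨m + n + 1, by positivity, by linarith, ?_⟩
        rw [dd_succ, dd_nonpos m n (s-1) (by linarith), min_eq_left h.le, max_eq_right h0,
          phi_succ, min_self, phi_large m n _ (by linarith)]
        linarith
      · obtain ⟨t, ht, ht2, h3⟩ := ih n (s-1) (by linarith) (by linarith) (by linarith)
        refine ⟨t, ht, by linarith, ?_⟩
        rw [dd_succ, min_eq_right h, max_eq_right zero_le_one, phi_succ, min_eq_left (by linarith)]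
        linarith

lemma dmt_symm (m n : ℕ) (s : ℝ) : dmt m n s = dmt n m s := by
  simp only [dmt, dmtPt, min_comm m n]
  split_ifs
  · rfl
  · ring

lemma dmt_ge {m n : ℕ} {s : ℝ} (h : ¬ (s < m ∧ s < n)) : dmt m n s = 0 := by
  rw [dmt, if_pos]
  push_cast
  by_contra hc
  rw [not_le] at hc
  exact h (lt_min_iff.1 hc)

end FBL

namespace FBL
open MeasureTheory
open scoped ENNReal

/-- norm-bounded matrices with small determinant -/
def lowSet (m n : ℕ) (R ρ B : ℝ) : Set (Fin m → Fin n → ℂ) := {H | ‖H‖ ≤ R ∧ gG ρ H ≤ B}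

lemma measurableSet_lowSet (m n : ℕ) (R ρ B : ℝ) : MeasurableSet (lowSet m n R ρ B) := by
  refine (measurableSet_le (f := fun H : Fin m → Fin n → ℂ => ‖H‖) measurable_norm measurable_const).inter
    (measurableSet_le (measurable_gG ρ) measurable_const)

lemma asm_mem_lowSet {m n : ℕ} {R ρ η B : ℝ} (hρ : 0 ≤ ρ) (hη : 0 < η) (hηR : η ≤ R / 2)
    {a : ℂ} (ha : a ∈ Metric.closedBall (((3 / 4 * η : ℝ)) : ℂ) (η / 4)) {b : Fin n → ℂ}
    (hb : b ∈ Metric.closedBall (0 : Fin n → ℂ) (η / 2)) {c : Fin m → ℂ}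
    (hc : c ∈ Metric.closedBall (0 : Fin m → ℂ) (η / 2)) {S : Fin m → Fin n → ℂ}
    (hS : S ∈ lowSet m n (R / 2) ρ B) :
    asm 0 0 a b c (S + fun i j => c i * b j / a) ∈
      lowSet (m+1) (n+1) R ρ (KK m n * ((1 + ρ * η ^ 2) * B)) := by
  rw [mem_closedBall_zero_iff] at hb hc
  rw [mem_closedBall_iff_norm] at ha
  have hn : ‖((3 / 4 * η : ℝ) : ℂ)‖ = 3 / 4 * η := by
    rw [Complex.norm_real, Real.norm_of_nonneg (by positivity)]
  have ha1 : ‖a‖ ≤ η := by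
    have := norm_add_le (a - ((3 / 4 * η : ℝ) : ℂ)) ((3 / 4 * η : ℝ) : ℂ)
    rw [sub_add_cancel, hn] at this
    linarith
  have ha2 : η / 2 ≤ ‖a‖ := by
    have := norm_sub_norm_le ((3 / 4 * η : ℝ) : ℂ) a
    rw [norm_sub_rev, hn] at this
    linarith
  have ha0 : a ≠ 0 := norm_pos_iff.1 (by linarith)
  have hbj : ∀ j, ‖b j‖ ≤ η / 2 := fun j => (norm_le_pi_norm b j).trans hb
  have hcj : ∀ j, ‖c j‖ ≤ η / 2 := fun j => (norm_le_pi_norm c j).trans hc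
  have hz : ∀ j, ‖b j / a‖ ≤ 1 := fun j => by
    rw [norm_div]; exact div_le_one_of_le₀ ((hbj j).trans ha2) (norm_nonneg _)
  have hw : ∀ j, ‖c j / a‖ ≤ 1 := fun j => by
    rw [norm_div]; exact div_le_one_of_le₀ ((hcj j).trans ha2) (norm_nonneg _)
  have hba : b = fun j => a * (b j / a) := by
    funext j; field_simp
  have hca : c = fun j => (c j / a) * a := by
    funext j; field_simp
  have hSa : (S + fun i j => c i * b j / a) = fun i j => S i j + (c i / a) * a * (b j / a) := by
    funext i j; simp; field_simp
  have hpiv := (gG_pivot hρ 0 0 a (fun j => b j / a) (fun i => c i / a) S hz hw).2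
  rw [← hba, ← hca, ← hSa] at hpiv
  have hK := KK_pos m n
  have hgS := one_le_gG hρ S
  have hR : 0 ≤ R := by linarith
  refine ⟨?_, hpiv.trans ?_⟩
  · refine (pi_norm_le_iff_of_nonneg hR).2 fun i => (pi_norm_le_iff_of_nonneg hR).2 fun j => ?_
    refine Fin.cases ?_ (fun i => ?_) i <;> refine Fin.cases ?_ (fun j => ?_) j
    · rw [asm_pq]; linarith
    · have := asm_pj 0 0 a b c (S + fun i j => c i * b j / a) j
      rw [Fin.succAbove_zero] at this
      rw [this]; linarith [hbj j]
    · have := asm_iq 0 0 a b c (S + fun i j => c i * b j / a) i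
      rw [Fin.succAbove_zero] at this
      rw [this]; linarith [hcj i]
    · have := asm_ij 0 0 a b c (S + fun i j => c i * b j / a) i j
      rw [Fin.succAbove_zero, Fin.succAbove_zero] at this
      rw [this]
      have h1 : ‖c i * b j / a‖ ≤ η / 2 := by
        rw [mul_div_assoc, norm_mul]
        exact (mul_le_of_le_one_right (norm_nonneg _) (hz j)).trans (hcj i)
      have h2 : ‖S i j‖ ≤ R / 2 := ((norm_le_pi_norm _ j).trans (norm_le_pi_norm _ i)).trans hS.1
      exact (norm_add_le _ _).trans (by linarith)
  · have hB : gG ρ S ≤ B := hS.2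
    gcongr

lemma vol_step {m n : ℕ} {R ρ η B : ℝ} (hρ : 0 ≤ ρ) (hη : 0 < η) (hηR : η ≤ R / 2) :
    ENNReal.ofReal (Real.pi * (η / 4) ^ 2 * ((Real.pi * (η / 2) ^ 2) ^ n * (Real.pi * (η / 2) ^ 2) ^ m)) *
      volume (lowSet m n (R / 2) ρ B) ≤
      volume (lowSet (m+1) (n+1) R ρ (KK m n * ((1 + ρ * η ^ 2) * B))) := by
  rw [← lintegral_indicator_one (measurableSet_lowSet (m+1) (n+1) R ρ _),
    lintegral_asm 0 0 _ (measurable_one.indicator (measurableSet_lowSet (m+1) (n+1) R ρ _))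
      (fun a b c i j => c i * b j / a)]
  set T := lowSet m n (R / 2) ρ B with hT
  have hTm : MeasurableSet T := measurableSet_lowSet _ _ _ _ _
  set A := Metric.closedBall (((3 / 4 * η : ℝ)) : ℂ) (η / 4)
  set U := Metric.closedBall (0 : Fin n → ℂ) (η / 2)
  set V := Metric.closedBall (0 : Fin m → ℂ) (η / 2)
  have hA : MeasurableSet A := measurableSet_closedBall
  have hU : MeasurableSet U := measurableSet_closedBall
  have hV : MeasurableSet V := measurableSet_closedBall
  calc _ = volume A * (volume U * (volume V * volume T)) := by
        rw [volume_cball (by positivity), volume_cball (by positivity), Complex.volume_closedBall]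
        have hpi : (NNReal.pi : ℝ≥0∞) = ENNReal.ofReal Real.pi := by
          rw [← NNReal.coe_real_pi, ENNReal.ofReal_coe_nnreal]
        rw [hpi, ← ENNReal.ofReal_pow (by positivity), ← ENNReal.ofReal_mul (by positivity),
          ← mul_assoc (ENNReal.ofReal _) (ENNReal.ofReal _) (volume T),
          ← mul_assoc (ENNReal.ofReal _) _ (volume T),
          ← ENNReal.ofReal_mul (by positivity),
          ← ENNReal.ofReal_mul (by positivity)]
        congr 2; ring
  _ = ∫⁻ a : ℂ, ∫⁻ b : Fin n → ℂ, ∫⁻ c : Fin m → ℂ, ∫⁻ S : Fin m → Fin n → ℂ,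
      A.indicator 1 a * (U.indicator 1 b * (V.indicator 1 c * T.indicator 1 S)) := by
        have mA : Measurable (A.indicator (1 : ℂ → ℝ≥0∞)) := measurable_one.indicator hA
        have mU : Measurable (U.indicator (1 : (Fin n → ℂ) → ℝ≥0∞)) := measurable_one.indicator hU
        have mV : Measurable (V.indicator (1 : (Fin m → ℂ) → ℝ≥0∞)) := measurable_one.indicator hV
        have mT : Measurable (T.indicator (1 : (Fin m → Fin n → ℂ) → ℝ≥0∞)) := measurable_one.indicator hTm
        have s1 : ∀ a b c, ∫⁻ S : Fin m → Fin n → ℂ,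
            A.indicator 1 a * (U.indicator 1 b * (V.indicator 1 c * T.indicator 1 S)) =
            A.indicator 1 a * (U.indicator 1 b * (V.indicator 1 c * volume T)) := fun a b c => by
          rw [lintegral_const_mul _ (by fun_prop), lintegral_const_mul _ (by fun_prop),
            lintegral_const_mul _ mT, lintegral_indicator_one hTm]
        have s2 : ∀ a b, ∫⁻ c : Fin m → ℂ,
            A.indicator 1 a * (U.indicator 1 b * (V.indicator 1 c * volume T)) =
            A.indicator 1 a * (U.indicator 1 b * (volume V * volume T)) := fun a b => by
          rw [lintegral_const_mul _ (by fun_prop), lintegral_const_mul _ (by fun_prop),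
            lintegral_mul_const _ mV, lintegral_indicator_one hV]
        have s3 : ∀ a, ∫⁻ b : Fin n → ℂ,
            A.indicator 1 a * (U.indicator 1 b * (volume V * volume T)) =
            A.indicator 1 a * (volume U * (volume V * volume T)) := fun a => by
          rw [lintegral_const_mul _ (by fun_prop), 
            lintegral_mul_const _ mU, lintegral_indicator_one hU]
        simp_rw [s1, s2, s3]
        rw [lintegral_mul_const _ mA, lintegral_indicator_one hA]
  _ ≤ _ := by
    refine lintegral_mono fun a => lintegral_mono fun b => lintegral_mono fun c =>
      lintegral_mono fun S => ?_
    by_cases ha : a ∈ A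
    swap
    · simp [ha]
    by_cases hb : b ∈ U
    swap
    · simp [hb]
    by_cases hc : c ∈ V
    swap
    · simp [hc]
    by_cases hS : S ∈ T
    swap
    · simp [hS]
    have := asm_mem_lowSet hρ hη hηR ha hb hc hS
    simp [ha, hb, hc, hS, this]

lemma gG_empty_left {n : ℕ} (ρ : ℝ) (H : Fin 0 → Fin n → ℂ) : gG ρ H = 1 := by
  simp [gG, dG]

lemma gG_empty_right {m : ℕ} (ρ : ℝ) (H : Fin m → Fin 0 → ℂ) : gG ρ H = 1 := by
  have : (Matrix.of H) * (Matrix.of H).conjTranspose = 0 := by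
    ext i j; simp [Matrix.mul_apply]
  simp [gG, dG, this]

theorem low_bound : ∀ (m n : ℕ) (R s : ℝ), 0 < R →
    ∃ c C : ℝ, 0 < c ∧ 0 < C ∧ ∀ ρ : ℝ, 1 ≤ ρ →
      ENNReal.ofReal (c * ρ ^ (-dd m n s)) ≤ volume (lowSet m n R ρ (C * ρ ^ (max s 0))) := by
  intro m
  induction m with
  | zero =>
    intro n R s hR
    refine ⟨1, 1, one_pos, one_pos, fun ρ hρ => ?_⟩
    have : lowSet 0 n R ρ (1 * ρ ^ (max s 0)) = Set.univ := by
      ext H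
      simp only [lowSet, Set.mem_ofPred_eq, Set.mem_univ, iff_true, gG_empty_left, one_mul]
      refine ⟨?_, Real.one_le_rpow hρ (le_max_right _ _)⟩
      rw [Subsingleton.elim H 0, norm_zero]; exact hR.le
    rw [this, vol_univ_zero, dd_zero]; simp
  | succ m ih =>
    intro n R s hR
    cases n with
    | zero =>
      refine ⟨1, 1, one_pos, one_pos, fun ρ hρ => ?_⟩
      have : lowSet (m+1) 0 R ρ (1 * ρ ^ (max s 0)) = Set.univ := by
        ext H
        simp only [lowSet, Set.mem_ofPred_eq, Set.mem_univ, iff_true, gG_empty_right, one_mul]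
        refine ⟨?_, Real.one_le_rpow hρ (le_max_right _ _)⟩
        rw [Subsingleton.elim H 0, norm_zero]; exact hR.le
      rw [this, vol_univ_zero', dd_zero_right]; simp
    | succ n =>
      obtain ⟨c, C, hc, hC, h⟩ := ih n (R/2) (s-1) (by linarith)
      have hK := KK_pos m n
      refine ⟨(Real.pi * (R / 8) ^ 2 * ((Real.pi * (R / 4) ^ 2) ^ n * (Real.pi * (R / 4) ^ 2) ^ m)) * c,
        KK m n * ((1 + (R / 2) ^ 2) * C), by positivity, by positivity, fun ρ hρ => ?_⟩
      have hρ0 : 0 < ρ := by linarith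
      set σ := max 0 (min s 1) with hσ
      have hσ0 : 0 ≤ σ := le_max_left _ _
      have hσ1 : σ ≤ 1 := max_le zero_le_one (min_le_right _ _)
      have hσs : σ + max (s - 1) 0 = max s 0 := by
        rcases le_total s 0 with h0 | h0
        · rw [hσ, min_eq_left (by linarith), max_eq_left h0, max_eq_right h0, max_eq_right (by linarith)]
          ring
        · rcases le_total s 1 with h1 | h1
          · rw [hσ, min_eq_left h1, max_eq_right h0, max_eq_left h0, max_eq_right (by linarith)]; ring
          · rw [hσ, min_eq_right h1, max_eq_right zero_le_one, max_eq_left h0, max_eq_left (by linarith)]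
            ring
      set x := ρ ^ (-(1 - σ) / 2) with hx
      have hx0 : 0 < x := Real.rpow_pos_of_pos hρ0 _
      have hx1 : x ≤ 1 := Real.rpow_le_one_of_one_le_of_nonpos hρ (by linarith)
      have hx2 : x ^ 2 = ρ ^ (-(1 - σ)) := by
        rw [hx, ← Real.rpow_natCast, ← Real.rpow_mul hρ0.le]; congr 1; push_cast; ring
      have hρx : ρ * x ^ 2 = ρ ^ σ := by
        rw [hx2]; nth_rewrite 1 [← Real.rpow_one ρ]; rw [← Real.rpow_add hρ0]; congr 1; ring
      have hstep := vol_step (m := m) (n := n) (R := R) (ρ := ρ) (η := R / 2 * x)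
        (B := C * ρ ^ (max (s - 1) 0)) hρ0.le (by positivity) (by nlinarith)
      refine le_trans ?_ (hstep.trans (measure_mono ?_))
      · refine le_trans ?_ (mul_le_mul_right (h ρ hρ) _)
        rw [← ENNReal.ofReal_mul (by positivity)]
        refine ENNReal.ofReal_le_ofReal (le_of_eq ?_)
        have e1 : ρ ^ (-dd (m+1) (n+1) s) = (x ^ 2) ^ (m + n + 1) * ρ ^ (-dd m n (s-1)) := by
          rw [hx2, ← Real.rpow_natCast, ← Real.rpow_mul hρ0.le, ← Real.rpow_add hρ0, dd_succ]
          congr 1; push_cast; ring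
        rw [e1]
        rw [show R / 2 * x / 4 = R / 8 * x by ring, show R / 2 * x / 2 = R / 4 * x by ring]
        generalize R / 8 = y
        generalize R / 4 = z
        simp only [mul_pow, pow_add, pow_one]
        ring
      · rintro H ⟨h1, h2⟩
        refine ⟨h1, h2.trans ?_⟩
        have h3 : 1 + ρ * (R / 2 * x) ^ 2 ≤ (1 + (R / 2) ^ 2) * ρ ^ σ := by
          have := Real.one_le_rpow hρ hσ0
          calc 1 + ρ * (R / 2 * x) ^ 2 = 1 + (R / 2) ^ 2 * (ρ * x ^ 2) := by ring
          _ ≤ _ := by rw [hρx]; linarith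
        rw [← hσs, Real.rpow_add hρ0]
        calc _ ≤ KK m n * (((1 + (R / 2) ^ 2) * ρ ^ σ) * (C * ρ ^ max (s - 1) 0)) := by gcongr
        _ = _ := by ring

end FBL

namespace FBL
open MeasureTheory ProbabilityTheory
open scoped ENNReal NNReal

lemma lintegral_fin_prod {E : Type*} [MeasurableSpace E] (μ : Measure E) [SigmaFinite μ] :
    ∀ (n : ℕ) (f : Fin n → E → ℝ≥0∞), (∀ i, Measurable (f i)) →
    ∫⁻ x, ∏ i, f i (x i) ∂(Measure.pi fun _ : Fin n => μ) = ∏ i, ∫⁻ x, f i x ∂μ := by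
  intro n
  induction n with
  | zero => intro f hf; simp
  | succ n ih =>
    intro f hf
    have hmp := (measurePreserving_piFinSuccAbove (fun _ : Fin (n+1) => μ) 0).symm
    rw [← hmp.lintegral_comp (by fun_prop), Fin.prod_univ_succ, ← ih _ (fun i => hf i.succ)]
    rw [← lintegral_prod_mul (hf 0).aemeasurable (Measurable.aemeasurable
      (Finset.measurable_prod _ fun i _ => (hf i.succ).comp (measurable_pi_apply i)))]
    refine lintegral_congr fun x => ?_
    rw [Fin.prod_univ_succ]
    rfl

lemma pi_withDensity {E : Type*} [MeasurableSpace E] (μ : Measure E) [SigmaFinite μ] (n : ℕ)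
    (f : E → ℝ≥0∞) (hf : Measurable f) [SigmaFinite (μ.withDensity f)] :
    Measure.pi (fun _ : Fin n => μ.withDensity f) =
      (Measure.pi fun _ : Fin n => μ).withDensity (fun x => ∏ i, f (x i)) := by
  refine Measure.pi_eq fun s hs => ?_
  rw [withDensity_apply _ (MeasurableSet.univ_pi hs), ← lintegral_indicator (MeasurableSet.univ_pi hs)]
  have h : ∀ i, μ.withDensity f (s i) = ∫⁻ x, (s i).indicator f x ∂μ := fun i => by
    rw [withDensity_apply _ (hs i), lintegral_indicator (hs i)]
  simp_rw [h]
  rw [← lintegral_fin_prod μ n (fun i => (s i).indicator f) (fun i => hf.indicator (hs i))]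
  refine lintegral_congr fun x => ?_
  by_cases hx : x ∈ Set.univ.pi s
  · rw [Set.indicator_of_mem hx]
    exact Finset.prod_congr rfl fun i _ => (Set.indicator_of_mem (hx i (Set.mem_univ _)) _).symm
  · rw [Set.indicator_of_notMem hx]
    simp only [Set.mem_univ_pi, not_forall] at hx
    obtain ⟨i, hi⟩ := hx
    exact (Finset.prod_eq_zero (Finset.mem_univ i) (Set.indicator_of_notMem hi _)).symm

noncomputable def gam : Measure ℂ :=
  ((gaussianReal 0 (1/2)).prod (gaussianReal 0 (1/2))).map Complex.measurableEquivRealProd.symm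

noncomputable def gden (z : ℂ) : ℝ≥0∞ := ENNReal.ofReal (Real.pi⁻¹ * Real.exp (-‖z‖ ^ 2))

lemma measurable_gden : Measurable gden := by unfold gden; fun_prop

instance : IsProbabilityMeasure gam := by
  unfold gam
  exact Measure.isProbabilityMeasure_map (by fun_prop)

lemma gam_eq : gam = volume.withDensity gden := by
  have h2 : (1/2 : ℝ≥0) ≠ 0 := by norm_num
  have hmp := Complex.volume_preserving_equiv_real_prod
  unfold gam
  rw [gaussianReal_of_var_ne_zero _ h2, prod_withDensity (measurable_gaussianPDF _ _) (measurable_gaussianPDF _ _)]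
  ext s hs
  rw [MeasurableEquiv.map_apply, withDensity_apply _ (by measurability), withDensity_apply _ hs]
  rw [← Measure.volume_eq_prod, ← hmp.setLIntegral_comp_preimage_emb (MeasurableEquiv.measurableEmbedding _)]
  have : Complex.measurableEquivRealProd ⁻¹' (Complex.measurableEquivRealProd.symm ⁻¹' s) = s := by
    ext x; simp
  rw [this]
  refine lintegral_congr fun z => ?_
  simp only [Complex.measurableEquivRealProd_apply, gaussianPDF, gaussianPDFReal, gden]
  rw [← ENNReal.ofReal_mul (by positivity)]
  congr 1
  have e1 : ((√(2 * Real.pi * ((1/2 : ℝ≥0) : ℝ)))⁻¹ : ℝ) * (√(2 * Real.pi * ((1/2 : ℝ≥0) : ℝ)))⁻¹ = Real.pi⁻¹ := by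
    rw [← mul_inv, Real.mul_self_sqrt (by positivity)]
    congr 1
    push_cast; ring
  rw [mul_mul_mul_comm, e1, ← Real.exp_add, ← Complex.normSq_eq_norm_sq, Complex.normSq_apply]
  congr 2
  push_cast; ring

instance : IsProbabilityMeasure (volume.withDensity gden) := by rw [← gam_eq]; infer_instance

noncomputable def Gam (m n : ℕ) : Measure (Fin m → Fin n → ℂ) := Measure.pi fun _ => Measure.pi fun _ => gam

instance (m n : ℕ) : IsProbabilityMeasure (Gam m n) := by unfold Gam; infer_instance

lemma Gam_eq (m n : ℕ) : Gam m n = volume.withDensity (fun H => ∏ i, ∏ j, gden (H i j)) := by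
  unfold Gam
  have hm := measurable_gden
  have h1 := pi_withDensity (volume : Measure ℂ) n gden hm
  have : SigmaFinite ((volume : Measure (Fin n → ℂ)).withDensity (fun x => ∏ i, gden (x i))) := by
    rw [volume_pi, ← h1]; infer_instance
  rw [gam_eq, h1, ← volume_pi]
  rw [pi_withDensity (volume : Measure (Fin n → ℂ)) m (fun x => ∏ i, gden (x i)) (by fun_prop), ← volume_pi]

lemma prod_gden_le {m n : ℕ} (H : Fin m → Fin n → ℂ) :
    ∏ i, ∏ j, gden (H i j) ≤ ENNReal.ofReal (Real.exp (-1 * ‖H‖ ^ 2)) := by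
  have h1 : ∀ z, gden z ≤ ENNReal.ofReal (Real.exp (-‖z‖ ^ 2)) := fun z => by
    refine ENNReal.ofReal_le_ofReal (mul_le_of_le_one_left (Real.exp_pos _).le ?_)
    exact inv_le_one_of_one_le₀ (by linarith [Real.pi_gt_three])
  calc _ ≤ ∏ i, ∏ j, ENNReal.ofReal (Real.exp (-‖H i j‖ ^ 2)) :=
        Finset.prod_le_prod' fun i _ => Finset.prod_le_prod' fun j _ => h1 _
  _ = ENNReal.ofReal (Real.exp (-∑ i, ∑ j, ‖H i j‖ ^ 2)) := by
    simp_rw [← Finset.sum_neg_distrib, Real.exp_sum]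
    rw [ENNReal.ofReal_prod_of_nonneg (fun i _ => by positivity)]
    refine Finset.prod_congr rfl fun i _ => ?_
    rw [ENNReal.ofReal_prod_of_nonneg (fun i _ => by positivity)]
  _ ≤ _ := by
    refine ENNReal.ofReal_le_ofReal (Real.exp_le_exp.2 ?_)
    have : ‖H‖ ≤ √(∑ i, ∑ j, ‖H i j‖ ^ 2) := by
      refine (pi_norm_le_iff_of_nonneg (by positivity)).2 fun i =>
        (pi_norm_le_iff_of_nonneg (by positivity)).2 fun j => Real.le_sqrt_of_sq_le ?_
      refine le_trans ?_ (Finset.single_le_sum (f := fun i => ∑ j, ‖H i j‖ ^ 2)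
        (fun i _ => by positivity) (Finset.mem_univ i))
      exact (Finset.single_le_sum (f := fun j => ‖H i j‖ ^ 2)
        (fun i _ => by positivity) (Finset.mem_univ j))
    have h2 : ‖H‖ ^ 2 ≤ ∑ i, ∑ j, ‖H i j‖ ^ 2 := by
      rw [← Real.sq_sqrt (show 0 ≤ ∑ i, ∑ j, ‖H i j‖ ^ 2 by positivity)]
      gcongr
    linarith

lemma le_prod_gden {m n : ℕ} (H : Fin m → Fin n → ℂ) (hH : ‖H‖ ≤ 1) :
    ENNReal.ofReal (((Real.pi⁻¹ * Real.exp (-1)) ^ n) ^ m) ≤ ∏ i, ∏ j, gden (H i j) := by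
  have h1 : ∀ i j, ENNReal.ofReal (Real.pi⁻¹ * Real.exp (-1)) ≤ gden (H i j) := fun i j => by
    have : ‖H i j‖ ≤ 1 := ((norm_le_pi_norm _ j).trans (norm_le_pi_norm _ i)).trans hH
    have h2 : ‖H i j‖ ^ 2 ≤ 1 := pow_le_one₀ (norm_nonneg _) this
    refine ENNReal.ofReal_le_ofReal ?_
    gcongr
  calc _ = ∏ i : Fin m, ∏ j : Fin n, ENNReal.ofReal (Real.pi⁻¹ * Real.exp (-1)) := by
        rw [ENNReal.ofReal_pow (by positivity), ENNReal.ofReal_pow (by positivity)]; simp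
  _ ≤ _ := Finset.prod_le_prod' fun i _ => Finset.prod_le_prod' fun j _ => h1 _ _

/-- Upper bound on Gaussian probabilities (Chernoff). -/
lemma Gam_upper {m n : ℕ} {t ρ B : ℝ} (ht : 0 < t) (hρ : 0 ≤ ρ) (hB : 0 < B) :
    Gam m n {H | gG ρ H < B} ≤ ENNReal.ofReal (B ^ t) * FF m n t 1 ρ := by
  have hms : MeasurableSet {H : Fin m → Fin n → ℂ | gG ρ H < B} :=
    measurableSet_lt (measurable_gG ρ) measurable_const
  rw [Gam_eq, withDensity_apply _ hms, FF, ← lintegral_const_mul _ (measurable_ff t 1 ρ),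
    ← lintegral_indicator hms]
  refine lintegral_mono fun H => ?_
  by_cases hH : gG ρ H < B
  · rw [Set.indicator_of_mem (by exact hH)]
    refine (prod_gden_le H).trans ?_
    rw [← ENNReal.ofReal_mul (by positivity)]
    refine ENNReal.ofReal_le_ofReal ?_
    have hg := one_le_gG hρ H
    have : 1 ≤ B ^ t * gG ρ H ^ (-t) := by
      rw [Real.rpow_neg (by linarith), ← div_eq_mul_inv, one_le_div (by positivity)]
      exact Real.rpow_le_rpow (by linarith) hH.le ht.le
    rw [ff, ← mul_assoc]
    exact le_mul_of_one_le_left (Real.exp_pos _).le this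
  · rw [Set.indicator_of_notMem (by exact hH)]
    exact bot_le

lemma Gam_lower {m n : ℕ} {ρ B B' : ℝ} (hB : B < B') :
    ENNReal.ofReal (((Real.pi⁻¹ * Real.exp (-1)) ^ n) ^ m) * volume (lowSet m n 1 ρ B) ≤
      Gam m n {H | gG ρ H < B'} := by
  refine le_trans ?_ (measure_mono (s := lowSet m n 1 ρ B) fun H hH => lt_of_le_of_lt hH.2 hB)
  have hms := measurableSet_lowSet m n 1 ρ B
  rw [Gam_eq, withDensity_apply _ hms, ← setLIntegral_const]
  exact setLIntegral_mono' hms fun H hH => le_prod_gden H hH.1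

end FBL

namespace FBL
open MeasureTheory ProbabilityTheory Filter
open scoped ENNReal NNReal

/-- `p` has SNR exponent `-d`. -/
def HasExp (p : ℝ → ℝ) (d : ℝ) : Prop :=
  ∀ ε : ℝ, 0 < ε → ∀ᶠ ρ in atTop, ρ ^ (-d - ε) ≤ p ρ ∧ p ρ ≤ ρ ^ (-d + ε)

lemma const_ev (K : ℝ) {ε : ℝ} (hε : 0 < ε) : ∀ᶠ ρ : ℝ in atTop, K < ρ ^ ε :=
  (tendsto_rpow_atTop hε).eventually_gt_atTop K

lemma HasExp_one : HasExp (fun _ => 1) 0 := by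
  intro ε hε
  filter_upwards [eventually_ge_atTop 1] with ρ hρ
  exact ⟨Real.rpow_le_one_of_one_le_of_nonpos hρ (by linarith), Real.one_le_rpow hρ (by linarith)⟩

lemma HasExp.mul {p q : ℝ → ℝ} {d e : ℝ} (hp : HasExp p d) (hq : HasExp q e) :
    HasExp (fun ρ => p ρ * q ρ) (d + e) := by
  intro ε hε
  filter_upwards [hp (ε/2) (by linarith), hq (ε/2) (by linarith), eventually_gt_atTop 0] with ρ h1 h2 h0
  have a1 := Real.rpow_pos_of_pos h0 (-d - ε/2)
  have a2 := Real.rpow_pos_of_pos h0 (-e - ε/2)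
  constructor
  · calc ρ ^ (-(d+e) - ε) = ρ ^ (-d - ε/2) * ρ ^ (-e - ε/2) := by
          rw [← Real.rpow_add h0]; congr 1; ring
    _ ≤ _ := mul_le_mul h1.1 h2.1 a2.le (a1.le.trans h1.1)
  · calc p ρ * q ρ ≤ ρ ^ (-d + ε/2) * ρ ^ (-e + ε/2) := by
          gcongr
          · linarith [h2.1]
          · exact h1.2
          · exact h2.2
    _ = _ := by rw [← Real.rpow_add h0]; congr 1; ring

lemma HasExp.tendsto {p : ℝ → ℝ} {d : ℝ} (hp : HasExp p d) :
    Tendsto (fun ρ => Real.log (p ρ) / Real.log ρ) atTop (nhds (-d)) := by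
  rw [Metric.tendsto_nhds]
  intro ε hε
  filter_upwards [hp (ε/2) (by linarith), eventually_gt_atTop 1] with ρ h1 h0
  have hρ : 0 < ρ := by linarith
  have hl : 0 < Real.log ρ := Real.log_pos h0
  have hp0 : 0 < p ρ := (Real.rpow_pos_of_pos hρ _).trans_le h1.1
  have e1 := Real.log_le_log (Real.rpow_pos_of_pos hρ _) h1.1
  have e2 := Real.log_le_log hp0 h1.2
  rw [Real.log_rpow hρ] at e1 e2
  have e3 := (le_div_iff₀ hl).2 e1
  have e4 := (div_le_iff₀ hl).2 e2
  rw [Real.dist_eq, abs_lt]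
  constructor <;> linarith

/-- finite unions: exponent of something between the max and the sum -/
lemma HasExp.union {ι : Type*} (s : Finset ι) (p : ι → ℝ → ℝ) (d : ι → ℝ) (P : ℝ → ℝ)
    (hp : ∀ i ∈ s, HasExp (p i) (d i)) (i0 : ι) (hi0 : i0 ∈ s) (hmin : ∀ i ∈ s, d i0 ≤ d i)
    (h1 : ∀ᶠ ρ in atTop, p i0 ρ ≤ P ρ) (h2 : ∀ᶠ ρ in atTop, P ρ ≤ ∑ i ∈ s, p i ρ) :
    HasExp P (d i0) := by
  intro ε hε
  have hall : ∀ᶠ ρ in atTop, ∀ i ∈ s, p i ρ ≤ ρ ^ (-d i + ε/2) := by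
    rw [Filter.eventually_all_finset]
    intro i hi
    filter_upwards [hp i hi (ε/2) (by linarith)] with ρ h using h.2
  filter_upwards [hp i0 hi0 ε hε, h1, h2, hall, const_ev (s.card : ℝ) (show 0 < ε/2 by linarith),
    eventually_ge_atTop 1] with ρ a1 a2 a3 a4 a5 a6
  refine ⟨a1.1.trans a2, a3.trans ?_⟩
  have hρ : 0 < ρ := by linarith
  calc ∑ i ∈ s, p i ρ ≤ ∑ i ∈ s, ρ ^ (-d i0 + ε/2) := by
        refine Finset.sum_le_sum fun i hi => (a4 i hi).trans ?_
        exact Real.rpow_le_rpow_of_exponent_le a6 (by linarith [hmin i hi])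
  _ = s.card * ρ ^ (-d i0 + ε/2) := by simp
  _ ≤ ρ ^ (ε/2) * ρ ^ (-d i0 + ε/2) := by gcongr
  _ = _ := by rw [← Real.rpow_add hρ]; congr 1; ring

theorem channel_exp (m n M : ℕ) (hM : 0 < M) (s : ℝ) (hs : 0 < s) :
    HasExp (fun ρ => (Gam m n {H | gG (ρ / M) H < ρ ^ s}).toReal) (dmt m n s) := by
  intro ε hε
  have hM1 : (1 : ℝ) ≤ M := by exact_mod_cast hM
  have hM0 : (0 : ℝ) < M := by linarith
  refine Eventually.and ?_ ?_
  · rw [dmt_eq m n s hs.le]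
    have hc : ∀ᶠ s' in nhdsWithin s (Set.Iio s), dd m n s' < dd m n s + ε / 2 :=
      ((continuous_dd m n).continuousAt.eventually_lt_const (by linarith)).filter_mono
        nhdsWithin_le_nhds
    have hc2 : ∀ᶠ s' in nhdsWithin s (Set.Iio s), 0 < s' :=
      (continuousAt_id.eventually_const_lt hs).filter_mono nhdsWithin_le_nhds
    obtain ⟨s', ⟨h1, h2⟩, h3⟩ := ((hc.and hc2).and self_mem_nhdsWithin).exists
    have h3 : s' < s := h3
    obtain ⟨c, C, hc0, hC0, hlow⟩ := low_bound m n 1 s' one_pos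
    set k := ((Real.pi⁻¹ * Real.exp (-1)) ^ n) ^ m with hk
    have hk0 : 0 < k := by positivity
    have hMp : 0 < (M : ℝ) ^ (-dd m n s') := Real.rpow_pos_of_pos hM0 _
    filter_upwards [eventually_ge_atTop (M : ℝ), const_ev C (sub_pos.2 h3),
      const_ev ((k * (c * ((M : ℝ) ^ (-dd m n s'))⁻¹))⁻¹) (show 0 < ε / 2 by linarith)] with ρ a1 a2 a3
    have hρ0 : 0 < ρ := by linarith
    have hρM : 1 ≤ ρ / M := (one_le_div hM0).2 a1
    have hlt : C * (ρ / M) ^ (max s' 0) < ρ ^ s := by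
      rw [max_eq_left h2.le]
      calc C * (ρ / M) ^ s' ≤ C * ρ ^ s' := by
            gcongr
            exact div_le_self hρ0.le hM1
      _ < ρ ^ (s - s') * ρ ^ s' := by
            have := Real.rpow_pos_of_pos hρ0 s'
            gcongr
      _ = ρ ^ s := by rw [← Real.rpow_add hρ0]; congr 1; ring
    have hG := (mul_le_mul_right (hlow _ hρM) (ENNReal.ofReal k)).trans
      (Gam_lower (m := m) (n := n) (ρ := ρ / M) hlt)
    rw [← ENNReal.ofReal_mul hk0.le] at hG
    have hG' := (ENNReal.ofReal_le_iff_le_toReal (measure_ne_top _ _)).1 hG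
    refine le_trans ?_ hG'
    rw [Real.div_rpow hρ0.le hM0.le]
    have a4 : 1 ≤ (k * (c * ((M : ℝ) ^ (-dd m n s'))⁻¹)) * ρ ^ (ε / 2) := by
      have hpos : 0 < k * (c * ((M : ℝ) ^ (-dd m n s'))⁻¹) := by positivity
      rw [← inv_mul_le_iff₀ hpos, mul_one]
      exact a3.le
    calc ρ ^ (-dd m n s - ε) ≤ ρ ^ (-dd m n s' - ε / 2) :=
          Real.rpow_le_rpow_of_exponent_le (by linarith) (by linarith)
    _ ≤ ((k * (c * ((M : ℝ) ^ (-dd m n s'))⁻¹)) * ρ ^ (ε / 2)) * ρ ^ (-dd m n s' - ε / 2) :=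
          le_mul_of_one_le_left (by positivity) a4
    _ = (k * (c * ((M : ℝ) ^ (-dd m n s'))⁻¹)) * (ρ ^ (ε / 2) * ρ ^ (-dd m n s' - ε / 2)) := by ring
    _ = (k * (c * ((M : ℝ) ^ (-dd m n s'))⁻¹)) * ρ ^ (-dd m n s') := by
          rw [← Real.rpow_add hρ0]; congr 2; ring
    _ = _ := by rw [div_eq_mul_inv]; ring
  · by_cases hsmn : s < m ∧ s < n
    · rw [dmt_eq m n s hs.le]
      obtain ⟨t, ht, -, hleg⟩ := legendre m n s hs.le hsmn.1 hsmn.2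
      obtain ⟨C, hC, hF⟩ := FF_bound m n t 1 (ε/2) ht one_pos (by linarith)
      have hMp : 0 < (M : ℝ) ^ (-phi m n t + ε / 2) := Real.rpow_pos_of_pos hM0 _
      filter_upwards [eventually_ge_atTop (M : ℝ),
        const_ev (C * ((M : ℝ) ^ (-phi m n t + ε / 2))⁻¹) (show 0 < ε / 2 by linarith)] with ρ a1 a3
      have hρ0 : 0 < ρ := by linarith
      have hρM : 1 ≤ ρ / M := (one_le_div hM0).2 a1
      have hG := (Gam_upper (m := m) (n := n) (ρ := ρ / M) ht (by linarith)
        (Real.rpow_pos_of_pos hρ0 s)).trans (mul_le_mul_right (hF _ hρM) _)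
      rw [← ENNReal.ofReal_mul (by positivity)] at hG
      refine (ENNReal.toReal_le_of_le_ofReal (by positivity) hG).trans ?_
      rw [Real.div_rpow hρ0.le hM0.le, ← Real.rpow_mul hρ0.le]
      calc ρ ^ (s * t) * (C * (ρ ^ (-phi m n t + ε / 2) / (M : ℝ) ^ (-phi m n t + ε / 2)))
          = (C * ((M : ℝ) ^ (-phi m n t + ε / 2))⁻¹) * (ρ ^ (s * t) * ρ ^ (-phi m n t + ε / 2)) := by
            rw [div_eq_mul_inv]; ring
      _ ≤ ρ ^ (ε / 2) * (ρ ^ (s * t) * ρ ^ (-phi m n t + ε / 2)) := by gcongr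
      _ = ρ ^ (ε / 2 + (s * t + (-phi m n t + ε / 2))) := by
            rw [← Real.rpow_add hρ0, ← Real.rpow_add hρ0]
      _ ≤ _ := Real.rpow_le_rpow_of_exponent_le (by linarith) (by linarith)
    · rw [dmt_ge hsmn]
      filter_upwards [eventually_ge_atTop 1] with ρ hρ
      refine le_trans ?_ (Real.one_le_rpow hρ (by linarith))
      exact ENNReal.toReal_le_of_le_ofReal zero_le_one (by simpa using prob_le_one)

end FBL

namespace FBL
open MeasureTheory ProbabilityTheory Filter
open scoped ENNReal NNReal

lemma lt_decTime {C R : ℝ} (hC : 0 ≤ C) (hR : 0 < R) (l : ℕ) :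
    (l : ℕ∞) < decTime C R ↔ (l : ℝ) * C < R := by
  constructor
  · intro h
    by_contra hc
    rw [not_lt] at hc
    have hl : 1 ≤ l := by
      by_contra h0
      have : l = 0 := by omega
      rw [this] at hc
      simp at hc
      linarith
    exact absurd (sInf_le ⟨l, rfl, hl, hc⟩ : decTime C R ≤ l) (not_le.2 h)
  · intro h
    have h1 : ((l + 1 : ℕ) : ℕ∞) ≤ decTime C R := by
      refine le_sInf ?_
      rintro _ ⟨n, rfl, hn, hnR⟩
      have : l < n := by
        by_contra hc
        rw [not_lt] at hc
        have : (n : ℝ) * C ≤ l * C := by gcongr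
        linarith
      exact_mod_cast this
    refine lt_of_lt_of_le ?_ h1
    exact_mod_cast Nat.lt_succ_self l

lemma lt_add_iff_exists {a b : ℕ∞} (ha : 0 < a) (hb : 0 < b) {L : ℕ} (hL : 1 ≤ L) :
    (L : ℕ∞) < a + b ↔ ∃ l1 l2 : ℕ, l1 + l2 = L - 1 ∧ (l1 : ℕ∞) < a ∧ (l2 : ℕ∞) < b := by
  cases a with
  | top =>
    simp only [top_add, ENat.natCast_lt_top, true_iff]
    exact ⟨L - 1, 0, by omega, trivial, by simpa using hb⟩
  | coe a =>
    cases b with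
    | top =>
      simp only [add_top, ENat.natCast_lt_top, true_iff]
      exact ⟨0, L - 1, by omega, by simpa using ha, trivial⟩
    | coe b =>
      have ha : 0 < a := by exact_mod_cast ha
      have hb : 0 < b := by exact_mod_cast hb
      have e : ((L : ℕ∞) < (a : ℕ∞) + b) ↔ L < a + b := by norm_cast
      rw [e]
      simp only [Nat.cast_lt]
      constructor
      · intro h
        exact ⟨min (a - 1) (L - 1), L - 1 - min (a - 1) (L - 1), by omega, by omega, by omega⟩
      · rintro ⟨l1, l2, h1, h2, h3⟩
        omega

/-- outage set -/
def outSet (m n M : ℕ) (r ρ : ℝ) (l : ℕ) : Set (Fin m → Fin n → ℂ) :=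
  {H | (l : ℝ) * Real.log (gG (ρ / M) H) < r * Real.log ρ}

lemma measurableSet_outSet (m n M : ℕ) (r ρ : ℝ) (l : ℕ) : MeasurableSet (outSet m n M r ρ l) := by
  have := measurable_gG (m := m) (n := n) (ρ / M)
  exact measurableSet_lt (by fun_prop) measurable_const

lemma out_exp (m n M : ℕ) (hM : 0 < M) (r : ℝ) (hr : 0 < r) (l : ℕ) :
    HasExp (fun ρ => (Gam m n (outSet m n M r ρ l)).toReal) (dmtDiv m n r l) := by
  have hM0 : (0 : ℝ) < M := by exact_mod_cast hM
  rw [dmtDiv]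
  split_ifs with h
  · intro ε hε
    filter_upwards [HasExp_one ε hε, eventually_gt_atTop 1] with ρ h1 h2
    have : outSet m n M r ρ l = Set.univ := by
      ext H
      have := Real.log_pos h2
      simp only [outSet, Set.mem_ofPred_eq, h, Nat.cast_zero, zero_mul, Set.mem_univ, iff_true]
      positivity
    rw [this]
    simpa using h1
  · have hl : (0 : ℝ) < l := by exact_mod_cast Nat.pos_of_ne_zero h
    intro ε hε
    filter_upwards [channel_exp m n M hM (r / l) (by positivity) ε hε, eventually_gt_atTop 1] with ρ h1 h2
    have hρ : 0 < ρ := by linarith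
    have : outSet m n M r ρ l = {H | gG (ρ / M) H < ρ ^ (r / l)} := by
      ext H
      have hg := one_le_gG (show 0 ≤ ρ / M by positivity) H
      simp only [outSet, Set.mem_ofPred_eq]
      rw [← Real.log_lt_log_iff (by linarith) (Real.rpow_pos_of_pos hρ _), Real.log_rpow hρ,
        div_mul_eq_mul_div, lt_div_iff₀ hl, mul_comm]
    rw [this]
    exact h1

lemma gam_rect {A B : Set ℝ} :
    gam {z | z.re ∈ A ∧ z.im ∈ B} = gaussianReal 0 (1/2) A * gaussianReal 0 (1/2) B := by
  unfold gam
  rw [MeasurableEquiv.map_apply, ← Measure.prod_prod]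
  congr 1

/-- real coordinates of a pair of complex matrices -/
def JJ {a b c d : ℕ} (y : (Fin a → Fin b → ℂ) × (Fin c → Fin d → ℂ)) :
    ((Fin a × Fin b) ⊕ (Fin c × Fin d)) × Bool → ℝ := fun p =>
  Sum.elim (fun q => if p.2 then (y.1 q.1 q.2).re else (y.1 q.1 q.2).im)
    (fun q => if p.2 then (y.2 q.1 q.2).re else (y.2 q.1 q.2).im) p.1

def KKinv {a b c d : ℕ} (x : ((Fin a × Fin b) ⊕ (Fin c × Fin d)) × Bool → ℝ) :
    (Fin a → Fin b → ℂ) × (Fin c → Fin d → ℂ) :=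
  (fun i j => (x (Sum.inl (i, j), true) : ℂ) + (x (Sum.inl (i, j), false) : ℂ) * Complex.I,
   fun i j => (x (Sum.inr (i, j), true) : ℂ) + (x (Sum.inr (i, j), false) : ℂ) * Complex.I)

lemma KKinv_JJ {a b c d : ℕ} (y : (Fin a → Fin b → ℂ) × (Fin c → Fin d → ℂ)) : KKinv (JJ y) = y := by
  ext i j <;> simp [KKinv, JJ, Complex.re_add_im]

lemma measurable_KKinv {a b c d : ℕ} : Measurable (KKinv (a := a) (b := b) (c := c) (d := d)) := by
  unfold KKinv
  fun_prop

lemma measurable_JJ {a b c d : ℕ} : Measurable (JJ (a := a) (b := b) (c := c) (d := d)) := by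
  refine measurable_pi_lambda _ fun p => ?_
  obtain ⟨p | p, _ | _⟩ := p <;> simp only [JJ, Sum.elim_inl, Sum.elim_inr] <;> simp <;> fun_prop

lemma map_JJ (a b c d : ℕ) : Measure.map JJ ((Gam a b).prod (Gam c d)) =
    Measure.pi (fun _ : ((Fin a × Fin b) ⊕ (Fin c × Fin d)) × Bool => gaussianReal 0 (1/2)) := by
  symm
  refine Measure.pi_eq fun s hs => ?_
  rw [Measure.map_apply measurable_JJ (MeasurableSet.univ_pi hs)]
  have : JJ ⁻¹' (Set.univ.pi s) =
      (Set.univ.pi fun i : Fin a => Set.univ.pi fun j : Fin b =>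
        {z : ℂ | z.re ∈ s (Sum.inl (i, j), true) ∧ z.im ∈ s (Sum.inl (i, j), false)}) ×ˢ
      (Set.univ.pi fun i : Fin c => Set.univ.pi fun j : Fin d =>
        {z : ℂ | z.re ∈ s (Sum.inr (i, j), true) ∧ z.im ∈ s (Sum.inr (i, j), false)}) := by
    ext y
    simp [JJ, Set.mem_pi, Prod.forall, Sum.forall]
    constructor
    · rintro ⟨h1, h2⟩
      exact ⟨fun i j => ⟨(h1 i j).2, (h1 i j).1⟩, fun i j => ⟨(h2 i j).2, (h2 i j).1⟩⟩
    · rintro ⟨h1, h2⟩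
      exact ⟨fun i j => ⟨(h1 i j).2, (h1 i j).1⟩, fun i j => ⟨(h2 i j).2, (h2 i j).1⟩⟩
  rw [this, Measure.prod_prod]
  simp only [Gam, Measure.pi_pi, gam_rect]
  simp only [Fintype.prod_prod_type, Fintype.prod_sum_type, Fintype.prod_bool]

lemma law {Ω : Type*} [MeasurableSpace Ω] (P : Measure Ω) {a b c d : ℕ}
    (Y : Ω → (Fin a → Fin b → ℂ) × (Fin c → Fin d → ℂ))
    (h : Measure.map (fun ω => JJ (Y ω)) P = Measure.pi (fun _ => gaussianReal 0 (1/2)))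
    (B : Set ((Fin a → Fin b → ℂ) × (Fin c → Fin d → ℂ))) (hB : MeasurableSet B) :
    P (Y ⁻¹' B) = ((Gam a b).prod (Gam c d)) B := by
  have hX : AEMeasurable (fun ω => JJ (Y ω)) P := by
    by_contra hc
    rw [Measure.map_of_not_aemeasurable hc] at h
    have := congrArg (fun μ => μ Set.univ) h
    simp at this
  have hB' : MeasurableSet (KKinv ⁻¹' B) := measurable_KKinv hB
  have e1 := Measure.map_apply_of_aemeasurable hX hB'
  rw [h, ← map_JJ, Measure.map_apply measurable_JJ hB'] at e1
  have e2 : JJ ⁻¹' (KKinv ⁻¹' B) = B := by ext y; simp [KKinv_JJ]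
  have e3 : (fun ω => JJ (Y ω)) ⁻¹' (KKinv ⁻¹' B) = Y ⁻¹' B := by ext y; simp [KKinv_JJ]
  rw [e2, e3] at e1
  exact e1.symm

end FBL

theorem FBL_DMDT_threeNode_longTerm
    {Ω : Type*} [MeasurableSpace Ω] (P : Measure Ω) [IsProbabilityMeasure P]
    (M1 M2 M3 : ℕ) (hM1 : 0 < M1) (hM2 : 0 < M2) (hM3 : 0 < M3)
    (L : ℕ) (hL : 2 ≤ L) (r : ℝ) (hr : 0 < r)
    (H1 : Ω → Matrix (Fin M2) (Fin M1) ℂ) (H2 : Ω → Matrix (Fin M3) (Fin M2) ℂ)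
    (hGauss : Measure.map
      (fun ω (p : ((Fin M2 × Fin M1) ⊕ (Fin M3 × Fin M2)) × Bool) =>
        Sum.elim
          (fun q => if p.2 then (H1 ω q.1 q.2).re else (H1 ω q.1 q.2).im)
          (fun q => if p.2 then (H2 ω q.1 q.2).re else (H2 ω q.1 q.2).im) p.1) P
      = Measure.pi (fun _ => gaussianReal 0 (1/2))) :
    Filter.Tendsto (fun ρ : ℝ =>
        Real.log ((P {ω | decTime (cap M1 ρ (H1 ω)) (r * Real.log ρ)
                          + decTime (cap M2 ρ (H2 ω)) (r * Real.log ρ)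
                          > (L : ℕ∞)}).toReal)
          / Real.log ρ)
      Filter.atTop
      (nhds (-(sInf {x : ℝ | ∃ l1 l2 : ℕ, l1 + l2 = L - 1 ∧
          x = dmtDiv M1 M2 r l1 + dmtDiv M2 M3 r l2}))) := by
  have hsymm : ∀ (m n l : ℕ), dmtDiv m n r l = dmtDiv n m r l := fun m n l => by
    simp only [dmtDiv, FBL.dmt_symm m n]
  let s := Finset.HasAntidiagonal.antidiagonal (L - 1)
  let d : ℕ × ℕ → ℝ := fun x => dmtDiv M2 M1 r x.1 + dmtDiv M3 M2 r x.2
  have hne : s.Nonempty := ⟨(L - 1, 0), by simp [s]⟩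
  obtain ⟨x0, hx0, hmin⟩ := s.exists_min_image d hne
  have hinf : sInf {x : ℝ | ∃ l1 l2 : ℕ, l1 + l2 = L - 1 ∧
      x = dmtDiv M1 M2 r l1 + dmtDiv M2 M3 r l2} = d x0 := by
    refine IsLeast.csInf_eq ⟨⟨x0.1, x0.2, Finset.HasAntidiagonal.mem_antidiagonal.1 hx0, ?_⟩, ?_⟩
    · simp only [d, hsymm M2 M1, hsymm M3 M2]
    · rintro _ ⟨l1, l2, h, rfl⟩
      rw [hsymm M1 M2, hsymm M2 M3]
      exact hmin (l1, l2) (Finset.HasAntidiagonal.mem_antidiagonal.2 h)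
  rw [hinf]
  let A : ℝ → ℕ × ℕ → Set ((Fin M2 → Fin M1 → ℂ) × (Fin M3 → Fin M2 → ℂ)) := fun ρ x =>
    FBL.outSet M2 M1 M1 r ρ x.1 ×ˢ FBL.outSet M3 M2 M2 r ρ x.2
  let Q := (FBL.Gam M2 M1).prod (FBL.Gam M3 M2)
  have hA : ∀ ρ x, MeasurableSet (A ρ x) := fun ρ x =>
    (FBL.measurableSet_outSet _ _ _ _ _ _).prod (FBL.measurableSet_outSet _ _ _ _ _ _)
  have hPQ : ∀ ρ : ℝ, 1 < ρ → P {ω | decTime (cap M1 ρ (H1 ω)) (r * Real.log ρ)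
      + decTime (cap M2 ρ (H2 ω)) (r * Real.log ρ) > (L : ℕ∞)} = Q (⋃ x ∈ s, A ρ x) := by
    intro ρ hρ
    have hR : 0 < r * Real.log ρ := mul_pos hr (Real.log_pos hρ)
    rw [← FBL.law P (fun ω => (H1 ω, H2 ω)) hGauss _ (Finset.measurableSet_biUnion s fun x _ => hA ρ x)]
    congr 1
    ext ω
    have c1 : cap M1 ρ (H1 ω) = Real.log (FBL.gG (ρ / M1) (H1 ω)) := rfl
    have c2 : cap M2 ρ (H2 ω) = Real.log (FBL.gG (ρ / M2) (H2 ω)) := rfl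
    have p1 : 0 ≤ cap M1 ρ (H1 ω) := by
      rw [c1]; exact Real.log_nonneg (FBL.one_le_gG (by positivity) _)
    have p2 : 0 ≤ cap M2 ρ (H2 ω) := by
      rw [c2]; exact Real.log_nonneg (FBL.one_le_gG (by positivity) _)
    have z1 : 0 < decTime (cap M1 ρ (H1 ω)) (r * Real.log ρ) := by
      simpa [hR] using (FBL.lt_decTime p1 hR 0).2 (by simpa using hR)
    have z2 : 0 < decTime (cap M2 ρ (H2 ω)) (r * Real.log ρ) := by
      simpa [hR] using (FBL.lt_decTime p2 hR 0).2 (by simpa using hR)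
    have key := FBL.lt_add_iff_exists z1 z2 (show 1 ≤ L by omega)
    refine key.trans ?_
    simp only [FBL.lt_decTime p1 hR, FBL.lt_decTime p2 hR, Set.mem_preimage, Set.mem_iUnion]
    constructor
    · rintro ⟨l1, l2, h, h1, h2⟩
      exact ⟨(l1, l2), Finset.HasAntidiagonal.mem_antidiagonal.2 h, h1, h2⟩
    · rintro ⟨x, h, h1, h2⟩
      exact ⟨x.1, x.2, Finset.HasAntidiagonal.mem_antidiagonal.1 h, h1, h2⟩
  refine FBL.HasExp.tendsto ?_
  refine FBL.HasExp.union s (fun x ρ => (Q (A ρ x)).toReal) d _ ?_ x0 hx0 hmin ?_ ?_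
  · intro x _
    have := (FBL.out_exp M2 M1 M1 hM1 r hr x.1).mul (FBL.out_exp M3 M2 M2 hM2 r hr x.2)
    simpa only [Q, A, Measure.prod_prod, ENNReal.toReal_mul] using this
  · filter_upwards [Filter.eventually_gt_atTop 1] with ρ hρ
    rw [hPQ ρ hρ]
    exact ENNReal.toReal_mono (measure_ne_top _ _)
      (measure_mono (Set.subset_biUnion_of_mem (u := fun x => A ρ x) hx0))
  · filter_upwards [Filter.eventually_gt_atTop 1] with ρ hρ
    rw [hPQ ρ hρ, ← ENNReal.toReal_sum (fun x _ => measure_ne_top _ _)]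
    refine ENNReal.toReal_mono ?_ (measure_biUnion_finset_le s _)
    exact (ENNReal.sum_lt_top.2 fun x _ => measure_lt_top _ _).ne
end
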